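/- (Local form of Proposition 2.1 of the paper.) Let J be an almost complex structure on a connected open set U ⊆ ℂ² and let α be a closed J-anti-invariant 2-form on U which is not identically zero. Then the zero set Z := {x ∈ U : α(x) = 0} is closed in U, and for every compact subset K ⊆ U the 2-dimensional Hausdorff measure of Z ∩ K is finite; in particular Z has Hausdorff dimension at most 2. -/

import Mathlib

open Complex Metric MeasureTheory

/-- An almost complex structure on an open set `U ⊆ ℂ²`. -/
def IsAlmostComplexOn (J : ℂ × ℂ → (ℂ × ℂ →L[ℝ] ℂ × ℂ)) (U : Set (ℂ × ℂ)) : Prop :=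
  ContDiffOn ℝ (⊤ : ℕ∞) J U ∧ ∀ x ∈ U, ∀ X : ℂ × ℂ, J x (J x X) = -X

/-- The open unit disk in `ℂ`. -/
def unitDisk : Set ℂ := ball (0 : ℂ) 1

/-- An embedded `J`-holomorphic disk in `U`. -/
def IsEmbeddedJHolDisk (J : ℂ × ℂ → (ℂ × ℂ →L[ℝ] ℂ × ℂ)) (U : Set (ℂ × ℂ))
    (u : ℂ → ℂ × ℂ) : Prop :=
  ContDiffOn ℝ (⊤ : ℕ∞) u unitDisk ∧ Set.InjOn u unitDisk ∧
    Set.MapsTo u unitDisk U ∧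
    (∀ z ∈ unitDisk, Function.Injective (fderiv ℝ u z)) ∧
    ∀ z ∈ unitDisk, ∀ v : ℂ, fderiv ℝ u z (Complex.I * v) = J (u z) (fderiv ℝ u z v)

/-- A (smooth, alternating) 2-form on an open set `U ⊆ ℂ²`. -/
def IsTwoFormOn (α : ℂ × ℂ → (ℂ × ℂ →L[ℝ] ℂ × ℂ →L[ℝ] ℝ)) (U : Set (ℂ × ℂ)) : Prop :=
  ContDiffOn ℝ (⊤ : ℕ∞) α U ∧ ∀ x ∈ U, ∀ X : ℂ × ℂ, α x X X = 0

/-- `J`-anti-invariance of a 2-form on `U`. -/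
def IsJAntiInvariantOn (J : ℂ × ℂ → (ℂ × ℂ →L[ℝ] ℂ × ℂ))
    (α : ℂ × ℂ → (ℂ × ℂ →L[ℝ] ℂ × ℂ →L[ℝ] ℝ)) (U : Set (ℂ × ℂ)) : Prop :=
  ∀ x ∈ U, ∀ X Y : ℂ × ℂ, α x (J x X) (J x Y) = -α x X Y

/-- Closedness of a 2-form on `U`. -/
def IsClosedTwoFormOn (α : ℂ × ℂ → (ℂ × ℂ →L[ℝ] ℂ × ℂ →L[ℝ] ℝ))
    (U : Set (ℂ × ℂ)) : Prop :=
  ∀ x ∈ U, ∀ X Y Z : ℂ × ℂ,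
    fderiv ℝ α x X Y Z - fderiv ℝ α x Y X Z + fderiv ℝ α x Z X Y = 0


set_option linter.all false
set_option linter.style.longLine false

abbrev CC := ℂ × ℂ

def ss (x : CC) : ℝ := x.1.re ^ 2 + x.1.im ^ 2 + x.2.re ^ 2 + x.2.im ^ 2

noncomputable def ipL (x : CC) : CC →L[ℝ] ℝ :=
  x.1.re • (reCLM.comp (ContinuousLinearMap.fst ℝ ℂ ℂ)) +
  x.1.im • (imCLM.comp (ContinuousLinearMap.fst ℝ ℂ ℂ)) +
  x.2.re • (reCLM.comp (ContinuousLinearMap.snd ℝ ℂ ℂ)) +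
  x.2.im • (imCLM.comp (ContinuousLinearMap.snd ℝ ℂ ℂ))

theorem ipL_apply (x y : CC) : ipL x y =
    x.1.re * y.1.re + x.1.im * y.1.im + x.2.re * y.2.re + x.2.im * y.2.im := by
  simp [ipL]

theorem ipL_self (x : CC) : ipL x x = ss x := by
  rw [ipL_apply, ss]; ring

theorem ss_nonneg (x : CC) : 0 ≤ ss x := by unfold ss; positivity

theorem ss_pos {x : CC} (hx : x ≠ 0) : 0 < ss x := by
  rcases (ss_nonneg x).eq_or_lt with h | h
  · exfalso; apply hx
    unfold ss at h
    have h1 : x.1.re = 0 := by nlinarith [sq_nonneg x.1.re, sq_nonneg x.1.im, sq_nonneg x.2.re, sq_nonneg x.2.im]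
    have h2 : x.1.im = 0 := by nlinarith [sq_nonneg x.1.re, sq_nonneg x.1.im, sq_nonneg x.2.re, sq_nonneg x.2.im]
    have h3 : x.2.re = 0 := by nlinarith [sq_nonneg x.1.re, sq_nonneg x.1.im, sq_nonneg x.2.re, sq_nonneg x.2.im]
    have h4 : x.2.im = 0 := by nlinarith [sq_nonneg x.1.re, sq_nonneg x.1.im, sq_nonneg x.2.re, sq_nonneg x.2.im]
    apply Prod.ext <;> apply Complex.ext <;> simp [h1, h2, h3, h4]
  · exact h

noncomputable def tt (x : CC) : ℝ := Real.sqrt (Real.sqrt (ss x))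
noncomputable def ww (x : CC) : ℝ := (tt x)⁻¹
noncomputable def psi (x : CC) : ℝ := tt x - 2 * Real.log (tt x)

theorem tt_pos {x : CC} (hx : x ≠ 0) : 0 < tt x :=
  Real.sqrt_pos.2 (Real.sqrt_pos.2 (ss_pos hx))

theorem tt_nonneg (x : CC) : 0 ≤ tt x := Real.sqrt_nonneg _

theorem tt_sq (x : CC) : tt x ^ 2 = Real.sqrt (ss x) := Real.sq_sqrt (Real.sqrt_nonneg _)

theorem tt_pow4 (x : CC) : tt x ^ 4 = ss x := by
  rw [show tt x ^ 4 = (tt x ^ 2) ^ 2 by ring, tt_sq, Real.sq_sqrt (ss_nonneg x)]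

theorem norm_sq_le_ss (x : CC) : ‖x‖ ^ 2 ≤ ss x := by
  have h1 := Complex.sq_norm x.1
  have h2 := Complex.sq_norm x.2
  rw [Complex.normSq_apply] at h1 h2
  unfold ss
  rcases le_total ‖x.1‖ ‖x.2‖ with h | h
  · rw [Prod.norm_def, max_eq_right h]; nlinarith [sq_nonneg x.1.re, sq_nonneg x.1.im]
  · rw [Prod.norm_def, max_eq_left h]; nlinarith [sq_nonneg x.2.re, sq_nonneg x.2.im]

theorem ss_le_norm_sq (x : CC) : ss x ≤ 2 * ‖x‖ ^ 2 := by
  have h1 := Complex.sq_norm x.1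
  have h2 := Complex.sq_norm x.2
  rw [Complex.normSq_apply] at h1 h2
  have h3 : ‖x.1‖ ≤ ‖x‖ := norm_fst_le x
  have h4 : ‖x.2‖ ≤ ‖x‖ := norm_snd_le x
  unfold ss
  nlinarith [norm_nonneg x.1, norm_nonneg x.2, mul_self_le_mul_self (norm_nonneg _) h3, mul_self_le_mul_self (norm_nonneg _) h4]

theorem norm_le_tt_sq (x : CC) : ‖x‖ ≤ tt x ^ 2 := by
  rw [tt_sq]; exact Real.le_sqrt_of_sq_le (norm_sq_le_ss x)

theorem abs_ipL_le (x y : CC) : |ipL x y| ≤ 4 * ‖x‖ * ‖y‖ := by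
  have key : ∀ a b c d : ℝ, |a| ≤ ‖x‖ → |b| ≤ ‖y‖ → |a * b| ≤ ‖x‖ * ‖y‖ := by
    intro a b _ _ h1 h2
    rw [abs_mul]
    exact mul_le_mul h1 h2 (abs_nonneg _) (norm_nonneg _)
  have e1 := fun z : CC => (Complex.abs_re_le_norm z.1).trans (norm_fst_le z)
  have e2 := fun z : CC => (Complex.abs_im_le_norm z.1).trans (norm_fst_le z)
  have e3 := fun z : CC => (Complex.abs_re_le_norm z.2).trans (norm_snd_le z)
  have e4 := fun z : CC => (Complex.abs_im_le_norm z.2).trans (norm_snd_le z)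
  rw [ipL_apply]
  have f1 := abs_le.1 (key _ _ 0 0 (e1 x) (e1 y))
  have f2 := abs_le.1 (key _ _ 0 0 (e2 x) (e2 y))
  have f3 := abs_le.1 (key _ _ 0 0 (e3 x) (e3 y))
  have f4 := abs_le.1 (key _ _ 0 0 (e4 x) (e4 y))
  rw [abs_le]; constructor <;> linarith [f1.1, f1.2, f2.1, f2.2, f3.1, f3.2, f4.1, f4.2]

theorem hasFDerivAt_ss (x : CC) : HasFDerivAt ss ((2 : ℝ) • ipL x) x := by
  have h1 : HasFDerivAt (fun y : CC => y.1.re) (reCLM.comp (ContinuousLinearMap.fst ℝ ℂ ℂ)) x :=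
    (reCLM.comp (ContinuousLinearMap.fst ℝ ℂ ℂ)).hasFDerivAt
  have h2 : HasFDerivAt (fun y : CC => y.1.im) (imCLM.comp (ContinuousLinearMap.fst ℝ ℂ ℂ)) x :=
    (imCLM.comp (ContinuousLinearMap.fst ℝ ℂ ℂ)).hasFDerivAt
  have h3 : HasFDerivAt (fun y : CC => y.2.re) (reCLM.comp (ContinuousLinearMap.snd ℝ ℂ ℂ)) x :=
    (reCLM.comp (ContinuousLinearMap.snd ℝ ℂ ℂ)).hasFDerivAt
  have h4 : HasFDerivAt (fun y : CC => y.2.im) (imCLM.comp (ContinuousLinearMap.snd ℝ ℂ ℂ)) x :=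
    (imCLM.comp (ContinuousLinearMap.snd ℝ ℂ ℂ)).hasFDerivAt
  have := (((h1.pow 2).add (h2.pow 2)).add (h3.pow 2)).add (h4.pow 2)
  refine this.congr_fderiv ?_
  ext <;> simp [ipL] <;> ring

theorem contDiff_ss {n : WithTop ℕ∞} : ContDiff ℝ n ss := by
  have h1 : ContDiff ℝ n (fun y : CC => y.1.re) := (reCLM.comp (ContinuousLinearMap.fst ℝ ℂ ℂ)).contDiff
  have h2 : ContDiff ℝ n (fun y : CC => y.1.im) := (imCLM.comp (ContinuousLinearMap.fst ℝ ℂ ℂ)).contDiff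
  have h3 : ContDiff ℝ n (fun y : CC => y.2.re) := (reCLM.comp (ContinuousLinearMap.snd ℝ ℂ ℂ)).contDiff
  have h4 : ContDiff ℝ n (fun y : CC => y.2.im) := (imCLM.comp (ContinuousLinearMap.snd ℝ ℂ ℂ)).contDiff
  unfold ss
  exact (((h1.pow 2).add (h2.pow 2)).add (h3.pow 2)).add (h4.pow 2)

theorem contDiffAt_tt {n : WithTop ℕ∞} {x : CC} (hx : x ≠ 0) : ContDiffAt ℝ n tt x := by
  have h := ss_pos hx
  exact (contDiff_ss.contDiffAt.sqrt h.ne').sqrt (Real.sqrt_pos.2 h).ne'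

theorem contDiffAt_ww {n : WithTop ℕ∞} {x : CC} (hx : x ≠ 0) : ContDiffAt ℝ n ww x :=
  (contDiffAt_tt hx).inv (tt_pos hx).ne'

theorem contDiffAt_psi {n : WithTop ℕ∞} {x : CC} (hx : x ≠ 0) : ContDiffAt ℝ n psi x :=
  (contDiffAt_tt hx).sub (contDiffAt_const.mul ((contDiffAt_tt hx).log (tt_pos hx).ne'))

theorem continuous_tt : Continuous tt := by
  unfold tt; exact (contDiff_ss (n := 0)).continuous.sqrt.sqrt

theorem ww_pos {x : CC} (hx : x ≠ 0) : 0 < ww x := inv_pos.2 (tt_pos hx)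

theorem ww_mul_tt {x : CC} (hx : x ≠ 0) : ww x * tt x = 1 := inv_mul_cancel₀ (tt_pos hx).ne'

theorem hasFDerivAt_tt {x : CC} (hx : x ≠ 0) :
    HasFDerivAt tt ((1 / 2 * ww x ^ 3) • ipL x) x := by
  have h := ss_pos hx
  have := ((hasFDerivAt_ss x).sqrt h.ne').sqrt (Real.sqrt_pos.2 h).ne'
  refine this.congr_fderiv ?_
  rw [smul_smul, smul_smul]
  congr 1
  rw [← tt_sq, show √(tt x ^ 2) = tt x from Real.sqrt_sq (tt_nonneg x), ww]
  have := (tt_pos hx).ne'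
  field_simp

theorem hasFDerivAt_ww {x : CC} (hx : x ≠ 0) :
    HasFDerivAt ww ((-(1 / 2) * ww x ^ 5) • ipL x) x := by
  have h := (hasDerivAt_inv (tt_pos hx).ne').comp_hasFDerivAt x (hasFDerivAt_tt hx)
  refine h.congr_fderiv ?_
  rw [smul_smul]; congr 1
  rw [ww]
  have := (tt_pos hx).ne'
  field_simp

theorem hasFDerivAt_psi {x : CC} (hx : x ≠ 0) :
    HasFDerivAt psi ((1 / 2 * ww x ^ 3 - ww x ^ 4) • ipL x) x := by
  have h := (hasFDerivAt_tt hx).sub (((hasFDerivAt_tt hx).log (tt_pos hx).ne').const_mul 2)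
  refine h.congr_fderiv ?_
  rw [smul_smul, smul_smul, ← sub_smul]; congr 1
  rw [ww]
  have := (tt_pos hx).ne'
  field_simp

theorem hasFDerivAt_ww_pow {x : CC} (hx : x ≠ 0) (n : ℕ) :
    HasFDerivAt (fun y => ww y ^ n) ((-(n / 2) * ww x ^ (n + 4)) • ipL x) x := by
  have h := (hasFDerivAt_ww hx).pow n
  refine h.congr_fderiv ?_
  rcases n with _ | n
  · simp
  · rw [smul_smul]; congr 1
    simp; ring

/-- trace -/
noncomputable def trc (L : CC →L[ℝ] CC) : ℝ :=
  (L (1, 0)).1.re + (L (I, 0)).1.im + (L (0, 1)).2.re + (L (0, I)).2.im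

noncomputable def divg (W : CC → CC) (x : CC) : ℝ := trc (fderiv ℝ W x)

theorem decomp (V : CC) : V = V.1.re • ((1, 0) : CC) + V.1.im • ((I, 0) : CC) + V.2.re • ((0, 1) : CC) + V.2.im • ((0, I) : CC) := by
  apply Prod.ext <;> apply Complex.ext <;> simp

theorem apply_decomp {F : Type*} [NormedAddCommGroup F] [NormedSpace ℝ F] (P : CC →L[ℝ] F) (V : CC) :
    P V = V.1.re • P (1, 0) + V.1.im • P (I, 0) + V.2.re • P (0, 1) + V.2.im • P (0, I) := by
  conv_lhs => rw [decomp V]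
  simp only [map_add, map_smul]

theorem trc_smulRight (φ : CC →L[ℝ] ℝ) (V : CC) : trc (φ.smulRight V) = φ V := by
  rw [apply_decomp φ V]
  simp [trc]; ring

theorem trc_add (A B : CC →L[ℝ] CC) : trc (A + B) = trc A + trc B := by
  simp [trc]; ring

theorem trc_smul (c : ℝ) (A : CC →L[ℝ] CC) : trc (c • A) = c * trc A := by
  simp [trc]; ring

theorem trc_id : trc (ContinuousLinearMap.id ℝ CC) = 4 := by
  simp [trc]; norm_num

noncomputable def Icl : CC →L[ℝ] CC := ContinuousLinearMap.lsmul ℝ ℂ I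

theorem Icl_apply (x : CC) : Icl x = (I * x.1, I * x.2) := by
  simp [Icl, Prod.smul_def]

theorem trc_Icl : trc Icl = 0 := by
  simp [trc, Icl_apply]

theorem norm_basis : ‖((1, 0) : CC)‖ = 1 ∧ ‖((I, 0) : CC)‖ = 1 ∧ ‖((0, 1) : CC)‖ = 1 ∧ ‖((0, I) : CC)‖ = 1 := by
  simp [Prod.norm_def]

theorem abs_trc_le (A : CC →L[ℝ] CC) : |trc A| ≤ 4 * ‖A‖ := by
  obtain ⟨n1, n2, n3, n4⟩ := norm_basis
  have k1 := A.le_opNorm (1, 0)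
  have k2 := A.le_opNorm (I, 0)
  have k3 := A.le_opNorm (0, 1)
  have k4 := A.le_opNorm (0, I)
  rw [n1] at k1; rw [n2] at k2; rw [n3] at k3; rw [n4] at k4
  have e1 := abs_le.1 ((Complex.abs_re_le_norm _).trans ((norm_fst_le _).trans k1))
  have e2 := abs_le.1 ((Complex.abs_im_le_norm _).trans ((norm_fst_le _).trans k2))
  have e3 := abs_le.1 ((Complex.abs_re_le_norm _).trans ((norm_snd_le _).trans k3))
  have e4 := abs_le.1 ((Complex.abs_im_le_norm _).trans ((norm_snd_le _).trans k4))
  unfold trc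
  rw [abs_le]; constructor <;> linarith [e1.1, e1.2, e2.1, e2.2, e3.1, e3.2, e4.1, e4.2]

theorem divg_smul {g : CC → ℝ} {V : CC → CC} {x : CC} {g' : CC →L[ℝ] ℝ} {V' : CC →L[ℝ] CC}
    (hg : HasFDerivAt g g' x) (hV : HasFDerivAt V V' x) :
    divg (fun y => g y • V y) x = g' (V x) + g x * trc V' := by
  have h := (hg.smul hV).fderiv
  change trc (fderiv ℝ (g • V) x) = _
  rw [h, trc_add, trc_smulRight, trc_smul, add_comm]

theorem divg_add {V W : CC → CC} {x : CC}
    (hV : DifferentiableAt ℝ V x) (hW : DifferentiableAt ℝ W x) :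
    divg (fun y => V y + W y) x = divg V x + divg W x := by
  rw [divg, fderiv_fun_add hV hW, trc_add]; rfl

theorem divg_smul' {g : CC → ℝ} {V : CC → CC} {x : CC} {g' : CC →L[ℝ] ℝ}
    (hg : HasFDerivAt g g' x) (hV : DifferentiableAt ℝ V x) :
    divg (fun y => g y • V y) x = g' (V x) + g x * divg V x :=
  divg_smul hg hV.hasFDerivAt

theorem integral_fderiv_zero {g : CC → ℝ} (hg : ContDiff ℝ 1 g) (hc : HasCompactSupport g) (v : CC) :
    ∫ x, fderiv ℝ g x v = 0 := by
  have hcont : Continuous fun x => fderiv ℝ g x v :=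
    (hg.continuous_fderiv one_ne_zero).clm_apply continuous_const
  have hs : HasCompactSupport fun x => fderiv ℝ g x v := by
    exact hc.fderiv_apply (𝕜 := ℝ) v
  haveI : (volume : Measure CC).IsAddHaarMeasure := by
    rw [Measure.volume_eq_prod]; infer_instance
  have := integral_mul_fderiv_eq_neg_fderiv_mul_of_integrable (𝕜 := ℝ) (μ := (volume : Measure CC)) (f := fun _ : CC => (1 : ℝ)) (g := g) (v := v)
    (by simp) (by simpa using hcont.integrable_of_hasCompactSupport hs)
    (by simpa using hg.continuous.integrable_of_hasCompactSupport hc)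
    (by simp) (fun x _ => hg.differentiable one_ne_zero x)
  simpa using this

theorem integral_divg {W : CC → CC} (hW : ContDiff ℝ 1 W) (hc : HasCompactSupport W) :
    Integrable (divg W) ∧ ∫ x, divg W x = 0 := by
  have key : ∀ (l : CC →L[ℝ] ℝ) (v : CC), Integrable (fun x => l (fderiv ℝ W x v)) ∧ ∫ x, l (fderiv ℝ W x v) = 0 := by
    intro l v
    have h1 : ContDiff ℝ 1 (fun x => l (W x)) := l.contDiff.comp hW
    have h2 : HasCompactSupport (fun x => l (W x)) := hc.comp_left (g := l) (map_zero l)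
    have h3 : ∀ x, fderiv ℝ (fun x => l (W x)) x v = l (fderiv ℝ W x v) := by
      intro x
      have := (l.hasFDerivAt.comp x (hW.differentiable one_ne_zero x).hasFDerivAt)
      have h := this.fderiv
      rw [show (fun x => l (W x)) = (l ∘ W) from rfl, h]; rfl
    have h4 := integral_fderiv_zero h1 h2 v
    have hcont : Continuous fun x => fderiv ℝ (fun x => l (W x)) x v :=
      (h1.continuous_fderiv one_ne_zero).clm_apply continuous_const
    have hs : HasCompactSupport fun x => fderiv ℝ (fun x => l (W x)) x v :=
      h2.fderiv_apply (𝕜 := ℝ) v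
    have h5 := hcont.integrable_of_hasCompactSupport hs (μ := volume)
    simp only [h3] at h4 h5
    exact ⟨h5, h4⟩
  have a1 := key (reCLM.comp (ContinuousLinearMap.fst ℝ ℂ ℂ)) (1, 0)
  have a2 := key (imCLM.comp (ContinuousLinearMap.fst ℝ ℂ ℂ)) (I, 0)
  have a3 := key (reCLM.comp (ContinuousLinearMap.snd ℝ ℂ ℂ)) (0, 1)
  have a4 := key (imCLM.comp (ContinuousLinearMap.snd ℝ ℂ ℂ)) (0, I)
  set g1 : CC → ℝ := fun x => (fderiv ℝ W x (1, 0)).1.re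
  set g2 : CC → ℝ := fun x => (fderiv ℝ W x (I, 0)).1.im
  set g3 : CC → ℝ := fun x => (fderiv ℝ W x (0, 1)).2.re
  set g4 : CC → ℝ := fun x => (fderiv ℝ W x (0, I)).2.im
  change Integrable g1 ∧ ∫ x, g1 x = 0 at a1
  change Integrable g2 ∧ ∫ x, g2 x = 0 at a2
  change Integrable g3 ∧ ∫ x, g3 x = 0 at a3
  change Integrable g4 ∧ ∫ x, g4 x = 0 at a4
  have e : divg W = fun x => g1 x + g2 x + g3 x + g4 x := rfl
  rw [e]
  have b1 : Integrable (fun x => g1 x + g2 x) := a1.1.add a2.1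
  have b2 : Integrable (fun x => g1 x + g2 x + g3 x) := b1.add a3.1
  refine ⟨b2.add a4.1, ?_⟩
  rw [integral_add b2 a4.1, integral_add b1 a3.1, integral_add a1.1 a2.1, a1.2, a2.2, a3.2, a4.2]
  simp

set_option linter.style.longLine false

noncomputable def NN (J : CC → (CC →L[ℝ] CC)) (x : CC) : CC := (J x - Icl) x
noncomputable def YY (J : CC → (CC →L[ℝ] CC)) (x : CC) : CC := Icl x + NN J x

theorem YY_eq (J : CC → (CC →L[ℝ] CC)) (x : CC) : YY J x = J x x := by
  simp [YY, NN]

theorem norm_Icl_apply (x : CC) : ‖Icl x‖ = ‖x‖ := by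
  rw [Icl_apply, Prod.norm_def, Prod.norm_def]; simp

theorem ipL_Icl (x : CC) : ipL x (Icl x) = 0 := by
  rw [ipL_apply, Icl_apply]; simp; ring

theorem ipL_symm (x y : CC) : ipL x y = ipL y x := by
  rw [ipL_apply, ipL_apply]; ring

noncomputable def nn (J : CC → (CC →L[ℝ] CC)) (x : CC) : ℝ := ipL x (NN J x)

theorem ipL_YY (J : CC → (CC →L[ℝ] CC)) (x : CC) : ipL x (YY J x) = nn J x := by
  rw [YY, map_add, ipL_Icl, nn, zero_add]

noncomputable def ipB : CC →L[ℝ] CC →L[ℝ] ℝ := LinearMap.toContinuousLinearMap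
  { toFun := fun x => ipL x
    map_add' := by intro x y; ext <;> simp [ipL] <;> ring
    map_smul' := by intro c x; ext <;> simp [ipL] <;> ring }

theorem ipB_apply (x : CC) : ipB x = ipL x := rfl

/-- Quantitative closeness of `J` to the standard structure. -/
structure JBd (J : CC → (CC →L[ℝ] CC)) (k : ℝ) (x : CC) : Prop where
  dN : DifferentiableAt ℝ (NN J) x
  bK : ‖J x - Icl‖ ≤ k * ‖x‖
  bN : ‖fderiv ℝ (NN J) x‖ ≤ k * ‖x‖

theorem JBd.hasY {J k x} (h : JBd J k x) : HasFDerivAt (YY J) (Icl + fderiv ℝ (NN J) x) x :=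
  Icl.hasFDerivAt.add h.dN.hasFDerivAt

theorem JBd.hasn {J k x} (h : JBd J k x) : ∃ n' : CC →L[ℝ] ℝ, HasFDerivAt (nn J) n' x ∧
    ∀ h, n' h = ipL x (fderiv ℝ (NN J) x h) + ipL h (NN J x) := by
  have := (ipB.hasFDerivAt (x := x)).clm_apply h.dN.hasFDerivAt
  exact ⟨_, this, fun h => by simp [ipB_apply]⟩

theorem JBd.normN {J k x} (h : JBd J k x) : ‖NN J x‖ ≤ k * ‖x‖ ^ 2 := by
  calc _ ≤ ‖J x - Icl‖ * ‖x‖ := (J x - Icl).le_opNorm x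
    _ ≤ (k * ‖x‖) * ‖x‖ := by gcongr; exact h.bK
    _ = _ := by ring

noncomputable def V1 (J : CC → (CC →L[ℝ] CC)) (y : CC) : CC :=
  (1/2 * ww y ^ 7 - ww y ^ 8) • y + ((1/2 * ww y ^ 11 - ww y ^ 12) * nn J y) • YY J y

theorem ww_sq_norm {x : CC} (hx : x ≠ 0) : ww x ^ 2 * ‖x‖ ≤ 1 := by
  have h := norm_le_tt_sq x
  have h1 := ww_mul_tt hx
  have h2 := ww_pos hx
  calc ww x ^ 2 * ‖x‖ ≤ ww x ^ 2 * tt x ^ 2 := by gcongr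
    _ = 1 := by rw [← mul_pow, h1, one_pow]

theorem norm_le_one_of_ww {x : CC} (hx : x ≠ 0) (hw : 1 ≤ ww x) : ‖x‖ ≤ 1 := by
  have h := ww_sq_norm hx
  have h1 : (1 : ℝ) ≤ ww x ^ 2 := one_le_pow₀ hw
  nlinarith [norm_nonneg x]

theorem JBd.normY {J k x} (h : JBd J k x) (hk : 0 ≤ k) (hx1 : ‖x‖ ≤ 1) : ‖YY J x‖ ≤ (k + 1) * ‖x‖ := by
  calc _ ≤ ‖Icl x‖ + ‖NN J x‖ := norm_add_le _ _
    _ ≤ ‖x‖ + k * ‖x‖ ^ 2 := by rw [norm_Icl_apply]; gcongr; exact h.normN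
    _ ≤ _ := by nlinarith [norm_nonneg x, mul_nonneg hk (norm_nonneg x), mul_nonneg (mul_nonneg hk (norm_nonneg x)) (sub_nonneg.2 hx1)]

theorem JBd.absn {J k x} (h : JBd J k x) : |nn J x| ≤ 4 * k * ‖x‖ ^ 3 := by
  calc _ ≤ 4 * ‖x‖ * ‖NN J x‖ := abs_ipL_le _ _
    _ ≤ 4 * ‖x‖ * (k * ‖x‖ ^ 2) := by gcongr; exact h.normN
    _ = _ := by ring

theorem hasFDerivAt_id' (x : CC) : HasFDerivAt (fun y : CC => y) (ContinuousLinearMap.id ℝ CC) x := hasFDerivAt_id x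

set_option maxHeartbeats 1000000 in
theorem div_V1 {J k x} (h : JBd J k x) (hx : x ≠ 0) (hk : 0 ≤ k) (hw : 1 ≤ ww x) :
    DifferentiableAt ℝ (V1 J) x ∧
    1/4 * ww x ^ 7 - 1000 * (k + 1) ^ 3 * ww x ^ 6 ≤ divg (V1 J) x := by
  obtain ⟨n', hn', en'⟩ := h.hasn
  have c1 : HasFDerivAt (fun y => 1/2 * ww y ^ 7 - ww y ^ 8) ((-(7/4) * ww x ^ 11 + 4 * ww x ^ 12) • ipL x) x := by
    refine (((hasFDerivAt_ww_pow hx 7).const_mul (1/2)).sub (hasFDerivAt_ww_pow hx 8)).congr_fderiv ?_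
    rw [smul_smul, ← sub_smul]; congr 1; push_cast; ring
  have c2 : HasFDerivAt (fun y => 1/2 * ww y ^ 11 - ww y ^ 12) ((-(11/4) * ww x ^ 15 + 6 * ww x ^ 16) • ipL x) x := by
    refine (((hasFDerivAt_ww_pow hx 11).const_mul (1/2)).sub (hasFDerivAt_ww_pow hx 12)).congr_fderiv ?_
    rw [smul_smul, ← sub_smul]; congr 1; push_cast; ring
  have c3 := c2.mul hn'
  have A1 := c1.smul (hasFDerivAt_id' x)
  have A2 := c3.smul h.hasY
  refine ⟨(A1.add A2).differentiableAt, ?_⟩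
  have e : divg (V1 J) x = _ := divg_add A1.differentiableAt A2.differentiableAt
  have e1 := divg_smul c1 (hasFDerivAt_id' x)
  have e2 := divg_smul c3 h.hasY
  have hw0 := ww_pos hx
  have e3 : divg (V1 J) x = 1/4 * ww x ^ 7 + (((-(11/4) * ww x ^ 15 + 6 * ww x ^ 16) * nn J x ^ 2 + (1/2 * ww x ^ 11 - ww x ^ 12) * n' (YY J x)) + (1/2 * ww x ^ 11 - ww x ^ 12) * nn J x * trc (fderiv ℝ (NN J) x)) := by
    rw [e]
    refine (congrArg₂ (· + ·) e1 e2).trans ?_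
    rw [trc_id, trc_add, trc_Icl]
    simp only [smul_apply, add_apply, Pi.mul_apply, ipL_self, ipL_YY, ← tt_pow4, smul_eq_mul]
    have := ww_mul_tt hx
    have h2 : ww x ^ 4 * tt x ^ 4 = 1 := by rw [← mul_pow, this, one_pow]
    linear_combination (-(7/4) * ww x ^ 7 + 4 * ww x ^ 8) * h2
  rw [e3]
  have hs1 := norm_le_one_of_ww hx hw
  have hws := ww_sq_norm hx
  set s := ‖x‖ with hs
  set w := ww x with hwd
  have hs0 : 0 ≤ s := norm_nonneg x
  have hn := h.absn
  have hY := h.normY hk hs1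
  have htr : |trc (fderiv ℝ (NN J) x)| ≤ 4 * (k * s) :=
    (abs_trc_le _).trans (by gcongr; exact h.bN)
  have hnY : |n' (YY J x)| ≤ 8 * k * (k + 1) * s ^ 3 := by
    rw [en']
    have q1 : |ipL x (fderiv ℝ (NN J) x (YY J x))| ≤ 4 * s * (k * s * ((k + 1) * s)) := by
      refine (abs_ipL_le _ _).trans ?_
      gcongr
      refine ((fderiv ℝ (NN J) x).le_opNorm _).trans ?_
      gcongr
      exact h.bN
    have q2 : |ipL (YY J x) (NN J x)| ≤ 4 * ((k + 1) * s) * (k * s ^ 2) := by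
      refine (abs_ipL_le _ _).trans ?_
      gcongr
      exact h.normN
    refine (abs_add_le _ _).trans ?_
    linarith
  have p3 : w ^ 12 * s ^ 3 ≤ w ^ 6 := by
    calc w ^ 12 * s ^ 3 = w ^ 6 * (w ^ 2 * s) ^ 3 := by ring
      _ ≤ w ^ 6 * 1 := by gcongr; exact pow_le_one₀ (by positivity) hws
      _ = _ := mul_one _
  have p6 : w ^ 16 * s ^ 6 ≤ w ^ 6 := by
    calc w ^ 16 * s ^ 6 = w ^ 4 * (w ^ 2 * s) ^ 6 := by ring
      _ ≤ w ^ 4 * 1 := by gcongr; exact pow_le_one₀ (by positivity) hws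
      _ ≤ _ := by rw [mul_one]; exact pow_le_pow_right₀ hw (by norm_num)
  have p4 : w ^ 12 * s ^ 4 ≤ w ^ 6 := by
    calc w ^ 12 * s ^ 4 = w ^ 12 * s ^ 3 * s := by ring
      _ ≤ w ^ 6 * 1 := by gcongr
      _ = _ := mul_one _
  have w15 : w ^ 15 ≤ w ^ 16 := pow_le_pow_right₀ hw (by norm_num)
  have w11 : w ^ 11 ≤ w ^ 12 := pow_le_pow_right₀ hw (by norm_num)
  have z1 : |(-(11/4) * w ^ 15 + 6 * w ^ 16) * nn J x ^ 2| ≤ 144 * k ^ 2 * w ^ 6 := by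
    rw [abs_mul, abs_pow]
    calc _ ≤ 9 * w ^ 16 * (4 * k * s ^ 3) ^ 2 := by
          gcongr
          rw [abs_le]; constructor <;> linarith [pow_pos hw0 15, pow_pos hw0 16]
      _ = 144 * k ^ 2 * (w ^ 16 * s ^ 6) := by ring
      _ ≤ _ := by gcongr
  have hc : |1/2 * w ^ 11 - w ^ 12| ≤ 2 * w ^ 12 := by
    rw [abs_le]; constructor <;> linarith [pow_pos hw0 11, pow_pos hw0 12]
  have z2 : |(1/2 * w ^ 11 - w ^ 12) * n' (YY J x)| ≤ 16 * k * (k + 1) * w ^ 6 := by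
    rw [abs_mul]
    calc _ ≤ 2 * w ^ 12 * (8 * k * (k + 1) * s ^ 3) := by gcongr
      _ = 16 * k * (k + 1) * (w ^ 12 * s ^ 3) := by ring
      _ ≤ _ := by gcongr
  have z3 : |(1/2 * w ^ 11 - w ^ 12) * nn J x * trc (fderiv ℝ (NN J) x)| ≤ 32 * k ^ 2 * w ^ 6 := by
    rw [abs_mul, abs_mul]
    calc _ ≤ 2 * w ^ 12 * (4 * k * s ^ 3) * (4 * (k * s)) := by gcongr
      _ = 32 * k ^ 2 * (w ^ 12 * s ^ 4) := by ring
      _ ≤ _ := by gcongr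
  have z : 144 * k ^ 2 * w ^ 6 + 16 * k * (k + 1) * w ^ 6 + 32 * k ^ 2 * w ^ 6 ≤ 1000 * (k + 1) ^ 3 * w ^ 6 := by
    rw [← add_mul, ← add_mul]
    gcongr
    nlinarith [pow_nonneg hk 3, pow_nonneg hk 2]
  linarith [(abs_le.1 z1).1, (abs_le.1 z2).1, (abs_le.1 z3).1]

set_option linter.style.longLine false

noncomputable def V2 (J : CC → (CC →L[ℝ] CC)) (q : CC → ℝ) (y : CC) : CC :=
  ww y ^ 8 • ((fderiv ℝ q y (YY J y)) • y - (fderiv ℝ q y y) • YY J y)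

noncomputable def V3 (q : CC → ℝ) (y : CC) : CC :=
  ww y ^ 2 • ((fderiv ℝ q y (I, 0)) • ((1, 0) : CC) - (fderiv ℝ q y (1, 0)) • ((I, 0) : CC) +
    (fderiv ℝ q y (0, I)) • ((0, 1) : CC) - (fderiv ℝ q y (0, 1)) • ((0, I) : CC))

theorem divg_sub {V W : CC → CC} {x : CC}
    (hV : DifferentiableAt ℝ V x) (hW : DifferentiableAt ℝ W x) :
    divg (fun y => V y - W y) x = divg V x - divg W x := by
  rw [divg, fderiv_fun_sub hV hW, sub_eq_add_neg, trc_add, ← neg_one_smul ℝ, trc_smul]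
  simp [divg]; ring

theorem hasFDerivAt_const' (c x : CC) : HasFDerivAt (fun _ : CC => c) (0 : CC →L[ℝ] CC) x := hasFDerivAt_const c x

theorem trc_zero : trc 0 = 0 := by simp [trc]

theorem snd_deriv {F : Type*} [NormedAddCommGroup F] [NormedSpace ℝ F] {q : CC → F} {x : CC} (hq : ContDiffAt ℝ 2 q x) : ∃ B : CC →L[ℝ] CC →L[ℝ] F,
    HasFDerivAt (fderiv ℝ q) B x ∧ ∀ h k, B h k = B k h := by
  refine ⟨fderiv ℝ (fderiv ℝ q) x, ?_, ?_⟩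
  · have := hq.fderiv_right (m := 1) (by norm_num)
    exact (this.differentiableAt (by norm_num)).hasFDerivAt
  · intro h k
    exact (hq.isSymmSndFDerivAt (by simp)).eq h k

theorem div_V2 {J k x} (h : JBd J k x) (hx : x ≠ 0) (hk : 0 ≤ k) (hw : 1 ≤ ww x) {q : CC → ℝ}
    (hq : ContDiffAt ℝ 2 q x) {G : ℝ} (hG : ‖fderiv ℝ q x‖ ≤ G) :
    DifferentiableAt ℝ (V2 J q) x ∧
    |divg (V2 J q) x| ≤ 22 * k * ww x ^ 4 * G := by
  obtain ⟨B, hB, sB⟩ := snd_deriv hq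
  set Q := fderiv ℝ q x with hQ
  set N' := fderiv ℝ (NN J) x with hN'
  have hY := h.hasY
  have c1 := hB.clm_apply hY
  have c2 := hB.clm_apply (hasFDerivAt_id' x)
  have A1 := c1.smul (hasFDerivAt_id' x)
  have A2 := c2.smul hY
  have A3 := A1.sub A2
  refine ⟨((hasFDerivAt_ww_pow hx 8).smul A3).differentiableAt, ?_⟩
  have hw0 := ww_pos hx
  have e : divg (V2 J q) x = _ := divg_smul' (hasFDerivAt_ww_pow hx 8) A3.differentiableAt
  have e0 := divg_sub A1.differentiableAt A2.differentiableAt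
  have e1 := divg_smul c1 (hasFDerivAt_id' x)
  have e2 := divg_smul c2 hY
  have e3 : divg (V2 J q) x = ww x ^ 8 * Q (N' x - NN J x) + 4 * ww x ^ 12 * nn J x * Q x - ww x ^ 8 * (Q x * trc N') := by
    rw [e]
    have e0' : divg ((fun y => (fderiv ℝ q y (YY J y))) • (fun y => y) - (fun y => fderiv ℝ q y y) • YY J) x = _ := e0.trans (congrArg₂ (· - ·) e1 e2)
    refine (congrArg₂ (· + ·) rfl (congrArg₂ (· * ·) rfl e0')).trans ?_
    rw [trc_id, trc_add, trc_Icl]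
    simp only [smul_apply, add_apply, ipL_self, ipL_YY, ← tt_pow4, smul_eq_mul, Pi.sub_apply, Pi.smul_apply', map_sub, map_smul,
      ContinuousLinearMap.comp_apply, ContinuousLinearMap.flip_apply, ContinuousLinearMap.id_apply, map_add, ← hQ]
    have := ww_mul_tt hx
    have h2 : ww x ^ 4 * tt x ^ 4 = 1 := by rw [← mul_pow, this, one_pow]
    rw [sB x (YY J x)]
    have hYY : Q (YY J x) = Q (Icl x) + Q (NN J x) := by rw [YY, map_add]
    push_cast
    linear_combination (-4 * ww x ^ 8 * Q (YY J x)) * h2 - ww x ^ 8 * hYY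
  rw [e3]
  have hs1 := norm_le_one_of_ww hx hw
  have hws := ww_sq_norm hx
  have hG0 : 0 ≤ G := (norm_nonneg _).trans hG
  have hn := h.absn
  have hNx : ‖N' x - NN J x‖ ≤ 2 * k * ‖x‖ ^ 2 := by
    refine (norm_sub_le _ _).trans ?_
    have := (N'.le_opNorm x).trans (mul_le_mul_of_nonneg_right h.bN (norm_nonneg _))
    have := h.normN
    nlinarith
  have htr : |trc N'| ≤ 4 * (k * ‖x‖) :=
    (abs_trc_le _).trans (by gcongr; exact h.bN)
  have hQx : |Q x| ≤ G * ‖x‖ := (Q.le_opNorm x).trans (by gcongr)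
  have hQN : |Q (N' x - NN J x)| ≤ G * (2 * k * ‖x‖ ^ 2) := (Q.le_opNorm _).trans (by gcongr)
  set s := ‖x‖ with hs
  set w := ww x with hwd
  have hs0 : 0 ≤ s := norm_nonneg x
  have p2 : w ^ 8 * s ^ 2 ≤ w ^ 4 := by
    calc w ^ 8 * s ^ 2 = w ^ 4 * (w ^ 2 * s) ^ 2 := by ring
      _ ≤ w ^ 4 * 1 := by gcongr; exact pow_le_one₀ (by positivity) hws
      _ = _ := mul_one _
  have p4 : w ^ 12 * s ^ 4 ≤ w ^ 4 := by
    calc w ^ 12 * s ^ 4 = w ^ 4 * (w ^ 2 * s) ^ 4 := by ring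
      _ ≤ w ^ 4 * 1 := by gcongr; exact pow_le_one₀ (by positivity) hws
      _ = _ := mul_one _
  have z1 : |w ^ 8 * Q (N' x - NN J x)| ≤ 2 * k * w ^ 4 * G := by
    rw [abs_mul, abs_of_pos (pow_pos hw0 8)]
    calc _ ≤ w ^ 8 * (G * (2 * k * s ^ 2)) := by gcongr
      _ = 2 * k * G * (w ^ 8 * s ^ 2) := by ring
      _ ≤ 2 * k * G * w ^ 4 := by gcongr
      _ = _ := by ring
  have z2 : |4 * w ^ 12 * nn J x * Q x| ≤ 16 * k * w ^ 4 * G := by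
    rw [abs_mul, abs_mul, abs_of_pos (show 0 < 4 * w ^ 12 by positivity)]
    calc _ ≤ 4 * w ^ 12 * (4 * k * s ^ 3) * (G * s) := by gcongr
      _ = 16 * k * G * (w ^ 12 * s ^ 4) := by ring
      _ ≤ 16 * k * G * w ^ 4 := by gcongr
      _ = _ := by ring
  have z3 : |w ^ 8 * (Q x * trc N')| ≤ 4 * k * w ^ 4 * G := by
    rw [abs_mul, abs_mul, abs_of_pos (pow_pos hw0 8)]
    calc _ ≤ w ^ 8 * ((G * s) * (4 * (k * s))) := by gcongr
      _ = 4 * k * G * (w ^ 8 * s ^ 2) := by ring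
      _ ≤ 4 * k * G * w ^ 4 := by gcongr
      _ = _ := by ring
  rw [abs_le] at *
  constructor <;> linarith [z1.1, z1.2, z2.1, z2.2, z3.1, z3.2]

theorem div_V3 {x} (hx : x ≠ 0) {q : CC → ℝ}
    (hq : ContDiffAt ℝ 2 q x) {G : ℝ} (hG : ‖fderiv ℝ q x‖ ≤ G) :
    DifferentiableAt ℝ (V3 q) x ∧
    |divg (V3 q) x| ≤ 16 * ww x ^ 4 * G := by
  obtain ⟨B, hB, sB⟩ := snd_deriv hq
  set Q := fderiv ℝ q x with hQ
  have c := fun v : CC => hB.clm_apply (hasFDerivAt_const' v x)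
  have A := fun v u : CC => (c v).smul (hasFDerivAt_const' u x)
  have AA := (((A (I, 0) (1, 0)).sub (A (1, 0) (I, 0))).add (A (0, I) (0, 1))).sub (A (0, 1) (0, I))
  refine ⟨((hasFDerivAt_ww_pow hx 2).smul AA).differentiableAt, ?_⟩
  have e : divg (V3 q) x = _ := divg_smul (hasFDerivAt_ww_pow hx 2) AA
  have e3 : divg (V3 q) x = - ww x ^ 6 * ipL x (Q (I, 0) • ((1, 0) : CC) - Q (1, 0) • ((I, 0) : CC) + Q (0, I) • ((0, 1) : CC) - Q (0, 1) • ((0, I) : CC)) := by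
    rw [e]
    simp only [sub_eq_add_neg, trc_add, ← neg_one_smul ℝ (M := CC →L[ℝ] CC), trc_smul, smul_zero, zero_add, trc_smulRight, trc_zero]
    simp only [smul_apply, add_apply, smul_eq_mul, Pi.sub_apply, Pi.smul_apply', Pi.add_apply, map_sub, map_smul, Pi.neg_apply,
      ContinuousLinearMap.comp_apply, ContinuousLinearMap.flip_apply, ContinuousLinearMap.id_apply, map_add, map_neg, ← hQ]
    have s1 := sB (1, 0) (I, 0)
    have s2 := sB (0, 1) (0, I)
    simp
    linear_combination ww x ^ 2 * s1 + ww x ^ 2 * s2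
  rw [e3]
  obtain ⟨n1, n2, n3, n4⟩ := norm_basis
  have b1 : |Q (1, 0)| ≤ G := (Q.le_opNorm _).trans (by rw [n1]; linarith)
  have b2 : |Q (I, 0)| ≤ G := (Q.le_opNorm _).trans (by rw [n2]; linarith)
  have b3 : |Q (0, 1)| ≤ G := (Q.le_opNorm _).trans (by rw [n3]; linarith)
  have b4 : |Q (0, I)| ≤ G := (Q.le_opNorm _).trans (by rw [n4]; linarith)
  have hG0 : 0 ≤ G := (norm_nonneg _).trans hG
  have hn : ‖(Q (I, 0) • ((1, 0) : CC) - Q (1, 0) • ((I, 0) : CC) + Q (0, I) • ((0, 1) : CC) - Q (0, 1) • ((0, I) : CC))‖ ≤ 4 * G := by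
    refine (norm_sub_le _ _).trans ?_
    refine (add_le_add_left ((norm_add_le _ _).trans (add_le_add_left (norm_sub_le _ _) _)) _).trans ?_
    simp only [norm_smul, n1, n2, n3, n4, Real.norm_eq_abs]
    linarith
  have hw0 := ww_pos hx
  have hws := ww_sq_norm hx
  rw [abs_mul, abs_neg, abs_of_pos (pow_pos hw0 6)]
  calc _ ≤ ww x ^ 6 * (4 * ‖x‖ * (4 * G)) := by
        gcongr
        exact (abs_ipL_le _ _).trans (by gcongr)
    _ = 16 * ww x ^ 4 * G * (ww x ^ 2 * ‖x‖) := by ring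
    _ ≤ 16 * ww x ^ 4 * G * 1 := by gcongr
    _ = _ := mul_one _


theorem core_alg (a b p q Px Py Qx Qy τ : ℝ) :
    -τ * (2 * p * (a * Px + b * Py) + 2 * q * (a * Qx + b * Qy)) - 2 * (Qy * Px - Qx * Py) ≤
    (Px + τ * b * q - τ * a * p - Qy) ^ 2 + (Qx - τ * a * q + Py - τ * b * p) ^ 2 := by
  have h1 := sq_nonneg (Px + τ * b * q)
  have h2 := sq_nonneg (-τ * a * p - Qy)
  have h3 := sq_nonneg (Qx - τ * b * p)
  have h4 := sq_nonneg (-τ * a * q + Py)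
  nlinarith

theorem norm_expand (P Q v : ℂ) (a b τ : ℝ) : ‖P + I * Q - τ * ((a : ℂ) + I * (b : ℂ)) * v‖ ^ 2 =
    (P.re + τ * b * v.im - τ * a * v.re - Q.im) ^ 2 + (P.im - τ * a * v.im + Q.re - τ * b * v.re) ^ 2 := by
  rw [Complex.sq_norm, Complex.normSq_apply]
  simp
  ring

theorem final_alg {k s w τ D m g2 δ G p d1 d2 d3 dmV1 PV2 PV3 c1 c2 C divW : ℝ}
    (hτ : 1 ≤ τ) (hw1 : 1 ≤ w) (hws : w ^ 2 * s ≤ 1) (hs : 0 ≤ s) (hk : 0 ≤ k)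
    (hwk : 10 * (k + 1) ≤ w) (hm : 0 ≤ m) (hp : p ^ 2 ≤ m) (hg : 0 ≤ g2) (hC : 0 ≤ C) (hc1 : 0 ≤ c1) (hc2 : 0 ≤ c2)
    (hG0 : 0 ≤ G) (hG : G ^ 2 ≤ 4 * g2)
    (hW : divW = -τ * (dmV1 + m * d1) + -2 * (PV2 + p * d2) + -(2 / τ) * (PV3 + p * d3))
    (H1 : -τ * dmV1 - 2 * PV2 ≤ w ^ 4 * D ^ 2)
    (H2 : 2 * PV3 = w ^ 2 * (g2 - δ))
    (H3 : δ ≤ 6 * (D ^ 2 + 4 * k ^ 2 * s ^ 2 * g2 + C * τ ^ 2 * w ^ 4 * m))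
    (H4 : 1/4 * w ^ 7 - c1 * w ^ 6 ≤ d1)
    (H5 : |d2| ≤ c2 * w ^ 4 * G) (H6 : |d3| ≤ 16 * w ^ 4 * G)
    (hwl : 8 * (c1 + 6 * C + 16 * c2 ^ 2 + 4096) ≤ w) :
    divW + τ / 8 * w ^ 7 * m ≤ 7 * w ^ 4 * D ^ 2 := by
  have hτ0 : 0 < τ := by linarith
  have hw0 : 0 < w := by linarith
  set σ := 1 / τ with hσ
  have hσ0 : 0 < σ := by positivity
  have hσ1 : σ ≤ 1 := by rw [hσ, div_le_one hτ0]; exact hτ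
  have hστ : σ * τ = 1 := by rw [hσ]; field_simp
  have e2 : 2 / τ = 2 * σ := by rw [hσ]; ring
  rw [e2] at hW
  have ks : 24 * k ^ 2 * s ^ 2 ≤ 1/4 := by
    have a1 : w * s ≤ 1 := by nlinarith
    have a2 : 10 * k * s ≤ 1 := by nlinarith
    have a3 : 0 ≤ k * s := by positivity
    nlinarith
  have b1 : σ * w ^ 2 * δ ≤ 6 * w ^ 4 * D ^ 2 + 1/4 * (σ * w ^ 2 * g2) + 6 * C * τ * w ^ 6 * m := by
    have h1 : σ * w ^ 2 * δ ≤ σ * w ^ 2 * (6 * (D ^ 2 + 4 * k ^ 2 * s ^ 2 * g2 + C * τ ^ 2 * w ^ 4 * m)) := by gcongr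
    have h2 : σ * w ^ 2 * (6 * (D ^ 2 + 4 * k ^ 2 * s ^ 2 * g2 + C * τ ^ 2 * w ^ 4 * m)) =
      6 * (σ * w ^ 2) * D ^ 2 + (24 * k ^ 2 * s ^ 2) * (σ * w ^ 2 * g2) + (σ * τ) * (6 * C * τ * w ^ 6 * m) := by ring
    have h3 : 6 * (σ * w ^ 2) * D ^ 2 ≤ 6 * (1 * w ^ 4) * D ^ 2 := by
      gcongr
      norm_num
    have h4 : (24 * k ^ 2 * s ^ 2) * (σ * w ^ 2 * g2) ≤ 1/4 * (σ * w ^ 2 * g2) := by gcongr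
    rw [hστ] at h2
    linarith
  have am : ∀ c : ℝ, 0 ≤ c → 2 * |p| * (c * w ^ 4 * G) ≤ 1/4 * (σ * w ^ 2 * g2) + 16 * c ^ 2 * τ * w ^ 6 * m := by
    intro c hc
    have h1 : 0 ≤ σ * (1/4 * (w * G) - 4 * c * τ * w ^ 3 * |p|) ^ 2 := by positivity
    have h2 : σ * (1/4 * (w * G) - 4 * c * τ * w ^ 3 * |p|) ^ 2 = 1/16 * (σ * w ^ 2 * G ^ 2) - (σ * τ) * (2 * |p| * (c * w ^ 4 * G)) + (σ * τ) * (16 * c ^ 2 * τ * w ^ 6 * |p| ^ 2) := by ring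
    have h3 : σ * w ^ 2 * G ^ 2 ≤ σ * w ^ 2 * (4 * g2) := by gcongr
    have h4 : 16 * c ^ 2 * τ * w ^ 6 * |p| ^ 2 ≤ 16 * c ^ 2 * τ * w ^ 6 * m := by rw [sq_abs]; gcongr
    rw [hστ] at h2
    linarith
  have b2 : -2 * (p * d2) ≤ 1/4 * (σ * w ^ 2 * g2) + 16 * c2 ^ 2 * τ * w ^ 6 * m := by
    refine le_trans ?_ (am c2 hc2)
    calc -2 * (p * d2) ≤ 2 * |p * d2| := by linarith [neg_le_abs (p * d2)]
      _ = 2 * |p| * |d2| := by rw [abs_mul]; ring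
      _ ≤ _ := by gcongr
  have b3 : -(2 * σ) * (p * d3) ≤ 1/4 * (σ * w ^ 2 * g2) + 4096 * τ * w ^ 6 * m := by
    have := am 16 (by norm_num)
    calc -(2 * σ) * (p * d3) = σ * (2 * (-(p * d3))) := by ring
      _ ≤ σ * (2 * |p * d3|) := by gcongr; exact neg_le_abs _
      _ ≤ 1 * (2 * |p * d3|) := by gcongr
      _ = 2 * |p| * |d3| := by rw [abs_mul]; ring
      _ ≤ 2 * |p| * (16 * w ^ 4 * G) := by gcongr
      _ ≤ _ := by linarith
  have b4 : τ * m * (1/4 * w ^ 7 - c1 * w ^ 6) ≤ τ * m * d1 := by gcongr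
  have b5 : τ * m * (8 * (c1 + 6 * C + 16 * c2 ^ 2 + 4096) * w ^ 6) ≤ τ * m * (w * w ^ 6) := by gcongr
  have b6 : -(2 * σ) * PV3 = - (σ * w ^ 2 * g2) + σ * w ^ 2 * δ := by
    linear_combination (-σ) * H2
  have b7 : 0 ≤ σ * w ^ 2 * g2 := by positivity
  have expand : divW = (-τ * dmV1 - 2 * PV2) - τ * m * d1 + -2 * (p * d2) + -(2 * σ) * PV3 + -(2 * σ) * (p * d3) := by rw [hW]; ring
  rw [expand, b6]
  have : w * w ^ 6 = w ^ 7 := by ring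
  rw [this] at b5
  linarith

noncomputable def WW (J : CC → (CC →L[ℝ] CC)) (v : CC → ℂ) (τ : ℝ) (y : CC) : CC :=
  (-τ) • ((v y).re ^ 2 + (v y).im ^ 2) • V1 J y + (-2 : ℝ) • (v y).re • V2 J (fun y => (v y).im) y
    + (-(2 / τ)) • (v y).re • V3 (fun y => (v y).im) y

theorem opnorm_le_sum {F : Type*} [NormedAddCommGroup F] [NormedSpace ℝ F] (P : CC →L[ℝ] F) :
    ‖P‖ ≤ ‖P (1, 0)‖ + ‖P (I, 0)‖ + ‖P (0, 1)‖ + ‖P (0, I)‖ := by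
  refine P.opNorm_le_bound (by positivity) fun X => ?_
  rw [apply_decomp P X]
  have e1 := fun z : CC => (Complex.abs_re_le_norm z.1).trans (norm_fst_le z)
  have e2 := fun z : CC => (Complex.abs_im_le_norm z.1).trans (norm_fst_le z)
  have e3 := fun z : CC => (Complex.abs_re_le_norm z.2).trans (norm_snd_le z)
  have e4 := fun z : CC => (Complex.abs_im_le_norm z.2).trans (norm_snd_le z)
  refine (norm_add_le _ _).trans ?_
  refine (add_le_add_left ((norm_add_le _ _).trans (add_le_add_left (norm_add_le _ _) _)) _).trans ?_
  simp only [norm_smul, Real.norm_eq_abs]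
  rw [add_mul, add_mul, add_mul, mul_comm _ ‖X‖, mul_comm _ ‖X‖, mul_comm _ ‖X‖, mul_comm _ ‖X‖]
  gcongr
  · exact e1 X
  · exact e2 X
  · exact e3 X
  · exact e4 X

theorem psi'_bound {x : CC} (hx : x ≠ 0) (hw : 1 ≤ ww x) (X : CC) :
    |(1 / 2 * ww x ^ 3 - ww x ^ 4) * ipL x X| ≤ 4 * ww x ^ 2 * ‖X‖ := by
  have hw0 := ww_pos hx
  have hws := ww_sq_norm hx
  have w3 : ww x ^ 3 ≤ ww x ^ 4 := pow_le_pow_right₀ hw (by norm_num)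
  rw [abs_mul]
  calc _ ≤ ww x ^ 4 * (4 * ‖x‖ * ‖X‖) := by
        gcongr
        · rw [abs_le]; constructor <;> linarith [pow_pos hw0 3, pow_pos hw0 4]
        · exact abs_ipL_le _ _
    _ = 4 * ww x ^ 2 * ‖X‖ * (ww x ^ 2 * ‖x‖) := by ring
    _ ≤ 4 * ww x ^ 2 * ‖X‖ * 1 := by gcongr
    _ = _ := mul_one _

set_option maxHeartbeats 4000000 in
theorem carleman_pointwise {J k x} (h : JBd J k x) (hx : x ≠ 0) (hk : 0 ≤ k) {τ : ℝ} (hτ : 1 ≤ τ)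
    (hwk : 10 * (k + 1) ≤ ww x)
    (hwl : 8 * (1000 * (k + 1) ^ 3 + 6 * (16 * (k + 2) ^ 2) + 16 * (22 * k) ^ 2 + 4096) ≤ ww x)
    {v : CC → ℂ} (hv : ContDiffAt ℝ 2 v x) {D : ℝ}
    (hD : ∀ X, ‖fderiv ℝ v x X + I * fderiv ℝ v x (J x X) - τ * (((1 / 2 * ww x ^ 3 - ww x ^ 4) * ipL x X : ℝ) + I * ((1 / 2 * ww x ^ 3 - ww x ^ 4) * ipL x (J x X) : ℝ)) * v x‖ ≤ D * ‖X‖) :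
    divg (WW J v τ) x + τ / 8 * ww x ^ 7 * ‖v x‖ ^ 2 ≤ 7 * ww x ^ 4 * D ^ 2 := by
  have hw1 : 1 ≤ ww x := by linarith
  have hw0 := ww_pos hx
  have hws := ww_sq_norm hx
  have hs1 := norm_le_one_of_ww hx hw1
  have hvd : HasFDerivAt v (fderiv ℝ v x) x := (hv.differentiableAt (by norm_num)).hasFDerivAt
  have hp : HasFDerivAt (fun y => (v y).re) (reCLM.comp (fderiv ℝ v x)) x := reCLM.hasFDerivAt.comp x hvd
  have hq : HasFDerivAt (fun y => (v y).im) (imCLM.comp (fderiv ℝ v x)) x := imCLM.hasFDerivAt.comp x hvd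
  have hq2 : ContDiffAt ℝ 2 (fun y => (v y).im) x := imCLM.contDiff.contDiffAt.comp x hv
  have hm := (hp.pow 2).add (hq.pow 2)
  set dv := fderiv ℝ v x with hdv
  have hQG : ‖fderiv ℝ (fun y => (v y).im) x‖ ≤ ‖dv‖ := by
    rw [hq.fderiv]
    refine ContinuousLinearMap.opNorm_le_bound _ (norm_nonneg _) fun X => ?_
    exact (Complex.abs_im_le_norm _).trans (dv.le_opNorm X)
  obtain ⟨dV1, bV1⟩ := div_V1 h hx hk hw1
  obtain ⟨dV2, bV2⟩ := div_V2 h hx hk hw1 hq2 hQG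
  obtain ⟨dV3, bV3⟩ := div_V3 hx hq2 hQG
  have hms : ‖v x‖ ^ 2 = (v x).re ^ 2 + (v x).im ^ 2 := by
    rw [Complex.sq_norm, Complex.normSq_apply]; ring
  have hGg : ‖dv‖ ^ 2 ≤ 4 * (‖dv (1, 0)‖ ^ 2 + ‖dv (I, 0)‖ ^ 2 + ‖dv (0, 1)‖ ^ 2 + ‖dv (0, I)‖ ^ 2) := by
    have := opnorm_le_sum dv
    calc ‖dv‖ ^ 2 ≤ (‖dv (1, 0)‖ + ‖dv (I, 0)‖ + ‖dv (0, 1)‖ + ‖dv (0, I)‖) ^ 2 := by gcongr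
      _ ≤ _ := by
        nlinarith [sq_nonneg (‖dv (1, 0)‖ - ‖dv (I, 0)‖), sq_nonneg (‖dv (1, 0)‖ - ‖dv (0, 1)‖), sq_nonneg (‖dv (1, 0)‖ - ‖dv (0, I)‖), sq_nonneg (‖dv (I, 0)‖ - ‖dv (0, 1)‖), sq_nonneg (‖dv (I, 0)‖ - ‖dv (0, I)‖), sq_nonneg (‖dv (0, 1)‖ - ‖dv (0, I)‖)]
  have hsq : ∀ X, ‖dv X‖ ^ 2 = (dv X).re ^ 2 + (dv X).im ^ 2 := fun X => by
    rw [Complex.sq_norm, Complex.normSq_apply]; ring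
  have hdb : ∀ e : CC, ‖e‖ = 1 → ‖dv e + I * dv (Icl e)‖ ^ 2 ≤ 3 * (D ^ 2 + 4 * k ^ 2 * ‖x‖ ^ 2 * (‖dv (1, 0)‖ ^ 2 + ‖dv (I, 0)‖ ^ 2 + ‖dv (0, 1)‖ ^ 2 + ‖dv (0, I)‖ ^ 2) + 16 * (k + 2) ^ 2 * τ ^ 2 * ww x ^ 4 * ‖v x‖ ^ 2) := by
    intro e he
    have hKe : ‖(J x - Icl) e‖ ≤ k * ‖x‖ := by
      refine ((J x - Icl).le_opNorm e).trans ?_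
      rw [he, mul_one]; exact h.bK
    have hJe : ‖J x e‖ ≤ 1 + k := by
      have : J x e = Icl e + (J x - Icl) e := by simp
      rw [this]
      refine (norm_add_le _ _).trans ?_
      rw [norm_Icl_apply, he]
      nlinarith [norm_nonneg x]
    have e1 : dv e + I * dv (Icl e) = (dv e + I * dv (J x e) - τ * (((1 / 2 * ww x ^ 3 - ww x ^ 4) * ipL x e : ℝ) + I * ((1 / 2 * ww x ^ 3 - ww x ^ 4) * ipL x (J x e) : ℝ)) * v x) - I * dv ((J x - Icl) e) + τ * (((1 / 2 * ww x ^ 3 - ww x ^ 4) * ipL x e : ℝ) + I * ((1 / 2 * ww x ^ 3 - ww x ^ 4) * ipL x (J x e) : ℝ)) * v x := by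
      rw [sub_apply, map_sub]; ring
    have n1 := hD e
    rw [he, mul_one] at n1
    have n2 : ‖I * dv ((J x - Icl) e)‖ ≤ ‖dv‖ * (k * ‖x‖) := by
      rw [norm_mul, norm_I, one_mul]
      exact (dv.le_opNorm _).trans (by gcongr)
    have n3 : ‖(τ : ℂ) * (((1 / 2 * ww x ^ 3 - ww x ^ 4) * ipL x e : ℝ) + I * ((1 / 2 * ww x ^ 3 - ww x ^ 4) * ipL x (J x e) : ℝ)) * v x‖ ≤ τ * (4 * (k + 2) * ww x ^ 2) * ‖v x‖ := by
      rw [norm_mul, norm_mul, Complex.norm_real, Real.norm_eq_abs, abs_of_pos (by linarith)]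
      gcongr
      refine (norm_add_le _ _).trans ?_
      rw [norm_mul, norm_I, one_mul, Complex.norm_real, Complex.norm_real, Real.norm_eq_abs, Real.norm_eq_abs]
      have u1 := psi'_bound hx hw1 e
      have u2 := psi'_bound hx hw1 (J x e)
      rw [he] at u1
      have u3 : 4 * ww x ^ 2 * ‖J x e‖ ≤ 4 * ww x ^ 2 * (1 + k) := by gcongr
      linarith
    have n4 : ‖dv e + I * dv (Icl e)‖ ≤ D + ‖dv‖ * (k * ‖x‖) + τ * (4 * (k + 2) * ww x ^ 2) * ‖v x‖ := by
      rw [e1]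
      refine (norm_add_le _ _).trans ?_
      gcongr
      refine (norm_sub_le _ _).trans ?_
      gcongr
    calc _ ≤ (D + ‖dv‖ * (k * ‖x‖) + τ * (4 * (k + 2) * ww x ^ 2) * ‖v x‖) ^ 2 := by gcongr
      _ ≤ 3 * (D ^ 2 + (‖dv‖ * (k * ‖x‖)) ^ 2 + (τ * (4 * (k + 2) * ww x ^ 2) * ‖v x‖) ^ 2) := by
        generalize ‖dv‖ * (k * ‖x‖) = A
        generalize τ * (4 * (k + 2) * ww x ^ 2) * ‖v x‖ = B
        nlinarith [sq_nonneg (D - A), sq_nonneg (D - B), sq_nonneg (A - B)]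
      _ = 3 * (D ^ 2 + ‖dv‖ ^ 2 * (k ^ 2 * ‖x‖ ^ 2) + 16 * (k + 2) ^ 2 * τ ^ 2 * ww x ^ 4 * ‖v x‖ ^ 2) := by ring
      _ ≤ 3 * (D ^ 2 + 4 * (‖dv (1, 0)‖ ^ 2 + ‖dv (I, 0)‖ ^ 2 + ‖dv (0, 1)‖ ^ 2 + ‖dv (0, I)‖ ^ 2) * (k ^ 2 * ‖x‖ ^ 2) + 16 * (k + 2) ^ 2 * τ ^ 2 * ww x ^ 4 * ‖v x‖ ^ 2) := by gcongr
      _ = _ := by ring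
  have D1 := dV1.hasFDerivAt
  have B1 := hm.differentiableAt.smul dV1
  have B2 := hp.differentiableAt.smul dV2
  have B3 := hp.differentiableAt.smul dV3
  have f1 : divg (fun y => ((v y).re ^ 2 + (v y).im ^ 2) • V1 J y) x = _ := divg_smul' hm dV1
  have f2 := divg_smul' hp dV2
  have f3 := divg_smul' hp dV3
  have cs : ∀ (c : ℝ) (V : CC → CC), DifferentiableAt ℝ V x → divg (fun y => c • V y) x = c * divg V x := by
    intro c V hV
    rw [divg, fderiv_fun_const_smul hV, trc_smul, divg]
  have hW : divg (WW J v τ) x = -τ * divg (fun y => ((v y).re ^ 2 + (v y).im ^ 2) • V1 J y) x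
     + -2 * divg (fun y => (v y).re • V2 J (fun y => (v y).im) y) x + -(2/τ) * divg (fun y => (v y).re • V3 (fun y => (v y).im) y) x := by
    have r1 := cs (-τ) _ B1
    have r2 := cs (-2) _ B2
    have r3 := cs (-(2/τ)) _ B3
    have q1 := divg_add (B1.const_smul (-τ)) (B2.const_smul (-2 : ℝ))
    have q2 := divg_add ((B1.const_smul (-τ)).add (B2.const_smul (-2 : ℝ))) (B3.const_smul (-(2/τ)))
    exact q2.trans (congrArg₂ (· + ·) (q1.trans (congrArg₂ (· + ·) r1 r2)) r3)
  rw [f1, f2, f3] at hW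
  have hdbs := add_le_add (hdb (1, 0) norm_basis.1) (hdb (0, 1) norm_basis.2.2.1)
  refine final_alg (c1 := 1000 * (k + 1) ^ 3) (c2 := 22 * k) (C := 16 * (k + 2) ^ 2) (G := ‖dv‖)
    (g2 := ‖dv (1, 0)‖ ^ 2 + ‖dv (I, 0)‖ ^ 2 + ‖dv (0, 1)‖ ^ 2 + ‖dv (0, I)‖ ^ 2)
    (δ := ‖dv (1, 0) + I * dv (Icl (1, 0))‖ ^ 2 + ‖dv (0, 1) + I * dv (Icl (0, 1))‖ ^ 2)
    (m := ‖v x‖ ^ 2) (p := (v x).re) hτ hw1 hws (norm_nonneg _) hk hwk (by positivity) ?_ (by positivity) (by positivity) (by positivity) (by positivity)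
    (norm_nonneg _) hGg (by rw [hms]; exact hW) ?_ ?_ ?_ bV1 bV2 bV3 hwl
  · rw [hms]; exact le_add_of_nonneg_right (sq_nonneg _)
  · have hE := hD x
    have hE2 : ‖dv x + I * dv (J x x) - τ * (((1 / 2 * ww x ^ 3 - ww x ^ 4) * ipL x x : ℝ) + I * ((1 / 2 * ww x ^ 3 - ww x ^ 4) * ipL x (J x x) : ℝ)) * v x‖ ^ 2 ≤ (D * ‖x‖) ^ 2 := by gcongr
    have hca := core_alg ((1 / 2 * ww x ^ 3 - ww x ^ 4) * ipL x x) ((1 / 2 * ww x ^ 3 - ww x ^ 4) * ipL x (J x x)) (v x).re (v x).im (dv x).re (dv (J x x)).re (dv x).im (dv (J x x)).im τ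
    rw [norm_expand] at hE2
    have t4 : ww x ^ 4 * tt x ^ 4 = 1 := by rw [← mul_pow, ww_mul_tt hx, one_pow]
    have wx : ww x ^ 4 * ‖x‖ ^ 2 ≤ 1 := by
      have := pow_le_one₀ (n := 2) (by positivity) hws
      calc _ = (ww x ^ 2 * ‖x‖) ^ 2 := by ring
        _ ≤ 1 := this
    have hlast : ww x ^ 8 * (D * ‖x‖) ^ 2 ≤ ww x ^ 4 * D ^ 2 := by
      calc _ = ww x ^ 4 * D ^ 2 * (ww x ^ 4 * ‖x‖ ^ 2) := by ring
        _ ≤ ww x ^ 4 * D ^ 2 * 1 := by gcongr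
        _ = _ := mul_one _
    refine le_trans ?_ hlast
    have hfin : ww x ^ 8 * (-τ * (2 * (v x).re * ((1 / 2 * ww x ^ 3 - ww x ^ 4) * ipL x x * (dv x).re + (1 / 2 * ww x ^ 3 - ww x ^ 4) * ipL x (J x x) * (dv (J x x)).re) + 2 * (v x).im * ((1 / 2 * ww x ^ 3 - ww x ^ 4) * ipL x x * (dv x).im + (1 / 2 * ww x ^ 3 - ww x ^ 4) * ipL x (J x x) * (dv (J x x)).im)) - 2 * ((dv (J x x)).im * (dv x).re - (dv x).im * (dv (J x x)).re)) ≤ ww x ^ 8 * (D * ‖x‖) ^ 2 := by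
      gcongr
      exact hca.trans hE2
    refine le_trans (le_of_eq ?_) hfin
    have hV1 : V1 J x = (ww x ^ 8 * ((1 / 2 * ww x ^ 3 - ww x ^ 4) * ipL x x)) • x + (ww x ^ 8 * ((1 / 2 * ww x ^ 3 - ww x ^ 4) * ipL x (J x x))) • J x x := by
      rw [V1, ← ipL_YY, YY_eq, ipL_self, ← tt_pow4]
      congr 2
      · linear_combination -(1/2 * ww x ^ 7 - ww x ^ 8) * t4
      · ring
    have hV2 : V2 J (fun y => (v y).im) x = ww x ^ 8 • ((dv (J x x)).im • x - (dv x).im • J x x) := by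
      rw [V2, hq.fderiv, YY_eq]; rfl
    rw [hV1, hV2]
    generalize (1 / 2 * ww x ^ 3 - ww x ^ 4) * ipL x x = a
    generalize (1 / 2 * ww x ^ 3 - ww x ^ 4) * ipL x (J x x) = b
    generalize ww x ^ 8 = c
    simp
    ring
  · rw [V3, hq.fderiv]
    simp only [hsq, Icl_apply, mul_one, mul_zero]
    generalize ww x ^ 2 = c
    rw [Complex.sq_norm, Complex.normSq_apply, Complex.sq_norm, Complex.normSq_apply]
    simp only [ContinuousLinearMap.comp_apply, map_smul, map_add, map_sub, reCLM_apply, imCLM_apply, smul_eq_mul]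
    simp only [add_re, mul_re, I_re, I_im, add_im, mul_im]
    ring
  · linarith


theorem contDiffAt_WW {J : CC → (CC →L[ℝ] CC)} (hJ : ContDiff ℝ (⊤ : ℕ∞) J) {v : CC → ℂ} {x : CC} (hx : x ≠ 0)
    (hv : ContDiffAt ℝ (⊤ : ℕ∞) v x) (τ : ℝ) : ContDiffAt ℝ 1 (WW J v τ) x := by
  have hw : ContDiffAt ℝ (⊤ : ℕ∞) ww x := contDiffAt_ww hx
  have hid : ContDiffAt ℝ (⊤ : ℕ∞) (fun y : CC => y) x := contDiffAt_id
  have hN : ContDiffAt ℝ (⊤ : ℕ∞) (NN J) x := (hJ.contDiffAt.sub contDiffAt_const).clm_apply hid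
  have hY : ContDiffAt ℝ (⊤ : ℕ∞) (YY J) x := Icl.contDiff.contDiffAt.add hN
  have hn : ContDiffAt ℝ (⊤ : ℕ∞) (nn J) x := ipB.contDiff.contDiffAt.clm_apply hN
  have hp : ContDiffAt ℝ (⊤ : ℕ∞) (fun y => (v y).re) x := reCLM.contDiff.contDiffAt.comp x hv
  have hq : ContDiffAt ℝ (⊤ : ℕ∞) (fun y => (v y).im) x := imCLM.contDiff.contDiffAt.comp x hv
  have hQ : ContDiffAt ℝ (⊤ : ℕ∞) (fderiv ℝ (fun y => (v y).im)) x := hq.fderiv_right (by norm_cast)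
  have hc : ∀ c : CC, ContDiffAt ℝ (⊤ : ℕ∞) (fun _ : CC => c) x := fun c => contDiffAt_const
  have hcr : ∀ c : ℝ, ContDiffAt ℝ (⊤ : ℕ∞) (fun _ : CC => c) x := fun c => contDiffAt_const
  have h1 : ContDiffAt ℝ (⊤ : ℕ∞) (V1 J) x :=
    ((((hcr (1/2)).mul (hw.pow 7)).sub (hw.pow 8)).smul hid).add
      (((((hcr (1/2)).mul (hw.pow 11)).sub (hw.pow 12)).mul hn).smul hY)
  have h2 : ContDiffAt ℝ (⊤ : ℕ∞) (V2 J (fun y => (v y).im)) x :=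
    (hw.pow 8).smul (((hQ.clm_apply hY).smul hid).sub ((hQ.clm_apply hid).smul hY))
  have h3 : ContDiffAt ℝ (⊤ : ℕ∞) (V3 (fun y => (v y).im)) x :=
    (hw.pow 2).smul (((((hQ.clm_apply (hc _)).smul (hc _)).sub ((hQ.clm_apply (hc _)).smul (hc _))).add
      ((hQ.clm_apply (hc _)).smul (hc _))).sub ((hQ.clm_apply (hc _)).smul (hc _)))
  have : ContDiffAt ℝ (⊤ : ℕ∞) (WW J v τ) x :=
    (((hcr _).smul (((hp.pow 2).add (hq.pow 2)).smul h1)).add ((hcr _).smul (hp.smul h2))).add ((hcr _).smul (hp.smul h3))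
  exact this.of_le (by norm_cast)

theorem continuous_of_supp {f : CC → ℝ} {S : Set CC} (hS : IsClosed S) (hf : ∀ x ∈ S, ContinuousAt f x)
    (h0 : ∀ x, x ∉ S → f x = 0) : Continuous f := by
  rw [continuous_iff_continuousAt]
  intro x
  by_cases hx : x ∈ S
  · exact hf x hx
  · have : f =ᶠ[nhds x] fun _ => 0 := by
      filter_upwards [hS.isOpen_compl.mem_nhds hx] with y hy using h0 y hy
    exact continuousAt_const.congr this.symm

theorem hcs_of_supp {F : Type*} [NormedAddCommGroup F] {f : CC → F} {S : Set CC} (hS : IsCompact S)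
    (h0 : ∀ x, x ∉ S → f x = 0) : HasCompactSupport f :=
  HasCompactSupport.intro hS (fun x hx => h0 x hx)

noncomputable def w00 (k C : ℝ) : ℝ := 10 * (k + 1) + 8 * (1000 * (k + 1) ^ 3 + 6 * (16 * (k + 2) ^ 2) + 16 * (22 * k) ^ 2 + 4096) + 224 * C ^ 2 + 1

set_option maxHeartbeats 1000000 in
theorem carleman_zeta {J : CC → (CC →L[ℝ] CC)} (hJ : ContDiff ℝ (⊤ : ℕ∞) J) {f : CC → ℂ} (hf : ContDiff ℝ (⊤ : ℕ∞) f)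
    {ζ : CC → ℝ} (hζ : ContDiff ℝ (⊤ : ℕ∞) ζ) (hc : HasCompactSupport ζ) (h0 : (0 : CC) ∉ tsupport ζ) {k C τ : ℝ} (hk : 0 ≤ k)
    (hτ : 1 ≤ τ)
    (hS : ∀ x ∈ tsupport ζ, JBd J k x ∧ w00 k C ≤ ww x ∧ ∀ X, ‖fderiv ℝ f x X + I * fderiv ℝ f x (J x X)‖ ≤ C * ‖f x‖ * ‖X‖) :
    Integrable (fun x => τ / 16 * ww x ^ 7 * Real.exp (2 * τ * psi x) * ζ x ^ 2 * ‖f x‖ ^ 2) ∧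
    ∫ x, τ / 16 * ww x ^ 7 * Real.exp (2 * τ * psi x) * ζ x ^ 2 * ‖f x‖ ^ 2 ≤
    ∫ x, 14 * (k + 2) ^ 2 * ww x ^ 4 * Real.exp (2 * τ * psi x) * ‖fderiv ℝ ζ x‖ ^ 2 * ‖f x‖ ^ 2 := by
  set S := tsupport ζ with hSdef
  have hScl : IsClosed S := isClosed_tsupport ζ
  have hScp : IsCompact S := hc
  have hne : ∀ x ∈ S, x ≠ 0 := fun x hx h => h0 (h ▸ hx)
  have hζ0 : ∀ x, x ∉ S → ζ =ᶠ[nhds x] 0 := fun x hx => notMem_tsupport_iff_eventuallyEq.1 hx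
  have hdζ0 : ∀ x, x ∉ S → fderiv ℝ ζ x = 0 := fun x hx => by
    rw [(hζ0 x hx).fderiv_eq]; simp
  set v : CC → ℂ := fun y => Real.exp (τ * psi y) • (ζ y • f y) with hvdef
  have hv : ∀ x, x ≠ 0 → ContDiffAt ℝ (⊤ : ℕ∞) v x := fun x hx =>
    ((contDiffAt_const.mul (contDiffAt_psi hx)).exp).smul (hζ.contDiffAt.smul hf.contDiffAt)
  have hv0 : ∀ x, x ∉ S → v =ᶠ[nhds x] 0 := fun x hx => by
    filter_upwards [hζ0 x hx] with y hy
    simp [hvdef, hy]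
  have hW0 : ∀ x, x ∉ S → WW J v τ =ᶠ[nhds x] fun _ => 0 := fun x hx => by
    filter_upwards [hv0 x hx] with y hy
    simp [WW, hy]
  have hWc : ContDiff ℝ 1 (WW J v τ) := by
    rw [contDiff_iff_contDiffAt]
    intro x
    by_cases hx : x ∈ S
    · exact contDiffAt_WW hJ (hne x hx) (hv x (hne x hx)) τ
    · exact contDiffAt_const.congr_of_eventuallyEq (hW0 x hx)
  have hWs : HasCompactSupport (WW J v τ) := hcs_of_supp hScp fun x hx => (hW0 x hx).self_of_nhds
  obtain ⟨iW, eW⟩ := integral_divg hWc hWs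
  have conte : ∀ x ∈ S, ContinuousAt (fun y => Real.exp (2 * τ * psi y)) x := fun x hx =>
    (continuousAt_const.mul (contDiffAt_psi (n := 0) (hne x hx)).continuousAt).rexp
  have cw : ∀ x ∈ S, ContinuousAt ww x := fun x hx => (contDiffAt_ww (n := 0) (hne x hx)).continuousAt
  set L : CC → ℝ := fun x => τ / 16 * ww x ^ 7 * Real.exp (2 * τ * psi x) * ζ x ^ 2 * ‖f x‖ ^ 2 with hL
  set Rr : CC → ℝ := fun x => 14 * (k + 2) ^ 2 * ww x ^ 4 * Real.exp (2 * τ * psi x) * ‖fderiv ℝ ζ x‖ ^ 2 * ‖f x‖ ^ 2 with hR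
  have hL0 : ∀ x, x ∉ S → L x = 0 := fun x hx => by
    have : ζ x = 0 := (hζ0 x hx).self_of_nhds
    simp [hL, this]
  have hR0 : ∀ x, x ∉ S → Rr x = 0 := fun x hx => by
    simp [hR, hdζ0 x hx]
  have hLc : Continuous L := continuous_of_supp hScl (fun x hx =>
    (((continuousAt_const.mul ((cw x hx).pow 7)).mul (conte x hx)).mul (hζ.continuous.continuousAt.pow 2)).mul (hf.continuous.continuousAt.norm.pow 2)) hL0
  have hRc : Continuous Rr := continuous_of_supp hScl (fun x hx =>
    (((continuousAt_const.mul ((cw x hx).pow 4)).mul (conte x hx)).mul ((hζ.continuous_fderiv (by norm_cast)).continuousAt.norm.pow 2)).mul (hf.continuous.continuousAt.norm.pow 2)) hR0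
  have iL : Integrable L := hLc.integrable_of_hasCompactSupport (hcs_of_supp hScp hL0)
  have iR : Integrable Rr := hRc.integrable_of_hasCompactSupport (hcs_of_supp hScp hR0)
  have key : ∀ x, divg (WW J v τ) x + L x ≤ Rr x := by
    intro x
    by_cases hx : x ∈ S
    swap
    · rw [hL0 x hx, hR0 x hx, divg, (hW0 x hx).fderiv_eq]
      simp [trc]
    obtain ⟨hJB, hww, hfe⟩ := hS x hx
    have hx0 := hne x hx
    have hC2 := sq_nonneg C
    have hwk : 10 * (k + 1) ≤ ww x := by
      refine le_trans ?_ hww; unfold w00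
      have : 0 ≤ 8 * (1000 * (k + 1) ^ 3 + 6 * (16 * (k + 2) ^ 2) + 16 * (22 * k) ^ 2 + 4096) := by positivity
      linarith
    have hwl : 8 * (1000 * (k + 1) ^ 3 + 6 * (16 * (k + 2) ^ 2) + 16 * (22 * k) ^ 2 + 4096) ≤ ww x := by
      refine le_trans ?_ hww; unfold w00; linarith
    have hwC : 224 * C ^ 2 ≤ ww x := by
      refine le_trans ?_ hww; unfold w00
      have : 0 ≤ 8 * (1000 * (k + 1) ^ 3 + 6 * (16 * (k + 2) ^ 2) + 16 * (22 * k) ^ 2 + 4096) := by positivity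
      linarith
    have hw1 : 1 ≤ ww x := by linarith
    have hw0 := ww_pos hx0
    set E := Real.exp (τ * psi x) with hE
    have hE0 : 0 < E := Real.exp_pos _
    have hEE : Real.exp (2 * τ * psi x) = E ^ 2 := by rw [hE, ← Real.exp_nat_mul]; congr 1; push_cast; ring
    set D : ℝ := E * (C * |ζ x| * ‖f x‖ + (k + 2) * ‖fderiv ℝ ζ x‖ * ‖f x‖) with hD
    have hfd : HasFDerivAt f (fderiv ℝ f x) x := (hf.differentiable (by norm_cast) x).hasFDerivAt
    have hζd : HasFDerivAt ζ (fderiv ℝ ζ x) x := (hζ.differentiable (by norm_cast) x).hasFDerivAt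
    have hed := ((hasFDerivAt_psi hx0).const_mul τ).exp
    have hvd : HasFDerivAt v _ x := hed.smul (hζd.smul hfd)
    have hJn : ∀ X, ‖J x X‖ ≤ (1 + k) * ‖X‖ := by
      intro X
      have e1 : J x X = Icl X + (J x - Icl) X := by simp
      rw [e1]
      refine (norm_add_le _ _).trans ?_
      rw [norm_Icl_apply]
      have h1 := (J x - Icl).le_opNorm X
      have h2 : ‖J x - Icl‖ ≤ k := hJB.bK.trans (by nlinarith [norm_le_one_of_ww hx0 hw1, norm_nonneg x])
      nlinarith [norm_nonneg X]
    have hDb : ∀ X, ‖fderiv ℝ v x X + I * fderiv ℝ v x (J x X) - τ * (((1 / 2 * ww x ^ 3 - ww x ^ 4) * ipL x X : ℝ) + I * ((1 / 2 * ww x ^ 3 - ww x ^ 4) * ipL x (J x X) : ℝ)) * v x‖ ≤ D * ‖X‖ := by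
      intro X
      have e1 : fderiv ℝ v x X + I * fderiv ℝ v x (J x X) - τ * (((1 / 2 * ww x ^ 3 - ww x ^ 4) * ipL x X : ℝ) + I * ((1 / 2 * ww x ^ 3 - ww x ^ 4) * ipL x (J x X) : ℝ)) * v x
        = (E : ℂ) * ((ζ x : ℂ) * (fderiv ℝ f x X + I * fderiv ℝ f x (J x X)) + ((fderiv ℝ ζ x X : ℝ) + I * (fderiv ℝ ζ x (J x X) : ℝ)) * f x) := by
        rw [hvd.fderiv]
        simp only [hvdef, add_apply, smul_apply, ContinuousLinearMap.smulRight_apply, Pi.smul_apply', smul_eq_mul, Complex.real_smul, ← hE]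
        push_cast
        ring
      rw [e1, norm_mul, Complex.norm_real, Real.norm_eq_abs, abs_of_pos hE0, hD, mul_assoc]
      gcongr
      have q : ‖((fderiv ℝ ζ x X : ℝ) : ℂ) + I * (fderiv ℝ ζ x (J x X) : ℝ)‖ ≤ (k + 2) * ‖fderiv ℝ ζ x‖ * ‖X‖ := by
        refine (norm_add_le _ _).trans ?_
        rw [norm_mul, norm_I, one_mul, Complex.norm_real, Complex.norm_real]
        have q1 := (fderiv ℝ ζ x).le_opNorm X
        have q2 := (fderiv ℝ ζ x).le_opNorm (J x X)
        have q3 : ‖fderiv ℝ ζ x‖ * ‖J x X‖ ≤ ‖fderiv ℝ ζ x‖ * ((1 + k) * ‖X‖) := by gcongr; exact hJn X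
        linarith
      have r1 : ‖(ζ x : ℂ) * (fderiv ℝ f x X + I * fderiv ℝ f x (J x X))‖ ≤ |ζ x| * (C * ‖f x‖ * ‖X‖) := by
        rw [norm_mul, Complex.norm_real, Real.norm_eq_abs]
        exact mul_le_mul_of_nonneg_left (hfe X) (abs_nonneg _)
      have r2 : ‖(((fderiv ℝ ζ x X : ℝ) : ℂ) + I * (fderiv ℝ ζ x (J x X) : ℝ)) * f x‖ ≤ (k + 2) * ‖fderiv ℝ ζ x‖ * ‖X‖ * ‖f x‖ := by
        rw [norm_mul]
        exact mul_le_mul_of_nonneg_right q (norm_nonneg _)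
      refine (norm_add_le _ _).trans ((add_le_add r1 r2).trans (le_of_eq ?_))
      ring
    have main := carleman_pointwise hJB hx0 hk hτ hwk hwl ((hv x hx0).of_le (by norm_cast)) hDb
    have hvn : ‖v x‖ ^ 2 = E ^ 2 * ζ x ^ 2 * ‖f x‖ ^ 2 := by
      simp only [hvdef, norm_smul, Real.norm_eq_abs, mul_pow, sq_abs, ← hE]; ring
    have hD2 : D ^ 2 ≤ 2 * E ^ 2 * (C ^ 2 * ζ x ^ 2 * ‖f x‖ ^ 2 + (k + 2) ^ 2 * ‖fderiv ℝ ζ x‖ ^ 2 * ‖f x‖ ^ 2) := by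
      have : D ^ 2 ≤ E ^ 2 * (2 * ((C * |ζ x| * ‖f x‖) ^ 2 + ((k + 2) * ‖fderiv ℝ ζ x‖ * ‖f x‖) ^ 2)) := by
        rw [hD, mul_pow]; gcongr; exact add_sq_le
      refine this.trans (le_of_eq ?_)
      rw [mul_pow, mul_pow, sq_abs]; ring
    have h7 : 7 * ww x ^ 4 * D ^ 2 ≤ 7 * ww x ^ 4 * (2 * E ^ 2 * (C ^ 2 * ζ x ^ 2 * ‖f x‖ ^ 2 + (k + 2) ^ 2 * ‖fderiv ℝ ζ x‖ ^ 2 * ‖f x‖ ^ 2)) := by gcongr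
    have habs : 14 * C ^ 2 * ww x ^ 4 * (E ^ 2 * ζ x ^ 2 * ‖f x‖ ^ 2) ≤ τ / 16 * ww x ^ 7 * (E ^ 2 * ζ x ^ 2 * ‖f x‖ ^ 2) := by
      refine mul_le_mul_of_nonneg_right ?_ (by positivity)
      have w3 : ww x ≤ ww x ^ 3 := le_self_pow₀ hw1 (by norm_num)
      calc 14 * C ^ 2 * ww x ^ 4 = 1 / 16 * (224 * C ^ 2) * ww x ^ 4 := by ring
        _ ≤ τ / 16 * (ww x ^ 3) * ww x ^ 4 := by
          refine mul_le_mul_of_nonneg_right ?_ (by positivity)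
          exact mul_le_mul (by linarith) (by linarith) (by positivity) (by positivity)
        _ = _ := by ring
    rw [hvn] at main
    simp only [hL, hR, hEE]
    nlinarith [main, h7, habs]
  have h1 : ∫ x, (divg (WW J v τ) x + L x) ≤ ∫ x, Rr x := integral_mono (iW.add iL) iR key
  rw [integral_add iW iL, eW, zero_add] at h1
  exact ⟨iL, h1⟩


theorem exists_JBd {J : CC → (CC →L[ℝ] CC)} (hJ : ContDiff ℝ (⊤ : ℕ∞) J) (hJ0 : J 0 = Icl) :
    ∃ k : ℝ, 0 ≤ k ∧ ∀ x : CC, ‖x‖ ≤ 1 → JBd J k x := by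
  have hc : Continuous (fun x => fderiv ℝ J x) := hJ.continuous_fderiv (by norm_cast)
  obtain ⟨M, hM⟩ := (isCompact_closedBall (0 : CC) 1).exists_bound_of_continuousOn (E := CC →L[ℝ] CC →L[ℝ] CC) hc.continuousOn
  have hM0 : 0 ≤ M := (norm_nonneg _).trans (hM 0 (by simp))
  have hd : ∀ x, DifferentiableAt ℝ J x := fun x => hJ.differentiable (by norm_cast) x
  refine ⟨2 * M, by positivity, fun x hx => ?_⟩
  have hx' : x ∈ closedBall (0 : CC) 1 := by simpa using hx
  have hb : ‖J x - Icl‖ ≤ M * ‖x‖ := by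
    have := (convex_closedBall (0 : CC) 1).norm_image_sub_le_of_norm_fderiv_le (𝕜 := ℝ) (f := J) (C := M)
      (fun y _ => hd y) (fun y hy => hM y hy) (x := 0) (y := x) (by simp) hx'
    simpa [hJ0] using this
  have hN : HasFDerivAt (NN J) _ x := (((hd x).hasFDerivAt.sub_const Icl)).clm_apply (hasFDerivAt_id x)
  refine ⟨hN.differentiableAt, hb.trans (by nlinarith [norm_nonneg x, mul_nonneg hM0 (norm_nonneg x)]), ?_⟩
  rw [hN.fderiv]
  refine (norm_add_le _ _).trans ?_
  have h1 : ‖(J x - Icl).comp (ContinuousLinearMap.id ℝ CC)‖ ≤ M * ‖x‖ := by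
    rw [ContinuousLinearMap.comp_id]; exact hb
  have h2 : ‖(fderiv ℝ J x).flip x‖ ≤ M * ‖x‖ := by
    refine ((fderiv ℝ J x).flip.le_opNorm x).trans ?_
    rw [ContinuousLinearMap.opNorm_flip]
    gcongr
    exact hM x hx'
  have := add_le_add h1 h2
  refine le_trans this (le_of_eq ?_)
  ring

theorem exists_eta_bound : ∃ B : ℝ, 0 ≤ B ∧ ∀ t, |deriv Real.smoothTransition t| ≤ B := by
  have hc : Continuous (deriv Real.smoothTransition) :=
    (Real.smoothTransition.contDiff (n := 1)).continuous_deriv (by norm_num)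
  obtain ⟨B, hB⟩ := (isCompact_Icc (a := (0 : ℝ)) (b := 1)).exists_bound_of_continuousOn hc.continuousOn
  have hB0 : 0 ≤ B := (norm_nonneg _).trans (hB 0 (by simp))
  refine ⟨B, hB0, fun t => ?_⟩
  by_cases ht : t ∈ Set.Icc (0 : ℝ) 1
  · exact hB t ht
  · have : deriv Real.smoothTransition t = 0 := by
      rw [Set.mem_Icc, not_and_or, not_le, not_le] at ht
      rcases ht with h | h
      · have : Real.smoothTransition =ᶠ[nhds t] fun _ => 0 := by
          filter_upwards [Iio_mem_nhds h] with y hy using Real.smoothTransition.zero_of_nonpos (le_of_lt hy)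
        rw [this.deriv_eq]; simp
      · have : Real.smoothTransition =ᶠ[nhds t] fun _ => 1 := by
          filter_upwards [Ioi_mem_nhds h] with y hy using Real.smoothTransition.one_of_one_le (le_of_lt hy)
        rw [this.deriv_eq]; simp
    rw [this]; simpa using hB0

theorem deriv_eta_nonpos {t : ℝ} (ht : t ≤ 0) : deriv Real.smoothTransition t = 0 := by
  apply IsLocalMin.deriv_eq_zero
  filter_upwards with y
  rw [Real.smoothTransition.zero_of_nonpos ht]; exact Real.smoothTransition.nonneg y

theorem deriv_eta_one_le {t : ℝ} (ht : 1 ≤ t) : deriv Real.smoothTransition t = 0 := by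
  apply IsLocalMax.deriv_eq_zero
  filter_upwards with y
  rw [Real.smoothTransition.one_of_one_le ht]; exact Real.smoothTransition.le_one y

noncomputable def zet (δ R : ℝ) (x : CC) : ℝ :=
  Real.smoothTransition (δ⁻¹ * ss x - 1) * (1 - Real.smoothTransition (R⁻¹ * ss x - 1))

theorem contDiff_zet (δ R : ℝ) : ContDiff ℝ (⊤ : ℕ∞) (zet δ R) := by
  have h : ∀ c : ℝ, ContDiff ℝ (⊤ : ℕ∞) (fun x : CC => Real.smoothTransition (c⁻¹ * ss x - 1)) := fun c =>
    Real.smoothTransition.contDiff.comp ((contDiff_const.mul contDiff_ss).sub contDiff_const)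
  exact (h δ).mul (contDiff_const.sub (h R))

theorem zet_eq_one {δ R : ℝ} (hδ : 0 < δ) (hR : 0 < R) {x : CC} (h1 : 2 * δ ≤ ss x) (h2 : ss x ≤ R) : zet δ R x = 1 := by
  have e1 : 1 ≤ δ⁻¹ * ss x - 1 := by
    have : δ⁻¹ * (2 * δ) ≤ δ⁻¹ * ss x := by gcongr
    have e : δ⁻¹ * (2 * δ) = 2 := by field_simp
    linarith
  have e2 : R⁻¹ * ss x - 1 ≤ 0 := by
    have : R⁻¹ * ss x ≤ R⁻¹ * R := by gcongr
    have e : R⁻¹ * R = 1 := by field_simp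
    linarith
  rw [zet, Real.smoothTransition.one_of_one_le e1, Real.smoothTransition.zero_of_nonpos e2]; simp

theorem zet_supp {δ R : ℝ} (hδ : 0 < δ) (hR : 0 < R) : tsupport (zet δ R) ⊆ {x | δ ≤ ss x ∧ ss x ≤ 2 * R} := by
  apply closure_minimal
  · intro x hx
    rw [Function.mem_support] at hx
    by_contra hcon
    apply hx
    rw [Set.mem_setOf_eq, not_and_or, not_le, not_le] at hcon
    rcases hcon with h | h
    · have e2 : δ⁻¹ * ss x - 1 ≤ 0 := by
        have : δ⁻¹ * ss x ≤ δ⁻¹ * δ := by gcongr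
        have e : δ⁻¹ * δ = 1 := by field_simp
        linarith
      rw [zet, Real.smoothTransition.zero_of_nonpos e2]; simp
    · have e1 : 1 ≤ R⁻¹ * ss x - 1 := by
        have : R⁻¹ * (2 * R) ≤ R⁻¹ * ss x := by gcongr
        have e : R⁻¹ * (2 * R) = 2 := by field_simp
        linarith
      rw [zet, Real.smoothTransition.one_of_one_le e1]; simp
  · have c : Continuous ss := (contDiff_ss (n := 0)).continuous
    exact (isClosed_le continuous_const c).inter (isClosed_le c continuous_const)

theorem norm_ipL_sq (x : CC) : ‖ipL x‖ ^ 2 ≤ 16 * ss x := by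
  have : ‖ipL x‖ ≤ 4 * ‖x‖ := (ipL x).opNorm_le_bound (by positivity) fun y => by
    rw [Real.norm_eq_abs]; exact abs_ipL_le x y
  have h2 := norm_sq_le_ss x
  nlinarith [norm_nonneg (ipL x), norm_nonneg x]

theorem hasFDerivAt_zet (δ R : ℝ) (x : CC) : HasFDerivAt (zet δ R)
   ((Real.smoothTransition (δ⁻¹ * ss x - 1) * -(deriv Real.smoothTransition (R⁻¹ * ss x - 1) * R⁻¹ * 2) +
    (1 - Real.smoothTransition (R⁻¹ * ss x - 1)) * (deriv Real.smoothTransition (δ⁻¹ * ss x - 1) * δ⁻¹ * 2)) • ipL x) x := by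
  have h : ∀ c : ℝ, HasFDerivAt (fun x : CC => Real.smoothTransition (c⁻¹ * ss x - 1))
      ((deriv Real.smoothTransition (c⁻¹ * ss x - 1)) • (c⁻¹ • ((2 : ℝ) • ipL x))) x := fun c => by
    have h1 : HasDerivAt Real.smoothTransition (deriv Real.smoothTransition (c⁻¹ * ss x - 1)) (c⁻¹ * ss x - 1) :=
      ((Real.smoothTransition.contDiff (n := 1)).differentiable (by norm_num) _).hasDerivAt
    exact h1.comp_hasFDerivAt x (((hasFDerivAt_ss x).const_mul c⁻¹).sub_const 1)
  have := (h δ).mul ((h R).const_sub 1)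
  refine this.congr_fderiv ?_
  ext <;> simp <;> ring

theorem fderiv_zet_bound {B : ℝ} (hB0 : 0 ≤ B) (hB : ∀ t, |deriv Real.smoothTransition t| ≤ B) {δ R : ℝ}
    (hδ : 0 < δ) (hR : 2 * δ ≤ R) (x : CC) :
    fderiv ℝ (zet δ R) x = 0 ∨ (δ ≤ ss x ∧ ss x ≤ 2 * δ ∧ ‖fderiv ℝ (zet δ R) x‖ ^ 2 ≤ 128 * B ^ 2 / δ) ∨
      (R ≤ ss x ∧ ss x ≤ 2 * R ∧ ‖fderiv ℝ (zet δ R) x‖ ^ 2 ≤ 128 * B ^ 2 / R) := by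
  have hR0 : 0 < R := by linarith
  rw [(hasFDerivAt_zet δ R x).fderiv]
  have le0 : ∀ c : ℝ, 0 < c → ss x ≤ c → deriv Real.smoothTransition (c⁻¹ * ss x - 1) = 0 := fun c hc h => by
    apply deriv_eta_nonpos
    have : c⁻¹ * ss x ≤ c⁻¹ * c := by gcongr
    have e : c⁻¹ * c = 1 := by field_simp
    linarith
  have ge1 : ∀ c : ℝ, 0 < c → 2 * c ≤ ss x → deriv Real.smoothTransition (c⁻¹ * ss x - 1) = 0 := fun c hc h => by
    apply deriv_eta_one_le
    have : c⁻¹ * (2 * c) ≤ c⁻¹ * ss x := by gcongr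
    have e : c⁻¹ * (2 * c) = 2 := by field_simp
    linarith
  have gen : ∀ c a d : ℝ, 0 < c → ss x ≤ 2 * c → |a| ≤ 1 → |d| ≤ B → ‖(a * (d * c⁻¹ * 2)) • ipL x‖ ^ 2 ≤ 128 * B ^ 2 / c := by
    intro c a d hc h ha hd
    rw [norm_smul, mul_pow, Real.norm_eq_abs, sq_abs]
    have a2 : a ^ 2 ≤ 1 := by rw [← sq_abs]; nlinarith [abs_nonneg a]
    have d2 : d ^ 2 ≤ B ^ 2 := by rw [← sq_abs]; nlinarith [abs_nonneg d]
    have ad : a ^ 2 * d ^ 2 ≤ 1 * B ^ 2 := mul_le_mul a2 d2 (sq_nonneg _) (by norm_num)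
    have ip := norm_ipL_sq x
    calc (a * (d * c⁻¹ * 2)) ^ 2 * ‖ipL x‖ ^ 2 = (a ^ 2 * d ^ 2) * (4 * (c⁻¹) ^ 2 * ‖ipL x‖ ^ 2) := by ring
      _ ≤ (1 * B ^ 2) * (4 * (c⁻¹) ^ 2 * (16 * (2 * c))) := by gcongr; linarith
      _ = _ := by field_simp; ring
  have b01 : ∀ t, |Real.smoothTransition t| ≤ 1 := fun t => by
    rw [abs_of_nonneg (Real.smoothTransition.nonneg t)]; exact Real.smoothTransition.le_one t
  have b02 : ∀ t, |1 - Real.smoothTransition t| ≤ 1 := fun t => by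
    rw [abs_of_nonneg (by linarith [Real.smoothTransition.le_one t])]; linarith [Real.smoothTransition.nonneg t]
  rcases le_total (ss x) δ with h1 | h1
  · left; rw [le0 δ hδ h1, le0 R hR0 (by linarith)]; simp
  rcases le_total (ss x) (2 * δ) with h2 | h2
  · right; left
    refine ⟨h1, h2, ?_⟩
    rw [le0 R hR0 (by linarith)]
    have := gen δ _ _ hδ h2 (b02 (R⁻¹ * ss x - 1)) (hB (δ⁻¹ * ss x - 1))
    simpa using this
  rcases le_total (ss x) R with h3 | h3
  · left; rw [ge1 δ hδ h2, le0 R hR0 h3]; simp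
  rcases le_total (ss x) (2 * R) with h4 | h4
  · right; right
    refine ⟨h3, h4, ?_⟩
    rw [ge1 δ hδ h2]
    have := gen R (-Real.smoothTransition (δ⁻¹ * ss x - 1)) _ hR0 h4 (by rw [abs_neg]; exact b01 _) (hB (R⁻¹ * ss x - 1))
    simpa using this
  · left; rw [ge1 δ hδ h2, ge1 R hR0 h4]; simp

/-- the phase as a function of `ss`. -/
noncomputable def phs (R : ℝ) : ℝ := √√R - 2 * Real.log (√√R)

theorem psi_eq (x : CC) : psi x = phs (ss x) := rfl

theorem phs_anti {a b : ℝ} (ha : 0 < a) (hab : a ≤ b) (hb : b ≤ 1) : phs b ≤ phs a := by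
  unfold phs
  have hs : 0 < √√a := Real.sqrt_pos.2 (Real.sqrt_pos.2 ha)
  have hst : √√a ≤ √√b := Real.sqrt_le_sqrt (Real.sqrt_le_sqrt hab)
  have ht1 : √√b ≤ 1 := Real.sqrt_le_one.2 (Real.sqrt_le_one.2 hb)
  set s := √√a
  set t := √√b
  have ht : 0 < t := by linarith
  have h1 := Real.one_sub_inv_le_log_of_pos (div_pos ht hs)
  rw [Real.log_div ht.ne' hs.ne', inv_div] at h1
  have h2 : t - s ≤ 1 - s / t := by
    rw [show 1 - s / t = (t - s) / t by field_simp]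
    rw [le_div_iff₀ ht]; nlinarith
  linarith

theorem exp_phs {a : ℝ} (ha : 0 < a) (n : ℕ) : Real.exp (2 * n * phs a) = Real.exp (2 * n * √√a) * a⁻¹ ^ n := by
  unfold phs
  have hs : 0 < √√a := Real.sqrt_pos.2 (Real.sqrt_pos.2 ha)
  have h4 : (√√a) ^ 4 = a := by
    rw [show (√√a) ^ 4 = ((√√a) ^ 2) ^ 2 by ring, Real.sq_sqrt (Real.sqrt_nonneg _), Real.sq_sqrt ha.le]
  have hl : Real.log a = 4 * Real.log (√√a) := by
    conv_lhs => rw [← h4]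
    rw [Real.log_pow]; norm_num
  rw [show 2 * (n : ℝ) * (√√a - 2 * Real.log √√a) = 2 * n * √√a + n * (-Real.log a) by rw [hl]; ring, Real.exp_add, Real.exp_nat_mul,
    Real.exp_neg, Real.exp_log ha]

set_option maxHeartbeats 1000000 in
theorem sucp {J : CC → (CC →L[ℝ] CC)} (hJ : ContDiff ℝ (⊤ : ℕ∞) J) (hJ0 : J 0 = Icl) {f : CC → ℂ}
    (hf : ContDiff ℝ (⊤ : ℕ∞) f) {ρ C : ℝ} (hρ : 0 < ρ)
    (hE : ∀ x ∈ ball (0 : CC) ρ, ∀ X, ‖fderiv ℝ f x X + I * fderiv ℝ f x (J x X)‖ ≤ C * ‖f x‖ * ‖X‖)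
    (hfl : ∀ N : ℕ, ∃ C' : ℝ, ∀ x : CC, ‖x‖ ≤ 1 → ‖f x‖ ≤ C' * ‖x‖ ^ N) :
    ∀ᶠ x in nhds (0 : CC), f x = 0 := by
  obtain ⟨k, hk, hJB⟩ := exists_JBd hJ hJ0
  obtain ⟨B, hB0, hB⟩ := exists_eta_bound
  have hw0 : 1 ≤ w00 k C := by
    unfold w00
    have : 0 ≤ 10 * (k + 1) + 8 * (1000 * (k + 1) ^ 3 + 6 * (16 * (k + 2) ^ 2) + 16 * (22 * k) ^ 2 + 4096) + 224 * C ^ 2 := by positivity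
    linarith
  set w0 := w00 k C with hw0d
  obtain ⟨R, hR0, hR1, hRρ, hRw⟩ : ∃ R : ℝ, 0 < R ∧ 2 * R ≤ 1 ∧ 2 * R < ρ ^ 2 ∧ 2 * R ≤ (w0⁻¹) ^ 4 := by
    have h1 : 0 < ρ ^ 2 := by positivity
    have h2 : 0 < (w0⁻¹) ^ 4 := by positivity
    refine ⟨min (min 1 (ρ ^ 2 / 2)) ((w0⁻¹) ^ 4) / 2, by positivity, ?_, ?_, ?_⟩
    · have := (min_le_left (min 1 (ρ ^ 2 / 2)) ((w0⁻¹) ^ 4)).trans (min_le_left _ _); linarith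
    · have := (min_le_left (min 1 (ρ ^ 2 / 2)) ((w0⁻¹) ^ 4)).trans (min_le_right _ _); linarith
    · have := (min_le_right (min 1 (ρ ^ 2 / 2)) ((w0⁻¹) ^ 4)); linarith
  have hcss : Continuous ss := (contDiff_ss (n := 0)).continuous
  have hn1 : ∀ x, ss x ≤ 2 * R → ‖x‖ ≤ 1 := fun x hx => by
    have := norm_sq_le_ss x; nlinarith [norm_nonneg x]
  have hnρ : ∀ x, ss x ≤ 2 * R → ‖x‖ < ρ := fun x hx => by
    have := norm_sq_le_ss x; nlinarith [norm_nonneg x]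
  have hww : ∀ x, x ≠ 0 → ss x ≤ 2 * R → w0 ≤ ww x := fun x hx0 hx => by
    have h4 := tt_pow4 x
    have : tt x ≤ w0⁻¹ := by
      apply le_of_pow_le_pow_left₀ (n := 4) (by norm_num) (by positivity); rw [h4]; linarith
    unfold ww
    rw [le_inv_comm₀ (by linarith) (tt_pos hx0)]; exact this
  have hss0 : ss 0 = 0 := by simp [ss]
  have hne : ∀ x, 0 < ss x → x ≠ 0 := fun x hx h => by rw [h, hss0] at hx; exact lt_irrefl _ hx
  have hw4 : ∀ x, 0 < ss x → ww x ^ 4 = (ss x)⁻¹ := fun x hx => by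
    rw [ww, inv_pow, tt_pow4]
  obtain ⟨F, hF⟩ := (isCompact_closedBall (0 : CC) 1).exists_bound_of_continuousOn hf.continuous.continuousOn
  have hF0 : 0 ≤ F := (norm_nonneg _).trans (hF 0 (by simp))
  set V : ℝ := (volume (closedBall (0 : CC) 1)).toReal with hV
  have hV0 : 0 ≤ V := ENNReal.toReal_nonneg
  have hVf : volume (closedBall (0 : CC) 1) ≠ ⊤ := measure_closedBall_lt_top.ne
  set c : ℝ := 14 * (k + 2) ^ 2 * R⁻¹ * (128 * B ^ 2 / R) * F ^ 2 with hc
  have hc0 : 0 ≤ c := by positivity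
  have key : ∀ ε : ℝ, 0 < ε → ∀ n : ℕ, 1 ≤ n →
      (n : ℝ) / 16 * ∫ x in {x | ε ≤ ss x ∧ ss x ≤ R}, ‖f x‖ ^ 2 ≤ V * c := by
    intro ε hε n hn
    obtain ⟨CN, hCN⟩ := hfl (n + 3)
    set E : ℝ := Real.exp (2 * n * phs R) with hEd
    have hE0 : 0 < E := Real.exp_pos _
    set Kn : ℝ := 14 * (k + 2) ^ 2 * Real.exp (2 * n) * (128 * B ^ 2) * CN ^ 2 * 4 with hKn
    have hKn0 : 0 ≤ Kn := by positivity
    have hn1' : (1 : ℝ) ≤ n := by exact_mod_cast hn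
    have step : ∀ δ : ℝ, 0 < δ → 2 * δ ≤ ε → 2 * δ ≤ R →
        (n : ℝ) / 16 * E * ∫ x in {x | ε ≤ ss x ∧ ss x ≤ R}, ‖f x‖ ^ 2 ≤ V * (Kn * δ + c * E) := by
      intro δ hδ hδε hδR
      have hsup := zet_supp hδ hR0
      have hcsup : HasCompactSupport (zet δ R) := by
        refine hcs_of_supp (isCompact_closedBall (0 : CC) 1) fun x hx => ?_
        by_contra h
        have := hsup (subset_tsupport _ h)
        exact hx (by simpa using hn1 x this.2)
      have h0t : (0 : CC) ∉ tsupport (zet δ R) := fun h => by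
        have := (hsup h).1; rw [hss0] at this; linarith
      obtain ⟨iL, hcz⟩ := carleman_zeta hJ hf (contDiff_zet δ R) hcsup h0t (k := k) (C := C) (τ := n) hk hn1' (by
        intro x hx
        have h := hsup hx
        have hx0 : x ≠ 0 := hne x (by linarith [h.1])
        exact ⟨hJB x (hn1 x h.2), hww x hx0 h.2, hE x (by simpa using hnρ x h.2)⟩)
      have lower : (n : ℝ) / 16 * E * ∫ x in {x | ε ≤ ss x ∧ ss x ≤ R}, ‖f x‖ ^ 2 ≤
          ∫ x, (n : ℝ) / 16 * ww x ^ 7 * Real.exp (2 * n * psi x) * zet δ R x ^ 2 * ‖f x‖ ^ 2 := by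
        rw [← integral_const_mul]
        have mA : MeasurableSet {x : CC | ε ≤ ss x ∧ ss x ≤ R} :=
          ((isClosed_le continuous_const hcss).inter (isClosed_le hcss continuous_const)).measurableSet
        refine le_trans ?_ (setIntegral_le_integral (s := {x | ε ≤ ss x ∧ ss x ≤ R}) iL ?_)
        · refine setIntegral_mono_on ?_ iL.integrableOn mA ?_
          · refine (ContinuousOn.integrableOn_compact (isCompact_closedBall (0 : CC) 1) ?_).mono_set ?_
            · exact (continuous_const.mul (hf.continuous.norm.pow 2)).continuousOn
            · intro x hx; simpa using hn1 x (by linarith [hx.2])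
          · intro x hx
            have hs : 0 < ss x := by linarith [hx.1]
            rw [zet_eq_one hδ hR0 (by linarith [hx.1]) hx.2, one_pow, mul_one]
            have w1 : 1 ≤ ww x := hw0.trans (hww x (hne x hs) (by linarith [hx.2]))
            have w7 : 1 ≤ ww x ^ 7 := one_le_pow₀ w1
            have e1 : E ≤ Real.exp (2 * n * psi x) := by
              rw [psi_eq, hEd]; gcongr; exact phs_anti hs hx.2 (by linarith)
            calc (n : ℝ) / 16 * E * ‖f x‖ ^ 2 = (n : ℝ) / 16 * 1 * E * ‖f x‖ ^ 2 := by ring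
              _ ≤ _ := by gcongr
        · filter_upwards with x
          rcases eq_or_ne x 0 with rfl | hx
          · have : zet δ R 0 = 0 := image_eq_zero_of_notMem_tsupport h0t
            simp [this]
          · have := ww_pos hx
            change (0 : ℝ) ≤ _
            positivity
      have upper : ∫ x, 14 * (k + 2) ^ 2 * ww x ^ 4 * Real.exp (2 * n * psi x) * ‖fderiv ℝ (zet δ R) x‖ ^ 2 * ‖f x‖ ^ 2 ≤ V * (Kn * δ + c * E) := by
        have e : V * (Kn * δ + c * E) = ∫ x, (closedBall (0 : CC) 1).indicator (fun _ => Kn * δ + c * E) x := by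
          rw [integral_indicator_const _ measurableSet_closedBall]; rfl
        rw [e]
        refine integral_mono_of_nonneg ?_ ((integrable_indicator_iff measurableSet_closedBall).2 (by
          refine integrableOn_const hVf)) ?_
        · filter_upwards with x
          change (0 : ℝ) ≤ _
          positivity
        · filter_upwards with x
          change 14 * (k + 2) ^ 2 * ww x ^ 4 * Real.exp (2 * n * psi x) * ‖fderiv ℝ (zet δ R) x‖ ^ 2 * ‖f x‖ ^ 2 ≤ (closedBall (0 : CC) 1).indicator (fun _ => Kn * δ + c * E) x
          have hpos : 0 ≤ (closedBall (0 : CC) 1).indicator (fun _ => Kn * δ + c * E) x :=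
            Set.indicator_nonneg (fun _ _ => by positivity) _
          rcases fderiv_zet_bound hB0 hB hδ hδR x with h | ⟨h1, h2, h3⟩ | ⟨h1, h2, h3⟩
          · rw [h]; simpa using hpos
          · have hs : 0 < ss x := by linarith
            have hx1 := hn1 x (by linarith)
            rw [Set.indicator_of_mem (by simpa using hx1), hw4 x hs, psi_eq, exp_phs hs]
            have f2 : ‖f x‖ ^ 2 ≤ CN ^ 2 * ss x ^ (n + 3) := by
              have h := hCN x hx1
              calc ‖f x‖ ^ 2 ≤ (CN * ‖x‖ ^ (n + 3)) ^ 2 := by gcongr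
                _ = CN ^ 2 * (‖x‖ ^ 2) ^ (n + 3) := by ring
                _ ≤ _ := by gcongr; exact norm_sq_le_ss x
            have e1 : Real.exp (2 * n * √√(ss x)) ≤ Real.exp (2 * n) := by
              have h5 : √√(ss x) ≤ 1 := Real.sqrt_le_one.2 (Real.sqrt_le_one.2 (by linarith))
              apply Real.exp_le_exp.2
              nlinarith
            calc 14 * (k + 2) ^ 2 * (ss x)⁻¹ * (Real.exp (2 * n * √√(ss x)) * (ss x)⁻¹ ^ n) * ‖fderiv ℝ (zet δ R) x‖ ^ 2 * ‖f x‖ ^ 2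
                ≤ 14 * (k + 2) ^ 2 * (ss x)⁻¹ * (Real.exp (2 * n) * (ss x)⁻¹ ^ n) * (128 * B ^ 2 / δ) * (CN ^ 2 * ss x ^ (n + 3)) := by gcongr
              _ = 14 * (k + 2) ^ 2 * Real.exp (2 * n) * (128 * B ^ 2 / δ) * CN ^ 2 * (ss x) ^ 2 := by
                rw [inv_pow]; field_simp; ring
              _ ≤ 14 * (k + 2) ^ 2 * Real.exp (2 * n) * (128 * B ^ 2 / δ) * CN ^ 2 * (2 * δ) ^ 2 := by gcongr
              _ = Kn * δ := by rw [hKn]; field_simp; ring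
              _ ≤ _ := by have := mul_nonneg hc0 hE0.le; linarith
          · have hs : 0 < ss x := by linarith
            have hx1 := hn1 x (by linarith)
            rw [Set.indicator_of_mem (by simpa using hx1), hw4 x hs, psi_eq]
            have e1 : Real.exp (2 * n * phs (ss x)) ≤ E := by
              rw [hEd]; gcongr; exact phs_anti hR0 h1 (by linarith)
            have hfF : ‖f x‖ ≤ F := hF x (by simpa using hx1)
            calc 14 * (k + 2) ^ 2 * (ss x)⁻¹ * Real.exp (2 * n * phs (ss x)) * ‖fderiv ℝ (zet δ R) x‖ ^ 2 * ‖f x‖ ^ 2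
                ≤ 14 * (k + 2) ^ 2 * R⁻¹ * E * (128 * B ^ 2 / R) * F ^ 2 := by gcongr
              _ = c * E := by rw [hc]; ring
              _ ≤ _ := by have := mul_nonneg hKn0 hδ.le; linarith
      exact lower.trans (hcz.trans upper)
    set X := ∫ x in {x | ε ≤ ss x ∧ ss x ≤ R}, ‖f x‖ ^ 2
    have lim : (n : ℝ) / 16 * E * X ≤ V * (c * E) := by
      refine le_of_forall_pos_le_add fun e he => ?_
      set d := min (min (ε / 2) (R / 2)) (e / (V * Kn + 1)) with hd
      have hVK : 0 ≤ V * Kn := by positivity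
      have hd0 : 0 < d := by positivity
      have d1 : d ≤ ε / 2 := (min_le_left _ _).trans (min_le_left _ _)
      have d2 : d ≤ R / 2 := (min_le_left _ _).trans (min_le_right _ _)
      have d3 : d ≤ e / (V * Kn + 1) := min_le_right _ _
      have := step d hd0 (by linarith) (by linarith)
      rw [le_div_iff₀ (by linarith)] at d3
      nlinarith
    have : E * ((n : ℝ) / 16 * X) ≤ E * (V * c) := by linarith
    exact le_of_mul_le_mul_left this hE0
  have zero : ∀ ε : ℝ, 0 < ε → ∀ x : CC, ε < ss x → ss x < R → f x = 0 := by
    intro ε hε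
    set X := ∫ x in {x : CC | ε ≤ ss x ∧ ss x ≤ R}, ‖f x‖ ^ 2 with hX
    have hX0 : 0 ≤ X := setIntegral_nonneg_of_ae (by filter_upwards with x; positivity)
    have hXz : X = 0 := by
      by_contra hne0
      have hXp : 0 < X := lt_of_le_of_ne hX0 (Ne.symm hne0)
      obtain ⟨n, hn⟩ := exists_nat_gt (16 * (V * c) / X)
      have h1 := key ε hε (n + 1) (by omega)
      rw [div_lt_iff₀ hXp] at hn
      push_cast at h1
      nlinarith
    have io : IntegrableOn (fun x : CC => ‖f x‖ ^ 2) {x : CC | ε ≤ ss x ∧ ss x ≤ R} := by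
      refine (ContinuousOn.integrableOn_compact (isCompact_closedBall (0 : CC) 1) ?_).mono_set ?_
      · exact (hf.continuous.norm.pow 2).continuousOn
      · intro x hx; simpa using hn1 x (by linarith [hx.2])
    have h1 := (setIntegral_eq_zero_iff_of_nonneg_ae (by filter_upwards with x; positivity) io).1 hXz
    have hO : IsOpen {x : CC | ε < ss x ∧ ss x < R} :=
      (isOpen_lt continuous_const hcss).inter (isOpen_lt hcss continuous_const)
    have h2 : (fun x : CC => ‖f x‖ ^ 2) =ᵐ[volume.restrict {x : CC | ε < ss x ∧ ss x < R}] (fun _ => (0 : ℝ)) :=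
      ae_mono (Measure.restrict_mono (fun x (hx : ε < ss x ∧ ss x < R) => (⟨hx.1.le, hx.2.le⟩ : ε ≤ ss x ∧ ss x ≤ R)) le_rfl) h1
    have h3 := Measure.eqOn_open_of_ae_eq h2 hO (hf.continuous.norm.pow 2).continuousOn continuousOn_const
    intro x h4 h5
    simpa using h3 ⟨h4, h5⟩
  have f0 : f 0 = 0 := by
    obtain ⟨C', hC'⟩ := hfl 1
    simpa using hC' 0 (by simp)
  have : ∀ᶠ x in nhds (0 : CC), ss x < R := hcss.continuousAt.eventually_lt continuousAt_const (by rw [hss0]; exact hR0)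
  filter_upwards [this] with x hx
  rcases eq_or_ne x 0 with rfl | hx0
  · exact f0
  · exact zero (ss x / 2) (by linarith [ss_pos hx0]) x (by linarith [ss_pos hx0]) hx


abbrev Sm (f : CC → ℂ) : Prop := ContDiff ℝ (⊤ : ℕ∞) f

noncomputable def Dv (v : CC) (f : CC → ℂ) : CC → ℂ := fun x => fderiv ℝ f x v

noncomputable def Dl : List CC → (CC → ℂ) → CC → ℂ
  | [], f => f
  | v :: l, f => Dl l (Dv v f)

theorem Sm.dv {f : CC → ℂ} (hf : Sm f) (v : CC) : Sm (Dv v f) :=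
  (hf.fderiv_right (m := (⊤ : ℕ∞)) (by norm_cast)).clm_apply contDiff_const

theorem Sm.dl {f : CC → ℂ} (hf : Sm f) (l : List CC) : Sm (Dl l f) := by
  induction l generalizing f with
  | nil => exact hf
  | cons v l ih => exact ih (hf.dv v)

theorem Sm.diff {f : CC → ℂ} (hf : Sm f) (x : CC) : DifferentiableAt ℝ f x := hf.differentiable (by norm_cast) x

theorem Sm.hasF {f : CC → ℂ} (hf : Sm f) (x : CC) : HasFDerivAt f (fderiv ℝ f x) x := (hf.diff x).hasFDerivAt

theorem Dv_comm {f : CC → ℂ} (hf : Sm f) (u v : CC) : Dv u (Dv v f) = Dv v (Dv u f) := by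
  funext x
  obtain ⟨B, hB, sB⟩ := snd_deriv (q := f) (x := x) (hf.contDiffAt.of_le (by norm_cast))
  have h : ∀ w, HasFDerivAt (Dv w f) (B.flip w) x := fun w => by
    have := hB.clm_apply (hasFDerivAt_const w x)
    refine this.congr_fderiv ?_
    ext z <;> simp
  simp only [Dv] at h ⊢
  rw [(h v).fderiv, (h u).fderiv]
  simpa using sB u v

theorem Dl_cons {f : CC → ℂ} (hf : Sm f) (v : CC) (l : List CC) : Dl (v :: l) f = Dv v (Dl l f) := by
  induction l generalizing f with
  | nil => rfl
  | cons u l ih =>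
    change Dl l (Dv u (Dv v f)) = Dv v (Dl l (Dv u f))
    rw [Dv_comm hf, ← ih (hf.dv u)]; rfl

theorem Dl_append (l m : List CC) (f : CC → ℂ) : Dl (l ++ m) f = Dl m (Dl l f) := by
  induction l generalizing f with
  | nil => rfl
  | cons v l ih => exact ih _

theorem Dl_perm {f : CC → ℂ} (hf : Sm f) {l m : List CC} (h : l.Perm m) : Dl l f = Dl m f := by
  induction h generalizing f with
  | nil => rfl
  | cons v _ ih => exact ih (hf.dv v)
  | swap u v l => change Dl l _ = Dl l _; rw [Dv_comm hf]
  | trans _ _ ih1 ih2 => exact (ih1 hf).trans (ih2 hf)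

theorem Dv_add {f g : CC → ℂ} (hf : Sm f) (hg : Sm g) (v : CC) : Dv v (fun x => f x + g x) = fun x => Dv v f x + Dv v g x := by
  funext x
  simp only [Dv]
  have h : HasFDerivAt (fun x => f x + g x) _ x := (hf.hasF x).add (hg.hasF x)
  rw [h.fderiv]; rfl

theorem Dv_cmul {f : CC → ℂ} (hf : Sm f) (c : ℂ) (v : CC) : Dv v (fun x => c * f x) = fun x => c * Dv v f x := by
  funext x
  simp only [Dv]
  rw [((hf.hasF x).const_mul c).fderiv]; rfl

theorem Sm.add' {f g : CC → ℂ} (hf : Sm f) (hg : Sm g) : Sm (fun x => f x + g x) := ContDiff.add hf hg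
theorem Sm.cmul {f : CC → ℂ} (hf : Sm f) (c : ℂ) : Sm (fun x => c * f x) := contDiff_const.mul hf

theorem Dl_add {f g : CC → ℂ} (hf : Sm f) (hg : Sm g) (l : List CC) : Dl l (fun x => f x + g x) = fun x => Dl l f x + Dl l g x := by
  induction l generalizing f g with
  | nil => rfl
  | cons v l ih =>
    simp only [Dl]
    rw [Dv_add hf hg, ih (hf.dv v) (hg.dv v)]

theorem Dl_cmul {f : CC → ℂ} (hf : Sm f) (c : ℂ) (l : List CC) : Dl l (fun x => c * f x) = fun x => c * Dl l f x := by
  induction l generalizing f with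
  | nil => rfl
  | cons v l ih =>
    simp only [Dl]
    rw [Dv_cmul hf, ih (hf.dv v)]

def flat (k : ℕ) (f : CC → ℂ) (q : CC) : Prop := ∀ l : List CC, l.length < k → Dl l f q = 0

theorem flat.dv {k : ℕ} {f : CC → ℂ} {q : CC} (h : flat (k + 1) f q) (v : CC) : flat k (Dv v f) q :=
  fun l hl => h (v :: l) (by simp; omega)

theorem flat.mono {k m : ℕ} {f : CC → ℂ} {q : CC} (h : flat k f q) (hm : m ≤ k) : flat m f q :=
  fun l hl => h l (by omega)

theorem flat_fderiv_bound {k : ℕ} {f : CC → ℂ} {q : CC}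
    (hb : ∀ v, ∃ C : ℝ, 0 ≤ C ∧ ∀ x, ‖x - q‖ ≤ 1 → ‖Dv v f x‖ ≤ C * ‖x - q‖ ^ k) :
    ∃ C : ℝ, 0 ≤ C ∧ ∀ x, ‖x - q‖ ≤ 1 → ‖fderiv ℝ f x‖ ≤ C * ‖x - q‖ ^ k := by
  obtain ⟨C1, h1, b1⟩ := hb (1, 0)
  obtain ⟨C2, h2, b2⟩ := hb (I, 0)
  obtain ⟨C3, h3, b3⟩ := hb (0, 1)
  obtain ⟨C4, h4, b4⟩ := hb (0, I)
  refine ⟨C1 + C2 + C3 + C4, by positivity, fun x hx => ?_⟩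
  have := opnorm_le_sum (fderiv ℝ f x)
  have e1 := b1 x hx
  have e2 := b2 x hx
  have e3 := b3 x hx
  have e4 := b4 x hx
  simp only [Dv] at e1 e2 e3 e4
  linarith

theorem flat_bound {k : ℕ} {f : CC → ℂ} {q : CC} (hf : Sm f) (h : flat k f q) :
    ∃ C : ℝ, 0 ≤ C ∧ ∀ x, ‖x - q‖ ≤ 1 → ‖f x‖ ≤ C * ‖x - q‖ ^ k := by
  induction k generalizing f with
  | zero =>
    obtain ⟨C, hC⟩ := (isCompact_closedBall q 1).exists_bound_of_continuousOn hf.continuous.continuousOn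
    refine ⟨C, (norm_nonneg _).trans (hC q (by simp)), fun x hx => ?_⟩
    simpa using hC x (by rw [mem_closedBall, dist_eq_norm]; exact hx)
  | succ k ih =>
    obtain ⟨C, hC0, hC⟩ := flat_fderiv_bound (f := f) (q := q) (k := k) fun v => ih (hf.dv v) (h.dv v)
    refine ⟨C, hC0, fun x hx => ?_⟩
    have := (convex_closedBall q ‖x - q‖).norm_image_sub_le_of_norm_fderiv_le (𝕜 := ℝ) (f := f) (C := C * ‖x - q‖ ^ k)
      (fun y _ => hf.diff y) (fun y hy => by
        rw [mem_closedBall, dist_eq_norm] at hy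
        refine (hC y (hy.trans hx)).trans (by gcongr)) (x := q) (y := x) (by simp) (by simp [dist_eq_norm])
    have f0 : f q = 0 := h [] (by simp)
    rw [f0, sub_zero] at this
    rw [pow_succ, ← mul_assoc]; exact this

theorem flat_fderiv {k : ℕ} {f : CC → ℂ} {q : CC} (hf : Sm f) (h : flat (k + 1) f q) :
    ∃ C : ℝ, 0 ≤ C ∧ ∀ x, ‖x - q‖ ≤ 1 → ‖fderiv ℝ f x‖ ≤ C * ‖x - q‖ ^ k :=
  flat_fderiv_bound fun v => flat_bound (hf.dv v) (h.dv v)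

theorem iteratedFDeriv_eq_Dl {f : CC → ℂ} (hf : Sm f) (n : ℕ) (x : CC) (v : Fin n → CC) :
    iteratedFDeriv ℝ n f x v = Dl (List.ofFn v) f x := by
  induction n generalizing x with
  | zero => simp [Dl]
  | succ n ih =>
    rw [iteratedFDeriv_succ_apply_left, List.ofFn_succ, Dl_cons hf, Dv]
    have hd : DifferentiableAt ℝ (iteratedFDeriv ℝ n f) x :=
      (hf.contDiffAt (x := x)).differentiableAt_iteratedFDeriv (by norm_cast; exact WithTop.coe_lt_top _)
    have e : (fun y => Dl (List.ofFn fun i : Fin n => v i.succ) f y) = fun y => (iteratedFDeriv ℝ n f y) (Fin.tail v) := by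
      funext y; rw [ih]; rfl
    change _ = fderiv ℝ (fun y => Dl (List.ofFn fun i : Fin n => v i.succ) f y) x (v 0)
    rw [e]
    have h2 := (ContinuousMultilinearMap.apply ℝ (fun _ : Fin n => CC) ℂ (Fin.tail v)).hasFDerivAt.comp x hd.hasFDerivAt
    rw [show (fun y => (iteratedFDeriv ℝ n f y) (Fin.tail v)) = (ContinuousMultilinearMap.apply ℝ (fun _ : Fin n => CC) ℂ (Fin.tail v)) ∘ (iteratedFDeriv ℝ n f) from rfl, h2.fderiv]
    rfl

theorem diag_zero {f : CC → ℂ} (hf : Sm f) {k : ℕ} {q : CC} (h : ∀ e : CC, Dl (List.replicate k e) f q = 0)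
    {l : List CC} (hl : l.length = k) : Dl l f q = 0 := by
  subst hl
  set n := l.length
  have h0 : ∀ e : CC, iteratedFDeriv ℝ n f q (fun _ => e) = 0 := fun e => by
    rw [iteratedFDeriv_eq_Dl hf, List.ofFn_const]; exact h e
  have key := ContinuousMultilinearMap.iteratedFDeriv_comp_diagonal (iteratedFDeriv ℝ n f q) (0 : CC) (fun i => l.get i)
  rw [show (fun x => (iteratedFDeriv ℝ n f q) (fun _ => x)) = (fun _ => (0 : ℂ)) from funext h0] at key
  have : ∀ σ : Equiv.Perm (Fin n), iteratedFDeriv ℝ n f q (fun i => l.get (σ i)) = Dl l f q := fun σ => by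
    rw [iteratedFDeriv_eq_Dl hf]
    refine congrFun (Dl_perm hf ?_) q
    have := Equiv.Perm.ofFn_comp_perm σ (fun i => l.get i)
    rw [List.ofFn_get] at this
    exact this
  simp only [this] at key
  rw [show iteratedFDeriv ℝ n (fun _ : CC => (0 : ℂ)) = 0 from iteratedFDeriv_fun_zero] at key
  simp [Nat.factorial_ne_zero, Fintype.card_perm] at key
  exact key

theorem line_deriv {f : CC → ℂ} (hf : Sm f) (q e : CC) (j : ℕ) :
    iteratedDeriv j (fun t : ℝ => f (q + t • e)) = fun t => Dl (List.replicate j e) f (q + t • e) := by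
  induction j generalizing f with
  | zero => simp [Dl]
  | succ j ih =>
    rw [iteratedDeriv_succ']
    have : deriv (fun t : ℝ => f (q + t • e)) = fun t => Dv e f (q + t • e) := by
      funext t
      have h1 : HasDerivAt (fun t : ℝ => q + t • e) e t := by
        simpa using ((hasDerivAt_id t).smul_const e).const_add q
      exact ((hf.hasF (q + t • e)).comp_hasDerivAt t h1).deriv
    rw [this, ih (hf.dv e)]; rfl

theorem sm_line {f : CC → ℂ} (hf : Sm f) (q e : CC) : ContDiff ℝ (⊤ : ℕ∞) (fun t : ℝ => f (q + t • e)) :=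
  hf.comp (contDiff_const.add (contDiff_id.smul contDiff_const))

theorem flat_of_bound {f : CC → ℂ} (hf : Sm f) {k : ℕ} {q : CC} {C r : ℝ} (hr : 0 < r)
    (hb : ∀ x, ‖x - q‖ < r → ‖f x‖ ≤ C * ‖x - q‖ ^ k) : flat k f q := by
  have main : ∀ m, m ≤ k → flat m f q := by
    intro m
    induction m with
    | zero => intro _ l hl; simp at hl
    | succ m ih =>
      intro hm l hl
      have hfl := ih (by omega)
      rcases Nat.lt_succ_iff_lt_or_eq.1 hl with h | h
      · exact hfl l h
      refine diag_zero hf (fun e => ?_) h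
      set φ : ℝ → ℂ := fun t => f (q + t • e) with hφ
      have hφs : ContDiff ℝ m φ := (sm_line hf q e).of_le (by norm_cast; exact le_top)
      have hT := taylor_isLittleO_univ (x₀ := 0) hφs
      set c := Dl (List.replicate m e) f q with hc
      have eT : ∀ t, taylorWithinEval φ m Set.univ 0 t = ((m.factorial : ℝ)⁻¹ * t ^ m) • c := by
        intro t
        rw [taylor_within_apply, Finset.sum_range_succ, Finset.sum_eq_zero, zero_add]
        · rw [iteratedDerivWithin_univ, hφ, line_deriv hf]; simp [hc]
        · intro j hj
          rw [iteratedDerivWithin_univ, hφ, line_deriv hf]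
          simp only [zero_smul, add_zero]
          rw [hfl _ (by simpa using hj), smul_zero]
      have hO : φ =O[nhds 0] fun t => t ^ (m + 1) := by
        refine Asymptotics.IsBigO.of_bound (|C| * ‖e‖ ^ k) ?_
        have h1 : ∀ᶠ t : ℝ in nhds 0, ‖t • e‖ < r := by
          have : Continuous fun t : ℝ => ‖t • e‖ := by fun_prop
          exact this.continuousAt.eventually_lt continuousAt_const (by simpa using hr)
        have h2 : ∀ᶠ t : ℝ in nhds 0, |t| < 1 := by
          exact continuous_abs.continuousAt.eventually_lt continuousAt_const (by simp)
        filter_upwards [h1, h2] with t h1 h2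
        have := hb (q + t • e) (by simpa using h1)
        rw [add_sub_cancel_left, norm_smul, mul_pow] at this
        rw [norm_pow, Real.norm_eq_abs] at *
        calc ‖φ t‖ ≤ C * (|t| ^ k * ‖e‖ ^ k) := this
          _ ≤ |C| * (|t| ^ (m + 1) * ‖e‖ ^ k) := by
            gcongr ?_ * (?_ * _)
            · exact le_abs_self C
            · exact pow_le_pow_of_le_one (abs_nonneg t) h2.le hm
          _ = _ := by ring
      have ho : φ =o[nhds 0] fun t : ℝ => t ^ m := hO.trans_isLittleO (Asymptotics.isLittleO_pow_pow (by omega))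
      have h3 := ho.sub (by simpa using hT)
      have h4 : (fun t : ℝ => ((m.factorial : ℝ)⁻¹ * t ^ m) • c) =o[nhds 0] fun t : ℝ => t ^ m := by
        refine h3.congr_left fun t => ?_
        rw [eT]; simp
      by_contra hc0
      have hpos : 0 < (m.factorial : ℝ)⁻¹ * ‖c‖ / 2 := by
        have := norm_pos_iff.2 hc0
        have := m.factorial_pos
        positivity
      have h5 := h4.def hpos
      have h6 : ∃ t : ℝ, ‖((m.factorial : ℝ)⁻¹ * t ^ m) • c‖ ≤ (m.factorial : ℝ)⁻¹ * ‖c‖ / 2 * ‖t ^ m‖ ∧ t ≠ 0 :=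
        ((h5.filter_mono nhdsWithin_le_nhds).and (self_mem_nhdsWithin (s := {(0:ℝ)}ᶜ))).exists
      obtain ⟨t, ht, ht0⟩ := h6
      have h7 : 0 < ‖t ^ m‖ := norm_pos_iff.2 (pow_ne_zero _ ht0)
      rw [norm_smul, norm_mul, norm_inv, Real.norm_natCast] at ht
      nlinarith [mul_pos hpos h7]
  exact main k le_rfl

theorem holo_flat {J : CC → (CC →L[ℝ] CC)} (hJ : ContDiff ℝ (⊤ : ℕ∞) J) {f : CC → ℂ} (hf : Sm f) {q : CC} {r C : ℝ} (hr : 0 < r)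
    (hE : ∀ x ∈ ball q r, ∀ X, ‖fderiv ℝ f x X + I * fderiv ℝ f x (J x X)‖ ≤ C * ‖f x‖ * ‖X‖) {k : ℕ} (hk : flat k f q) (X : CC) :
    flat k (fun x => Dv X f x + I * Dv (J q X) f x) q := by
  rcases k with _ | k
  · intro l hl; simp at hl
  obtain ⟨C1, hC1, b1⟩ := flat_bound hf hk
  obtain ⟨C2, hC2, b2⟩ := flat_fderiv hf hk
  have hJd : DifferentiableAt ℝ J q := hJ.differentiable (by norm_cast) q
  obtain ⟨K, hK⟩ := hJd.hasFDerivAt.isBigO_sub.bound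
  obtain ⟨r1, hr1, hK⟩ := Metric.eventually_nhds_iff.1 hK
  refine flat_of_bound (C := |C| * C1 * ‖X‖ + C2 * (|K| * ‖X‖)) ((hf.dv _).add' ((hf.dv _).cmul I)) (lt_min (lt_min hr hr1) one_pos) fun x hx => ?_
  rw [lt_min_iff, lt_min_iff] at hx
  obtain ⟨⟨hx1, hx2⟩, hx3⟩ := hx
  have e1 : Dv X f x + I * Dv (J q X) f x = (fderiv ℝ f x X + I * fderiv ℝ f x (J x X)) - I * fderiv ℝ f x ((J x - J q) X) := by
    simp only [Dv, sub_apply, map_sub]; ring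
  rw [e1]
  refine (norm_sub_le _ _).trans ?_
  have h1 := hE x (by rw [mem_ball, dist_eq_norm]; exact hx1) X
  have h2 := b1 x hx3.le
  have h3 := b2 x hx3.le
  have h4 : ‖J x - J q‖ ≤ K * ‖x - q‖ := hK (by rw [dist_eq_norm]; exact hx2)
  have h5 : ‖I * fderiv ℝ f x ((J x - J q) X)‖ ≤ C2 * ‖x - q‖ ^ k * (|K| * ‖x - q‖ * ‖X‖) := by
    rw [norm_mul, norm_I, one_mul]
    refine ((fderiv ℝ f x).le_opNorm _).trans ?_
    gcongr
    refine ((J x - J q).le_opNorm X).trans ?_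
    gcongr
    exact h4.trans (by gcongr; exact le_abs_self K)
  have h6 : C * ‖f x‖ * ‖X‖ ≤ |C| * (C1 * ‖x - q‖ ^ (k + 1)) * ‖X‖ := by
    gcongr ?_ * ?_ * _
    exact le_abs_self C
  calc _ ≤ _ := add_le_add (h1.trans h6) h5
    _ = _ := by ring

theorem Dl_comp {f : CC → ℂ} (hf : Sm f) (p : CC) (S : CC →L[ℝ] CC) (l : List CC) :
    Dl l (fun x => f (p + S x)) = fun x => Dl (l.map S) f (p + S x) := by
  induction l generalizing f with
  | nil => rfl
  | cons v l ih =>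
    have : Dv v (fun x => f (p + S x)) = fun x => Dv (S v) f (p + S x) := by
      funext x
      have h := (hf.hasF (p + S x)).comp x (S.hasFDerivAt.const_add p)
      have h' : HasFDerivAt (fun x => f (p + S x)) _ x := h
      simp only [Dv]
      rw [h'.fderiv]; rfl
    change Dl l (Dv v _) = _
    rw [this, ih (hf.dv _)]; rfl

theorem continuous_Dl_diag {f : CC → ℂ} (hf : Sm f) (k : ℕ) (q : CC) : Continuous fun e => Dl (List.replicate k e) f q := by
  have : (fun e => Dl (List.replicate k e) f q) = fun e => iteratedFDeriv ℝ k f q (fun _ => e) := by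
    funext e; rw [iteratedFDeriv_eq_Dl hf, List.ofFn_const]
  rw [this]
  exact (iteratedFDeriv ℝ k f q).cont.comp (continuous_pi fun _ => continuous_id)


noncomputable def Av (x0 : CC) (m : ℕ) (h : CC → ℂ) (x : CC) : ℂ := ∫ t in (0 : ℝ)..1, (t ^ m) • h (x0 + t • (x - x0))

theorem hasFDerivAt_Av {h : CC → ℂ} (hh : Sm h) (x0 : CC) (m : ℕ) (x : CC) :
    HasFDerivAt (Av x0 m h) (∫ t in (0 : ℝ)..1, (t ^ (m + 1)) • fderiv ℝ h (x0 + t • (x - x0))) x := by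
  have hdc : Continuous (fderiv ℝ h) := hh.continuous_fderiv (by norm_cast)
  set R : ℝ := ‖x0‖ + (‖x‖ + 1 + ‖x0‖) with hR
  obtain ⟨B, hB⟩ := (isCompact_closedBall (0 : CC) R).exists_bound_of_continuousOn (E := CC →L[ℝ] ℂ) hdc.continuousOn
  have c1 : ∀ y : CC, Continuous fun t : ℝ => x0 + t • (y - x0) := fun y => by fun_prop
  refine intervalIntegral.hasFDerivAt_integral_of_dominated_of_fderiv_le (bound := fun _ => B)
    (F := fun y (t : ℝ) => (t ^ m) • h (x0 + t • (y - x0))) (F' := fun y (t : ℝ) => (t ^ (m + 1)) • fderiv ℝ h (x0 + t • (y - x0)))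
    (ball_mem_nhds x one_pos) ?_ ?_ ?_ ?_ ?_ ?_
  · filter_upwards with y
    exact ((continuous_pow m).smul (hh.continuous.comp (c1 y))).aestronglyMeasurable
  · exact ((continuous_pow m).smul (hh.continuous.comp (c1 x))).intervalIntegrable _ _
  · exact ((continuous_pow (m + 1)).smul (hdc.comp (c1 x))).aestronglyMeasurable
  · filter_upwards with t ht y hy
    rw [Set.uIoc_of_le zero_le_one] at ht
    have h1 : ‖y‖ < ‖x‖ + 1 := by
      have := norm_sub_norm_le y x
      rw [mem_ball, dist_eq_norm] at hy; linarith
    have h2 : ‖x0 + t • (y - x0)‖ ≤ R := by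
      refine (norm_add_le _ _).trans ?_
      rw [norm_smul, Real.norm_eq_abs, abs_of_pos ht.1]
      have := norm_sub_le y x0
      have : t * ‖y - x0‖ ≤ 1 * ‖y - x0‖ := by gcongr; exact ht.2
      rw [hR]; linarith
    rw [norm_smul, norm_pow, Real.norm_eq_abs, abs_of_pos ht.1]
    have h3 := hB _ (mem_closedBall_zero_iff.2 h2)
    have h4 : t ^ (m + 1) ≤ 1 := pow_le_one₀ ht.1.le ht.2
    calc _ ≤ 1 * B := by gcongr
      _ = B := one_mul B
  · exact intervalIntegrable_const
  · filter_upwards with t ht y hy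
    have h1 : HasFDerivAt (fun y : CC => x0 + t • (y - x0)) (t • ContinuousLinearMap.id ℝ CC) y :=
      (((hasFDerivAt_id y).sub_const x0).const_smul t).const_add x0
    have h2 := ((hh.hasF (x0 + t • (y - x0))).comp y h1).const_smul (t ^ m)
    refine h2.congr_fderiv ?_
    ext v <;> simp [pow_succ] <;> ring

theorem Dv_Av {h : CC → ℂ} (hh : Sm h) (x0 : CC) (m : ℕ) (v : CC) : Dv v (Av x0 m h) = Av x0 (m + 1) (Dv v h) := by
  funext x
  have hdc : Continuous (fderiv ℝ h) := hh.continuous_fderiv (by norm_cast)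
  rw [Dv, (hasFDerivAt_Av hh x0 m x).fderiv, ContinuousLinearMap.intervalIntegral_apply]
  · rfl
  · exact Continuous.intervalIntegrable ((continuous_pow (m + 1)).smul (hdc.comp (by fun_prop))) _ _

theorem sm_Av {h : CC → ℂ} (hh : Sm h) (x0 : CC) (m : ℕ) : Sm (Av x0 m h) := by
  refine contDiff_infty.2 fun n => ?_
  induction n generalizing h m with
  | zero =>
    exact contDiff_zero.2 (continuous_iff_continuousAt.2 fun x => (hasFDerivAt_Av hh x0 m x).continuousAt)
  | succ n ih =>
    push_cast
    rw [contDiff_succ_iff_fderiv_apply]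
    refine ⟨fun x => (hasFDerivAt_Av hh x0 m x).differentiableAt, by simp, fun v => ?_⟩
    have := ih (hh.dv v) (m + 1)
    rw [← Dv_Av hh] at this
    exact this

theorem Dl_Av {h : CC → ℂ} (hh : Sm h) (x0 : CC) (m : ℕ) (l : List CC) : Dl l (Av x0 m h) = Av x0 (m + l.length) (Dl l h) := by
  induction l generalizing h m with
  | nil => rfl
  | cons v l ih =>
    change Dl l (Dv v _) = _
    rw [Dv_Av hh, ih (hh.dv v)]
    simp only [List.length_cons, Dl]
    congr 1; omega

theorem norm_Av_le {h : CC → ℂ} {x0 x : CC} {m : ℕ} {B : ℝ} (hb : ∀ t : ℝ, 0 ≤ t → t ≤ 1 → ‖h (x0 + t • (x - x0))‖ ≤ B) :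
    ‖Av x0 m h x‖ ≤ B := by
  have := intervalIntegral.norm_integral_le_of_norm_le_const (a := (0 : ℝ)) (b := 1) (C := B) (f := fun t : ℝ => (t ^ m) • h (x0 + t • (x - x0))) (by
    intro t ht
    rw [Set.uIoc_of_le zero_le_one] at ht
    rw [norm_smul, norm_pow, Real.norm_eq_abs, abs_of_pos ht.1]
    have h4 : t ^ m ≤ 1 := pow_le_one₀ ht.1.le ht.2
    calc _ ≤ 1 * B := by gcongr; exact hb t ht.1.le ht.2
      _ = B := one_mul B)
  simpa [Av] using this

theorem hadamard {f : CC → ℂ} (hf : Sm f) (x0 x : CC) : f x = f x0 + ∫ t in (0 : ℝ)..1, fderiv ℝ f (x0 + t • (x - x0)) (x - x0) := by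
  have hd : ∀ t : ℝ, HasDerivAt (fun t : ℝ => f (x0 + t • (x - x0))) (fderiv ℝ f (x0 + t • (x - x0)) (x - x0)) t := fun t => by
    have h1 : HasDerivAt (fun t : ℝ => x0 + t • (x - x0)) (x - x0) t := by
      simpa using ((hasDerivAt_id t).smul_const (x - x0)).const_add x0
    exact (hf.hasF _).comp_hasDerivAt t h1
  have hdc : Continuous (fderiv ℝ f) := hf.continuous_fderiv (by norm_cast)
  rw [intervalIntegral.integral_eq_sub_of_hasDerivAt (fun t _ => hd t)]
  · simp
  · exact Continuous.intervalIntegrable ((hdc.comp (by fun_prop)).clm_apply continuous_const) _ _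

theorem hadamard_slice {f : CC → ℂ} (hf : Sm f) (z0 z w : ℂ) :
    f (z, w) = f (z0, w) + Av (z0, w) 0 (Dv (1, 0) f) (z, w) * (z - z0).re + Av (z0, w) 0 (Dv (I, 0) f) (z, w) * (z - z0).im := by
  rw [hadamard hf (z0, w) (z, w), add_assoc]
  congr 1
  have hdc : Continuous (fderiv ℝ f) := hf.continuous_fderiv (by norm_cast)
  have hi : ∀ v : CC, IntervalIntegrable (fun t : ℝ => Dv v f ((z0, w) + t • ((z, w) - (z0, w)))) volume 0 1 := fun v =>
    Continuous.intervalIntegrable ((hdc.comp (by fun_prop)).clm_apply continuous_const) _ _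
  simp only [Av, pow_zero, one_smul]
  rw [← intervalIntegral.integral_mul_const, ← intervalIntegral.integral_mul_const, ← intervalIntegral.integral_add ((hi _).mul_const _) ((hi _).mul_const _)]
  congr 1
  funext t
  rw [apply_decomp]
  simp [Dv]
  ring


def zdir (l : List CC) : Prop := ∀ v ∈ l, v = ((1, 0) : CC) ∨ v = ((I, 0) : CC)

theorem int_step_re {S : Finset ℂ} {lam : ℂ → ℂ} {M ρ : ℝ} (hρ : 0 ≤ ρ) {z0 : ℂ} (hz0 : z0 ∈ S) (hz : ‖z0‖ ≤ ρ)
    (hM : ∀ a b : ℕ, ‖∑ x ∈ S, lam x * (x ^ a * (starRingEnd ℂ x) ^ b)‖ ≤ M * ρ ^ (a + b)) (a b : ℕ) :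
    ‖∑ x ∈ S.erase z0, (lam x * ((x - z0).re : ℂ)) * (x ^ a * (starRingEnd ℂ x) ^ b)‖ ≤ (2 * ρ * M) * ρ ^ (a + b) := by
  have e1 : ∑ x ∈ S.erase z0, (lam x * ((x - z0).re : ℂ)) * (x ^ a * (starRingEnd ℂ x) ^ b)
      = ∑ x ∈ S, (lam x * ((x - z0).re : ℂ)) * (x ^ a * (starRingEnd ℂ x) ^ b) := by
    rw [Finset.sum_erase]; simp
  have e2 : ∑ x ∈ S, (lam x * ((x - z0).re : ℂ)) * (x ^ a * (starRingEnd ℂ x) ^ b)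
      = (1/2) * (∑ x ∈ S, lam x * (x ^ (a+1) * (starRingEnd ℂ x) ^ b)) + (1/2) * (∑ x ∈ S, lam x * (x ^ a * (starRingEnd ℂ x) ^ (b+1)))
        - (z0.re : ℂ) * ∑ x ∈ S, lam x * (x ^ a * (starRingEnd ℂ x) ^ b) := by
    rw [Finset.mul_sum, Finset.mul_sum, Finset.mul_sum, ← Finset.sum_add_distrib, ← Finset.sum_sub_distrib]
    refine Finset.sum_congr rfl fun x _ => ?_
    have : ((x - z0).re : ℂ) = (x + starRingEnd ℂ x) / 2 - (z0.re : ℂ) := by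
      rw [Complex.sub_re, Complex.ofReal_sub, Complex.re_eq_add_conj]
    rw [this]; ring
  rw [e1, e2]
  have h1 := hM (a+1) b
  have h2 := hM a (b+1)
  have h3 := hM a b
  have h4 : ‖(z0.re : ℂ)‖ ≤ ρ := by rw [Complex.norm_real]; exact (Complex.abs_re_le_norm z0).trans hz
  refine (norm_sub_le _ _).trans ?_
  refine (add_le_add (norm_add_le _ _) le_rfl).trans ?_
  rw [norm_mul, norm_mul, norm_mul]
  have h5 := mul_le_mul h4 h3 (norm_nonneg _) hρ
  have e3 : a + 1 + b = a + b + 1 := by ring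
  have e4 : a + (b + 1) = a + b + 1 := by ring
  rw [e3, pow_succ] at h1
  rw [e4, pow_succ] at h2
  have : ‖(1/2 : ℂ)‖ = 1/2 := by simp
  rw [this]
  nlinarith

theorem int_step_im {S : Finset ℂ} {lam : ℂ → ℂ} {M ρ : ℝ} (hρ : 0 ≤ ρ) {z0 : ℂ} (hz0 : z0 ∈ S) (hz : ‖z0‖ ≤ ρ)
    (hM : ∀ a b : ℕ, ‖∑ x ∈ S, lam x * (x ^ a * (starRingEnd ℂ x) ^ b)‖ ≤ M * ρ ^ (a + b)) (a b : ℕ) :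
    ‖∑ x ∈ S.erase z0, (lam x * ((x - z0).im : ℂ)) * (x ^ a * (starRingEnd ℂ x) ^ b)‖ ≤ (2 * ρ * M) * ρ ^ (a + b) := by
  have e1 : ∑ x ∈ S.erase z0, (lam x * ((x - z0).im : ℂ)) * (x ^ a * (starRingEnd ℂ x) ^ b)
      = ∑ x ∈ S, (lam x * ((x - z0).im : ℂ)) * (x ^ a * (starRingEnd ℂ x) ^ b) := by
    rw [Finset.sum_erase]; simp
  have e2 : ∑ x ∈ S, (lam x * ((x - z0).im : ℂ)) * (x ^ a * (starRingEnd ℂ x) ^ b)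
      = (1/(2*I)) * (∑ x ∈ S, lam x * (x ^ (a+1) * (starRingEnd ℂ x) ^ b)) - (1/(2*I)) * (∑ x ∈ S, lam x * (x ^ a * (starRingEnd ℂ x) ^ (b+1)))
        - (z0.im : ℂ) * ∑ x ∈ S, lam x * (x ^ a * (starRingEnd ℂ x) ^ b) := by
    rw [Finset.mul_sum, Finset.mul_sum, Finset.mul_sum, ← Finset.sum_sub_distrib, ← Finset.sum_sub_distrib]
    refine Finset.sum_congr rfl fun x _ => ?_
    have : ((x - z0).im : ℂ) = (x - starRingEnd ℂ x) / (2 * I) - (z0.im : ℂ) := by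
      rw [Complex.sub_im, Complex.ofReal_sub, Complex.im_eq_sub_conj]
    rw [this]; ring
  rw [e1, e2]
  have h1 := hM (a+1) b
  have h2 := hM a (b+1)
  have h3 := hM a b
  have h4 : ‖(z0.im : ℂ)‖ ≤ ρ := by rw [Complex.norm_real]; exact (Complex.abs_im_le_norm z0).trans hz
  refine (norm_sub_le _ _).trans ?_
  refine (add_le_add (norm_sub_le _ _) le_rfl).trans ?_
  rw [norm_mul, norm_mul, norm_mul]
  have h5 := mul_le_mul h4 h3 (norm_nonneg _) hρ
  have e3 : a + 1 + b = a + b + 1 := by ring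
  have e4 : a + (b + 1) = a + b + 1 := by ring
  rw [e3, pow_succ] at h1
  rw [e4, pow_succ] at h2
  have : ‖(1/(2*I) : ℂ)‖ = 1/2 := by simp
  rw [this]
  nlinarith

theorem av_slice_bound {f : CC → ℂ} (hf : Sm f) {ρ : ℝ} {w z0 : ℂ} (hz0 : ‖z0‖ ≤ ρ) {e : CC} (he : e = ((1, 0) : CC) ∨ e = ((I, 0) : CC)) {n : ℕ} {b : ℕ → ℝ}
    (hB : ∀ l, zdir l → l.length < n + 1 → ∀ z : ℂ, ‖z‖ ≤ ρ → ‖Dl l f (z, w)‖ ≤ b l.length) :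
    ∀ l, zdir l → l.length < n → ∀ z : ℂ, ‖z‖ ≤ ρ → ‖Dl l (Av (z0, w) 0 (Dv e f)) (z, w)‖ ≤ b (l.length + 1) := by
  intro l hl hn z hz
  rw [Dl_Av (hf.dv e)]
  refine norm_Av_le fun t ht0 ht1 => ?_
  have h1 : ((z0, w) : CC) + t • ((z, w) - (z0, w)) = (z0 + t • (z - z0), w) := by
    ext <;> simp
  rw [h1]
  have h2 : ‖z0 + t • (z - z0)‖ ≤ ρ := by
    have := (convex_closedBall (0 : ℂ) ρ).add_smul_sub_mem (mem_closedBall_zero_iff.2 hz0) (mem_closedBall_zero_iff.2 hz) ⟨ht0, ht1⟩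
    exact mem_closedBall_zero_iff.1 this
  refine hB (e :: l) ?_ (by simpa using hn) _ h2
  intro v hv
  rcases List.mem_cons.1 hv with h | h
  · rw [h]; exact he
  · exact hl v h

theorem int_lemma (n : ℕ) : ∀ (S : Finset ℂ) (lam : ℂ → ℂ) (f : CC → ℂ) (b : ℕ → ℝ) (M ρ : ℝ) (w : ℂ), Sm f → S.card ≤ n → 0 ≤ ρ →
    (∀ x ∈ S, ‖x‖ ≤ ρ) → (∀ j, 0 ≤ b j) →
    (∀ a b : ℕ, ‖∑ x ∈ S, lam x * (x ^ a * (starRingEnd ℂ x) ^ b)‖ ≤ M * ρ ^ (a + b)) →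
    (∀ l, zdir l → l.length < n → ∀ z : ℂ, ‖z‖ ≤ ρ → ‖Dl l f (z, w)‖ ≤ b l.length) →
    ∀ a c : ℕ, ‖∑ x ∈ S, lam x * (x ^ a * (starRingEnd ℂ x) ^ c) * f (x, w)‖ ≤ M * ρ ^ (a + c) * ∑ j ∈ Finset.range n, b j * (4 * ρ) ^ j := by
  induction n with
  | zero =>
    intro S lam f b M ρ w hf hS hρ hx hb hM hB a c
    rw [Finset.card_eq_zero.1 (Nat.le_zero.1 hS)]; simp
  | succ n ih =>
    intro S lam f b M ρ w hf hS hρ hx hb hM hB a c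
    have hM0 : 0 ≤ M := by
      have := (norm_nonneg _).trans (hM 0 0); simpa using this
    rcases S.eq_empty_or_nonempty with rfl | ⟨z0, hz0⟩
    · simp only [Finset.sum_empty, norm_zero]
      have : 0 ≤ ∑ j ∈ Finset.range (n + 1), b j * (4 * ρ) ^ j := Finset.sum_nonneg fun j _ => mul_nonneg (hb j) (by positivity)
      positivity
    have hz := hx z0 hz0
    have hc : (S.erase z0).card ≤ n := by
      rw [Finset.card_erase_of_mem hz0]; omega
    have hx' : ∀ x ∈ S.erase z0, ‖x‖ ≤ ρ := fun x h => hx x (Finset.mem_of_mem_erase h)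
    have i1 := ih (S.erase z0) (fun x => lam x * ((x - z0).re : ℂ)) (Av (z0, w) 0 (Dv (1, 0) f)) (fun j => b (j + 1)) (2 * ρ * M) ρ w
      (sm_Av (hf.dv _) _ _) hc hρ hx' (fun j => hb _) (int_step_re hρ hz0 hz hM) (av_slice_bound hf hz (Or.inl rfl) hB) a c
    have i2 := ih (S.erase z0) (fun x => lam x * ((x - z0).im : ℂ)) (Av (z0, w) 0 (Dv (I, 0) f)) (fun j => b (j + 1)) (2 * ρ * M) ρ w
      (sm_Av (hf.dv _) _ _) hc hρ hx' (fun j => hb _) (int_step_im hρ hz0 hz hM) (av_slice_bound hf hz (Or.inr rfl) hB) a c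
    have e1 : ∑ x ∈ S, lam x * (x ^ a * (starRingEnd ℂ x) ^ c) * f (x, w) =
        f (z0, w) * (∑ x ∈ S, lam x * (x ^ a * (starRingEnd ℂ x) ^ c))
        + (∑ x ∈ S.erase z0, (lam x * ((x - z0).re : ℂ)) * (x ^ a * (starRingEnd ℂ x) ^ c) * Av (z0, w) 0 (Dv (1, 0) f) (x, w))
        + (∑ x ∈ S.erase z0, (lam x * ((x - z0).im : ℂ)) * (x ^ a * (starRingEnd ℂ x) ^ c) * Av (z0, w) 0 (Dv (I, 0) f) (x, w)) := by
      rw [Finset.sum_erase _ (by simp), Finset.sum_erase _ (by simp), Finset.mul_sum, ← Finset.sum_add_distrib, ← Finset.sum_add_distrib]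
      refine Finset.sum_congr rfl fun x _ => ?_
      rw [hadamard_slice hf z0 x w]; ring
    rw [e1]
    refine (norm_add₃_le).trans ?_
    have h0 : ‖f (z0, w)‖ ≤ b 0 := hB [] (fun v hv => by simp at hv) (by simp) z0 hz
    rw [norm_mul]
    have h1 := mul_le_mul h0 (hM a c) (norm_nonneg _) (hb 0)
    have e2 : ∑ j ∈ Finset.range (n + 1), b j * (4 * ρ) ^ j = (4 * ρ) * (∑ j ∈ Finset.range n, b (j + 1) * (4 * ρ) ^ j) + b 0 := by
      rw [Finset.sum_range_succ', Finset.mul_sum]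
      congr 1
      · refine Finset.sum_congr rfl fun j _ => by ring
      · simp
    rw [e2]
    refine (add_le_add (add_le_add h1 i1) i2).trans (le_of_eq ?_)
    ring


theorem half_step {S : Finset ℂ} {lam : ℂ → ℂ} {E : CC → ℂ} {b : ℕ → ℝ} {M ρ : ℝ} {w : ℂ} {k n : ℕ} (hE : Sm E) (hS : S.card ≤ n) (hρ : 0 ≤ ρ)
    (hx : ∀ x ∈ S, ‖x‖ ≤ ρ) (hb : ∀ j, 0 ≤ b j) (hM0 : 0 ≤ M)
    (hM : ∀ a b : ℕ, ‖∑ x ∈ S, lam x * (x ^ a * (starRingEnd ℂ x) ^ b)‖ ≤ M * ρ ^ (a + b))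
    (hB : ∀ l, zdir l → l.length < n → ∀ z : ℂ, ‖z‖ ≤ ρ → ‖Dl l E (z, w)‖ ≤ b l.length)
    (hsum : ∑ j ∈ Finset.range n, b j * (4 * ρ) ^ j ≤ ρ ^ k / 2)
    (hroot : ∀ x ∈ S, x ^ k = - E (x, w)) (a c : ℕ) (ha : k ≤ a) :
    ‖∑ x ∈ S, lam x * (x ^ a * (starRingEnd ℂ x) ^ c)‖ ≤ M / 2 * ρ ^ (a + c) := by
  have h1 := int_lemma n S lam E b M ρ w hE hS hρ hx hb hM hB (a - k) c
  have e1 : ∑ x ∈ S, lam x * (x ^ a * (starRingEnd ℂ x) ^ c) = - ∑ x ∈ S, lam x * (x ^ (a - k) * (starRingEnd ℂ x) ^ c) * E (x, w) := by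
    rw [← Finset.sum_neg_distrib]
    refine Finset.sum_congr rfl fun x hxS => ?_
    have : x ^ a = x ^ (a - k) * x ^ k := by rw [← pow_add]; congr 1; omega
    rw [this, hroot x hxS]; ring
  rw [e1, norm_neg]
  refine h1.trans ((mul_le_mul_of_nonneg_left hsum (by positivity)).trans (le_of_eq ?_))
  have : ρ ^ (a + c) = ρ ^ (a - k + c) * ρ ^ k := by rw [← pow_add]; congr 1; omega
  rw [this]; ring

theorem count_contra {S : Finset ℂ} {E : CC → ℂ} {b : ℕ → ℝ} {ρ : ℝ} {w : ℂ} {k : ℕ} (hE : Sm E) (hS : S.card = k ^ 2 + 1) (hρ : 0 < ρ)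
    (hx : ∀ x ∈ S, ‖x‖ ≤ ρ) (hb : ∀ j, 0 ≤ b j)
    (hB : ∀ l, zdir l → l.length < k ^ 2 + 1 → ∀ z : ℂ, ‖z‖ ≤ ρ → ‖Dl l E (z, w)‖ ≤ b l.length)
    (hsum : ∑ j ∈ Finset.range (k ^ 2 + 1), b j * (4 * ρ) ^ j ≤ ρ ^ k / 2)
    (hroot : ∀ x ∈ S, x ^ k = - E (x, w)) : False := by
  classical
  obtain ⟨lam, hlam0, hker⟩ : ∃ lam : ℂ → ℂ, (∃ x ∈ S, lam x ≠ 0) ∧ ∀ a b : ℕ, a < k → b < k → ∑ x ∈ S, lam x * (x ^ a * (starRingEnd ℂ x) ^ b) = 0 := by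
    let Φ : (S → ℂ) →ₗ[ℂ] (Fin k × Fin k → ℂ) :=
      { toFun := fun u p => ∑ x : S, u x * ((x : ℂ) ^ (p.1 : ℕ) * (starRingEnd ℂ (x : ℂ)) ^ (p.2 : ℕ))
        map_add' := fun u v => by
          funext p; simp only [Pi.add_apply, add_mul, Finset.sum_add_distrib]
        map_smul' := fun c u => by
          funext p; simp only [Pi.smul_apply, smul_eq_mul, Finset.mul_sum, RingHom.id_apply, mul_assoc] }
    have hk : LinearMap.ker Φ ≠ ⊥ := by
      apply LinearMap.ker_ne_bot_of_finrank_lt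
      simp [hS]; nlinarith
    obtain ⟨u, hu, hu0⟩ := (Submodule.ne_bot_iff _).1 hk
    refine ⟨fun x => if h : x ∈ S then u ⟨x, h⟩ else 0, ?_, ?_⟩
    · by_contra hcon
      push Not at hcon
      apply hu0
      funext x
      have := hcon x x.2
      simpa using this
    · intro a c ha hc
      have := congrFun (LinearMap.mem_ker.1 hu) (⟨a, ha⟩, ⟨c, hc⟩)
      change ∑ x : S, u x * ((x : ℂ) ^ a * (starRingEnd ℂ (x : ℂ)) ^ c) = 0 at this
      rw [← this, ← Finset.sum_attach]
      refine Finset.sum_congr rfl fun x _ => by simp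
  have hconj : ∀ a c : ℕ, ‖∑ x ∈ S, (starRingEnd ℂ (lam x)) * (x ^ a * (starRingEnd ℂ x) ^ c)‖ = ‖∑ x ∈ S, lam x * (x ^ c * (starRingEnd ℂ x) ^ a)‖ := by
    intro a c
    rw [← RCLike.norm_conj (∑ x ∈ S, lam x * (x ^ c * (starRingEnd ℂ x) ^ a)), map_sum]
    congr 1
    refine Finset.sum_congr rfl fun x _ => ?_
    simp [mul_comm]
  have hN : ∀ N : ℕ, ∀ a c : ℕ, ‖∑ x ∈ S, lam x * (x ^ a * (starRingEnd ℂ x) ^ c)‖ ≤ ((∑ x ∈ S, ‖lam x‖) / 2 ^ N) * ρ ^ (a + c) := by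
    intro N
    induction N with
    | zero =>
      intro a c
      rw [pow_zero, div_one, Finset.sum_mul]
      refine (norm_sum_le _ _).trans (Finset.sum_le_sum fun x hxS => ?_)
      rw [norm_mul, norm_mul, norm_pow, norm_pow, RCLike.norm_conj, ← pow_add]
      exact mul_le_mul_of_nonneg_left (pow_le_pow_left₀ (norm_nonneg _) (hx x hxS) _) (norm_nonneg _)
    | succ N ih =>
      have hM0 : 0 ≤ (∑ x ∈ S, ‖lam x‖) / 2 ^ N := div_nonneg (Finset.sum_nonneg fun _ _ => norm_nonneg _) (by positivity)
      have e : (∑ x ∈ S, ‖lam x‖) / 2 ^ (N + 1) = (∑ x ∈ S, ‖lam x‖) / 2 ^ N / 2 := by rw [pow_succ]; field_simp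
      intro a c
      rw [e]
      by_cases ha : k ≤ a
      · exact half_step hE hS.le hρ.le hx hb hM0 ih hB hsum hroot a c ha
      by_cases hc : k ≤ c
      · have ih' : ∀ a c : ℕ, ‖∑ x ∈ S, (starRingEnd ℂ (lam x)) * (x ^ a * (starRingEnd ℂ x) ^ c)‖ ≤ ((∑ x ∈ S, ‖lam x‖) / 2 ^ N) * ρ ^ (a + c) := by
          intro a c; rw [hconj, add_comm a c]; exact ih c a
        have := half_step (lam := fun x => starRingEnd ℂ (lam x)) hE hS.le hρ.le hx hb hM0 ih' hB hsum hroot c a hc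
        rw [hconj, add_comm c a] at this; exact this
      · rw [hker a c (by omega) (by omega), norm_zero]; positivity
  have hz : ∀ a : ℕ, ∑ x ∈ S, lam x * x ^ a = 0 := by
    intro a
    have h1 : ∀ N : ℕ, ‖∑ x ∈ S, lam x * x ^ a‖ ≤ ((∑ x ∈ S, ‖lam x‖) * ρ ^ a) * (1 / 2) ^ N := by
      intro N
      have := hN N a 0
      simp only [pow_zero, mul_one, add_zero] at this
      refine this.trans (le_of_eq ?_)
      rw [one_div, inv_pow]; ring
    have h2 : Filter.Tendsto (fun N : ℕ => ((∑ x ∈ S, ‖lam x‖) * ρ ^ a) * (1 / 2 : ℝ) ^ N) Filter.atTop (nhds 0) := by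
      simpa using (tendsto_pow_atTop_nhds_zero_of_lt_one (by norm_num : (0:ℝ) ≤ 1/2) (by norm_num)).const_mul ((∑ x ∈ S, ‖lam x‖) * ρ ^ a)
    have h3 := ge_of_tendsto' h2 h1
    exact norm_le_zero_iff.1 h3
  have hp : ∀ p : Polynomial ℂ, ∑ x ∈ S, lam x * p.eval x = 0 := by
    intro p
    simp_rw [Polynomial.eval_eq_sum_range, Finset.mul_sum]
    rw [Finset.sum_comm]
    refine Finset.sum_eq_zero fun i _ => ?_
    have := hz i
    calc ∑ x ∈ S, lam x * (p.coeff i * x ^ i) = p.coeff i * ∑ x ∈ S, lam x * x ^ i := by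
          rw [Finset.mul_sum]; exact Finset.sum_congr rfl fun x _ => by ring
      _ = 0 := by rw [this, mul_zero]
  obtain ⟨x0, hx0, hl⟩ := hlam0
  have := hp (∏ y ∈ S.erase x0, (Polynomial.X - Polynomial.C y))
  rw [Finset.sum_eq_single x0] at this
  · rcases mul_eq_zero.1 this with h | h
    · exact hl h
    · rw [Polynomial.eval_prod, Finset.prod_eq_zero_iff] at h
      obtain ⟨y, hy, hy0⟩ := h
      simp [sub_eq_zero] at hy0
      exact Finset.ne_of_mem_erase hy hy0.symm
  · intro x hxS hne
    rw [Polynomial.eval_prod, Finset.prod_eq_zero (Finset.mem_erase.2 ⟨hne, hxS⟩) (by simp), mul_zero]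
  · intro h; exact absurd hx0 h


theorem sm_pow (k : ℕ) : Sm (fun x : CC => x.1 ^ k) := contDiff_fst.pow k

theorem Dv_pow (k : ℕ) (v : CC) : Dv v (fun x : CC => x.1 ^ k) = fun x => ((k : ℂ) * v.1) * x.1 ^ (k - 1) := by
  funext x
  have h0 : HasFDerivAt (fun x : CC => x.1) (ContinuousLinearMap.fst ℝ ℂ ℂ) x := hasFDerivAt_fst
  have h : HasFDerivAt (fun x : CC => x.1 ^ k) _ x := h0.pow k
  rw [Dv, h.fderiv]
  simp
  ring

theorem Dl_pow (l : List CC) : ∀ k : ℕ, Dl l (fun x : CC => x.1 ^ k) = fun x => ((k.descFactorial l.length : ℂ) * (l.map Prod.fst).prod) * x.1 ^ (k - l.length) := by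
  induction l with
  | nil => intro k; funext x; simp [Dl]
  | cons v l ih =>
    intro k
    change Dl l (Dv v _) = _
    rw [Dv_pow, Dl_cmul (sm_pow (k-1)), ih (k-1)]
    funext x
    have e : k - 1 - l.length = k - (l.length + 1) := by omega
    simp only [List.length_cons, List.map_cons, List.prod_cons, e]
    have : (k.descFactorial (l.length + 1) : ℂ) = k * ((k-1).descFactorial l.length : ℂ) := by
      cases k with
      | zero => simp
      | succ k => rw [Nat.succ_descFactorial_succ]; push_cast; simp
    rw [this]; ring

theorem Dl_holo_dir {F : CC → ℂ} (hF : Sm F) {k : ℕ} (h : flat k (fun x => Dv (1, 0) F x + I * Dv (I, 0) F x) 0) (v : ℂ) (l : List CC) (hl : l.length < k) :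
    Dl ((v, 0) :: l) F 0 = v * Dl ((1, 0) :: l) F 0 := by
  have h1 : Dv (v, 0) F = fun x => (v.re : ℂ) * Dv (1, 0) F x + (v.im : ℂ) * Dv (I, 0) F x := by
    funext x
    have e : ((v, 0) : CC) = v.re • ((1, 0) : CC) + v.im • ((I, 0) : CC) := by
      ext <;> simp
    rw [Dv, e, map_add, map_smul, map_smul]; rfl
  have h2 := h l hl
  rw [Dl_add (hF.dv _) ((hF.dv _).cmul I), Dl_cmul (hF.dv _)] at h2
  have h2' : Dl l (Dv (1, 0) F) 0 + I * Dl l (Dv (I, 0) F) 0 = 0 := h2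
  change Dl l (Dv (v, 0) F) 0 = v * Dl l (Dv (1, 0) F) 0
  rw [h1, Dl_add ((hF.dv _).cmul _) ((hF.dv _).cmul _), Dl_cmul (hF.dv _), Dl_cmul (hF.dv _)]
  change (v.re : ℂ) * Dl l (Dv (1, 0) F) 0 + (v.im : ℂ) * Dl l (Dv (I, 0) F) 0 = _
  have h3 : Dl l (Dv (I, 0) F) 0 = I * Dl l (Dv (1, 0) F) 0 := by
    linear_combination (-I) * h2' + Dl l (Dv (I, 0) F) 0 * Complex.I_mul_I
  rw [h3]
  conv_rhs => rw [← Complex.re_add_im v]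
  ring

theorem Dl_holo_rep {F : CC → ℂ} (hF : Sm F) {k : ℕ} (h : flat k (fun x => Dv (1, 0) F x + I * Dv (I, 0) F x) 0) (v : ℂ) (j : ℕ) : ∀ m, j + m = k →
    Dl (List.replicate j (v, 0) ++ List.replicate m (1, 0)) F 0 = v ^ j * Dl (List.replicate k (1, 0)) F 0 := by
  induction j with
  | zero => intro m hm; simp at hm; subst hm; simp
  | succ j ih =>
    intro m hm
    rw [List.replicate_succ, List.cons_append, Dl_holo_dir hF h v _ (by simp; omega)]
    have hp : List.Perm ((1, 0) :: (List.replicate j ((v, 0) : CC) ++ List.replicate m (1, 0))) (List.replicate j (v, 0) ++ List.replicate (m + 1) (1, 0)) := by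
      rw [List.replicate_succ]; exact List.perm_middle.symm
    rw [Dl_perm hF hp, ih (m + 1) (by omega)]; ring

noncomputable def prz : CC →L[ℝ] CC := (ContinuousLinearMap.inl ℝ ℂ ℂ).comp (ContinuousLinearMap.fst ℝ ℂ ℂ)
theorem prz_apply (x : CC) : prz x = (x.1, 0) := rfl

theorem err_flat {F : CC → ℂ} (hF : Sm F) {k : ℕ} (hfl : flat k F 0) (h : flat k (fun x => Dv (1, 0) F x + I * Dv (I, 0) F x) 0)
    (hc : Dl (List.replicate k (1, 0)) F 0 ≠ 0) :
    flat (k + 1) (fun x => (fun y : CC => ((k.factorial : ℂ) / Dl (List.replicate k (1, 0)) F 0) * F y + (-1) * y.1 ^ k) (0 + prz x)) 0 := by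
  set c := Dl (List.replicate k (1, 0)) F 0 with hcdef
  have hE : Sm (fun y : CC => ((k.factorial : ℂ) / c) * F y + (-1) * y.1 ^ k) := (hF.cmul _).add' ((sm_pow k).cmul _)
  have hval : ∀ l : List CC, Dl l (fun y : CC => ((k.factorial : ℂ) / c) * F y + (-1) * y.1 ^ k) 0 =
      ((k.factorial : ℂ) / c) * Dl l F 0 + (-1) * (((k.descFactorial l.length : ℂ) * (l.map Prod.fst).prod) * 0 ^ (k - l.length)) := by
    intro l
    rw [Dl_add (hF.cmul _) ((sm_pow k).cmul _), Dl_cmul hF, Dl_cmul (sm_pow k), Dl_pow]; rfl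
  intro l hl
  have hl' : l.length ≤ k := by omega
  rcases hl'.lt_or_eq with hlt | heq
  · rw [Dl_comp hE]
    simp only [map_zero, add_zero]
    rw [hval, hfl _ (by simpa using hlt)]
    simp only [List.length_map]
    rw [zero_pow (by omega)]; simp
  · have hE0 : Sm (fun x => (fun y : CC => ((k.factorial : ℂ) / c) * F y + (-1) * y.1 ^ k) (0 + prz x)) := ContDiff.comp hE (contDiff_const.add prz.contDiff)
    refine diag_zero hE0 (fun e => ?_) heq
    have := congrFun (Dl_comp hE 0 prz (List.replicate k e)) 0
    refine this.trans ?_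
    simp only [map_zero, add_zero, List.map_replicate, prz_apply]
    rw [hval]
    have h2 := Dl_holo_rep hF h e.1 k 0 (by simp)
    simp only [List.replicate_zero, List.append_nil] at h2
    rw [h2, ← hcdef]
    simp only [List.length_replicate, Nat.descFactorial_self, List.map_replicate, List.prod_replicate, Nat.sub_self, pow_zero]
    field_simp
    ring

theorem zdir_finite (n : ℕ) : {l : List CC | zdir l ∧ l.length < n}.Finite := by
  refine ((List.finite_length_lt Bool n).image (List.map fun b : Bool => if b then ((1, 0) : CC) else (I, 0))).subset ?_
  rintro l ⟨hl, hn⟩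
  have : ∃ m : List Bool, m.map (fun b : Bool => if b then ((1, 0) : CC) else (I, 0)) = l := by
    clear hn
    induction l with
    | nil => exact ⟨[], rfl⟩
    | cons v l ih =>
      obtain ⟨m, hm⟩ := ih fun u hu => hl u (List.mem_cons_of_mem _ hu)
      rcases hl v List.mem_cons_self with h | h
      · exact ⟨true :: m, by simp [hm, h]⟩
      · exact ⟨false :: m, by simp [hm, h]⟩
  obtain ⟨m, hm⟩ := this
  refine ⟨m, ?_, hm⟩
  have : m.length = l.length := by rw [← hm]; simp
  simpa [this] using hn

theorem slice_bound {E : CC → ℂ} (hE : Sm E) {k : ℕ} (hfl : flat (k + 1) (fun x => E (0 + prz x)) 0) {l : List CC} (hl : zdir l) :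
    ∃ C : ℝ, 0 ≤ C ∧ ∀ ρ : ℝ, 0 < ρ → ρ ≤ 1 → ∀ᶠ w : ℂ in nhds 0, ∀ z ∈ closedBall (0 : ℂ) ρ, ‖Dl l E (z, w)‖ * ρ ^ l.length ≤ C * ρ ^ (k + 1) := by
  have hE0 : Sm (fun x => E (0 + prz x)) := hE.comp (by fun_prop)
  have hmap : l.map prz = l := by
    conv_rhs => rw [← List.map_id l]
    refine List.map_congr_left fun v hv => ?_
    rcases hl v hv with h | h <;> rw [h] <;> rfl
  have h1 : flat (k + 1 - l.length) (Dl l (fun x => E (0 + prz x))) 0 := by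
    intro m hm
    rw [← Dl_append]
    exact hfl _ (by simp; omega)
  obtain ⟨C, hC0, hC⟩ := flat_bound (hE0.dl l) h1
  refine ⟨C + 1, by positivity, fun ρ hρ hρ1 => ?_⟩
  have h2 : ∀ z : ℂ, ‖z‖ ≤ ρ → ‖Dl l E (z, 0)‖ * ρ ^ l.length ≤ C * ρ ^ (k + 1) := by
    intro z hz
    have hn : ‖((z, 0) : CC) - 0‖ = ‖z‖ := by simp [Prod.norm_def]
    have h3 := hC (z, 0) (by rw [hn]; linarith)
    rw [hn, Dl_comp hE, hmap] at h3
    simp only [prz_apply, zero_add] at h3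
    calc _ ≤ (C * ρ ^ (k + 1 - l.length)) * ρ ^ l.length := by
          refine mul_le_mul_of_nonneg_right (h3.trans ?_) (by positivity)
          exact mul_le_mul_of_nonneg_left (pow_le_pow_left₀ (norm_nonneg _) hz _) hC0
      _ = C * ρ ^ (k + 1 - l.length + l.length) := by rw [pow_add]; ring
      _ ≤ _ := mul_le_mul_of_nonneg_left (pow_le_pow_of_le_one hρ.le hρ1 (by omega)) hC0
  refine (isCompact_closedBall (0 : ℂ) ρ).eventually_forall_of_forall_eventually (P := fun w z => ‖Dl l E (z, w)‖ * ρ ^ l.length ≤ (C + 1) * ρ ^ (k + 1)) fun z hz => ?_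
  have hcont : Continuous fun p : ℂ × ℂ => ‖Dl l E (p.2, p.1)‖ * ρ ^ l.length :=
    (((hE.dl l).continuous.comp (continuous_snd.prodMk continuous_fst)).norm).mul continuous_const
  have hlt : ‖Dl l E (z, 0)‖ * ρ ^ l.length < (C + 1) * ρ ^ (k + 1) := by
    have := h2 z (mem_closedBall_zero_iff.1 hz)
    have hp : 0 < ρ ^ (k + 1) := by positivity
    nlinarith
  exact (hcont.continuousAt.eventually (gt_mem_nhds hlt)).mono fun p hp => hp.le

theorem zero_count {F : CC → ℂ} (hF : Sm F) {k : ℕ} (hfl : flat k F 0) (h : flat k (fun x => Dv (1, 0) F x + I * Dv (I, 0) F x) 0)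
    (hc : Dl (List.replicate k (1, 0)) F 0 ≠ 0) :
    ∃ δ : ℝ, 0 < δ ∧ ∀ w : ℂ, ‖w‖ < δ → ∀ S : Finset ℂ, (∀ z ∈ S, ‖z‖ < δ ∧ F (z, w) = 0) → S.card ≤ k ^ 2 := by
  have hflat := err_flat hF hfl h hc
  set c := Dl (List.replicate k (1, 0)) F 0 with hcdef
  set E : CC → ℂ := fun y : CC => ((k.factorial : ℂ) / c) * F y + (-1) * y.1 ^ k with hEdef
  have hE : Sm E := (hF.cmul _).add' ((sm_pow k).cmul _)
  have hfl' : flat (k + 1) (fun x => E (0 + prz x)) 0 := hflat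
  set n := k ^ 2 + 1 with hn
  have hfin := zdir_finite n
  have hch : ∀ l : List CC, ∃ C : ℝ, 0 ≤ C ∧ (zdir l → ∀ ρ : ℝ, 0 < ρ → ρ ≤ 1 → ∀ᶠ w : ℂ in nhds 0, ∀ z ∈ closedBall (0 : ℂ) ρ, ‖Dl l E (z, w)‖ * ρ ^ l.length ≤ C * ρ ^ (k + 1)) := by
    intro l
    by_cases hl : zdir l
    · obtain ⟨C, h0, hC⟩ := slice_bound hE hfl' hl
      exact ⟨C, h0, fun _ => hC⟩
    · exact ⟨0, le_rfl, fun h => absurd h hl⟩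
  choose Cl hCl0 hCl using hch
  obtain ⟨B, hB⟩ := (hfin.image Cl).bddAbove
  set C := max B 0 with hCdef
  have hC0 : 0 ≤ C := le_max_right _ _
  set A : ℝ := ∑ j ∈ Finset.range n, (4 : ℝ) ^ j with hA
  have hA0 : 0 ≤ A := Finset.sum_nonneg fun j _ => by positivity
  set ρ : ℝ := 1 / (2 * (C * A + 1)) with hρdef
  have hCA : 0 ≤ C * A := by positivity
  have hρ : 0 < ρ := by positivity
  have hρ1 : ρ ≤ 1 := by
    rw [hρdef, div_le_one (by positivity)]; linarith
  have hρA : C * A * ρ ≤ 1 / 2 := by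
    rw [hρdef, mul_one_div, div_le_div_iff₀ (by positivity) (by positivity)]; linarith
  have hev : ∀ᶠ w : ℂ in nhds 0, ∀ l ∈ {l : List CC | zdir l ∧ l.length < n}, ∀ z ∈ closedBall (0 : ℂ) ρ, ‖Dl l E (z, w)‖ * ρ ^ l.length ≤ Cl l * ρ ^ (k + 1) :=
    (Filter.eventually_all_finite hfin).2 fun l hl => hCl l hl.1 ρ hρ hρ1
  obtain ⟨ε, hε, hεb⟩ := Metric.eventually_nhds_iff_ball.1 hev
  refine ⟨min ε ρ, lt_min hε hρ, fun w hw S hS => ?_⟩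
  by_contra hcard
  push Not at hcard
  obtain ⟨S', hS', hc'⟩ := Finset.exists_subset_card_eq (n := k ^ 2 + 1) (s := S) hcard
  have hw' := hεb w (mem_ball_zero_iff.2 (hw.trans_le (min_le_left _ _)))
  refine count_contra (b := fun j => C * ρ ^ (k + 1) / ρ ^ j) (w := w) hE hc' hρ (fun x hx => (hS x (hS' hx)).1.le.trans (min_le_right _ _)) (fun j => by positivity) ?_ ?_ ?_
  · intro l hl hln z hz
    have h1 := hw' l ⟨hl, hln⟩ z (mem_closedBall_zero_iff.2 hz)
    rw [le_div_iff₀ (by positivity)]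
    refine h1.trans (mul_le_mul_of_nonneg_right ?_ (by positivity))
    exact (hB ⟨l, ⟨hl, hln⟩, rfl⟩).trans (le_max_left _ _)
  · have : ∀ j ∈ Finset.range (k ^ 2 + 1), C * ρ ^ (k + 1) / ρ ^ j * (4 * ρ) ^ j = C * ρ ^ (k + 1) * 4 ^ j := by
      intro j _; rw [mul_pow]; field_simp
    rw [Finset.sum_congr rfl this, ← Finset.mul_sum]
    have hp : 0 < ρ ^ k := by positivity
    calc C * ρ ^ (k + 1) * A = (C * A * ρ) * ρ ^ k := by rw [pow_succ]; ring
      _ ≤ 1 / 2 * ρ ^ k := mul_le_mul_of_nonneg_right hρA hp.le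
      _ = _ := by ring
  · intro x hx
    have := (hS x (hS' hx)).2
    simp only [hEdef, this]; ring


def good1 (A : Set CC) : Prop := ∀ x ∈ A, ∀ y ∈ A, ‖x.1 - y.1‖ ≤ 2 * ‖x.2 - y.2‖
def good2 (A : Set CC) : Prop := ∀ x ∈ A, ∀ y ∈ A, ‖x.2 - y.2‖ ≤ 2 * ‖x.1 - y.1‖

theorem good1.injOn {A : Set CC} (h : good1 A) : Set.InjOn Prod.snd A := by
  intro x hx y hy hxy
  have := h x hx y hy
  rw [hxy, sub_self, norm_zero, mul_zero] at this
  exact Prod.ext (sub_eq_zero.1 (norm_le_zero_iff.1 this)) hxy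

theorem good1.meas {A : Set CC} (h : good1 A) : μH[2] A ≤ 4 * μH[2] (Prod.snd '' A) := by
  rcases A.eq_empty_or_nonempty with rfl | hne
  · simp
  set g := Function.invFunOn (Prod.snd : CC → ℂ) A with hg
  have hgi : ∀ x ∈ A, g x.2 = x := fun x hx => h.injOn.leftInvOn_invFunOn hx
  have hL : LipschitzOnWith 2 g (Prod.snd '' A) := by
    refine LipschitzOnWith.of_dist_le_mul ?_
    rintro _ ⟨x, hx, rfl⟩ _ ⟨y, hy, rfl⟩
    rw [hgi x hx, hgi y hy, dist_eq_norm, dist_eq_norm, Prod.norm_def]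
    refine max_le (by simpa using h x hx y hy) ?_
    have := norm_nonneg (x.2 - y.2)
    simp only [Prod.snd_sub, NNReal.coe_ofNat]
    linarith
  have := hL.hausdorffMeasure_image_le (d := 2) (by norm_num)
  have e : g '' (Prod.snd '' A) = A := by
    rw [Set.image_image]
    conv_rhs => rw [← Set.image_id A]
    exact Set.image_congr fun x hx => hgi x hx
  rw [e] at this
  refine this.trans (le_of_eq ?_)
  congr 1
  norm_num

theorem disc_finite (δ : ℝ) : (μH[2] : Measure ℂ) (ball 0 δ) < ⊤ := by
  have h : (μH[((Module.finrank ℝ ℂ : ℕ) : ℝ)] : Measure ℂ).IsAddHaarMeasure := inferInstance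
  rw [Complex.finrank_real_complex] at h
  have e : (μH[2] : Measure ℂ) = μH[((2 : ℕ) : ℝ)] := by norm_num
  rw [e]
  exact measure_ball_lt_top

theorem meas_family {Z : Set CC} (hZ : MeasurableSet Z) {δ : ℝ} (hZδ : Z ⊆ ball 0 δ) {N : ℕ}
    (hN : ∀ w : ℂ, ∀ S : Finset ℂ, (∀ z ∈ S, (z, w) ∈ Z) → S.card ≤ N) {A : ℕ → Set CC} (hA : ∀ i, MeasurableSet (A i)) (hg : ∀ i, good1 (A i)) :
    μH[2] (Z ∩ ⋃ i, A i) < ⊤ := by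
  classical
  set B : ℕ → Set CC := disjointed (fun i => Z ∩ A i) with hB
  have hBsub : ∀ i, B i ⊆ Z ∩ A i := fun i => disjointed_subset _ i
  have hBm : ∀ i, MeasurableSet (B i) := MeasurableSet.disjointed fun i => hZ.inter (hA i)
  have hBg : ∀ i, good1 (B i) := fun i x hx y hy => hg i x (hBsub i hx).2 y (hBsub i hy).2
  have hBd : Pairwise (Function.onFun Disjoint B) := disjoint_disjointed _
  have hU : Z ∩ ⋃ i, A i = ⋃ i, B i := by rw [hB, iUnion_disjointed, Set.inter_iUnion]
  have hPm : ∀ i, MeasurableSet (Prod.snd '' B i : Set ℂ) := fun i =>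
    (hBm i).image_of_continuousOn_injOn continuous_snd.continuousOn (hBg i).injOn
  have hle : ∀ w : ℂ, ∑' i, (Prod.snd '' B i : Set ℂ).indicator (1 : ℂ → ENNReal) w ≤ (ball (0 : ℂ) δ).indicator (fun _ => (N : ENNReal)) w := by
    intro w
    by_cases hw : w ∈ ball (0 : ℂ) δ
    · rw [Set.indicator_of_mem hw, ENNReal.tsum_eq_iSup_sum]
      refine iSup_le fun s => ?_
      have e : ∑ i ∈ s, (Prod.snd '' B i : Set ℂ).indicator (1 : ℂ → ENNReal) w = ((s.filter fun i => w ∈ (Prod.snd '' B i : Set ℂ)).card : ENNReal) := by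
        rw [Finset.card_filter]
        push_cast
        refine Finset.sum_congr rfl fun i _ => ?_
        simp only [Set.indicator_apply, Pi.one_apply]
        
      rw [e]
      have hz : ∀ i, ∃ z : ℂ, w ∈ (Prod.snd '' B i : Set ℂ) → (z, w) ∈ B i := by
        intro i
        by_cases h : w ∈ (Prod.snd '' B i : Set ℂ)
        · obtain ⟨x, hx, rfl⟩ := h
          exact ⟨x.1, fun _ => hx⟩
        · exact ⟨0, fun h' => absurd h' h⟩
      choose z hz using hz
      have hinj : Set.InjOn z (s.filter fun i => w ∈ (Prod.snd '' B i : Set ℂ)) := by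
        intro i hi j hj hij
        by_contra hne
        have hi' := hz i (Finset.mem_filter.1 hi).2
        have hj' := hz j (Finset.mem_filter.1 hj).2
        rw [← hij] at hj'
        exact Set.disjoint_left.1 (hBd hne) hi' hj'
      rw [← Finset.card_image_of_injOn hinj]
      exact_mod_cast hN w _ (by
        intro x hx
        obtain ⟨i, hi, rfl⟩ := Finset.mem_image.1 hx
        exact (hBsub i (hz i (Finset.mem_filter.1 hi).2)).1)
    · rw [Set.indicator_of_notMem hw]
      refine le_of_eq (ENNReal.tsum_eq_zero.2 fun i => Set.indicator_of_notMem ?_ _)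
      rintro ⟨x, hx, rfl⟩
      apply hw
      have := hZδ (hBsub i hx).1
      rw [mem_ball_zero_iff] at this ⊢
      exact (norm_snd_le x).trans_lt this
  calc μH[2] (Z ∩ ⋃ i, A i) ≤ ∑' i, μH[2] (B i) := by rw [hU]; exact measure_iUnion_le _
    _ ≤ ∑' i, 4 * μH[2] (Prod.snd '' B i : Set ℂ) := ENNReal.tsum_le_tsum fun i => (hBg i).meas
    _ = 4 * ∑' i, μH[2] (Prod.snd '' B i : Set ℂ) := ENNReal.tsum_mul_left
    _ = 4 * ∑' i, ∫⁻ w, (Prod.snd '' B i : Set ℂ).indicator (1 : ℂ → ENNReal) w ∂(μH[2] : Measure ℂ) := by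
        congr 1; refine tsum_congr fun i => ?_
        rw [lintegral_indicator_one (hPm i)]
    _ = 4 * ∫⁻ w, ∑' i, (Prod.snd '' B i : Set ℂ).indicator (1 : ℂ → ENNReal) w ∂(μH[2] : Measure ℂ) := by
        rw [lintegral_tsum]
        exact fun i => (measurable_one.indicator (hPm i)).aemeasurable
    _ ≤ 4 * ∫⁻ w, (ball (0 : ℂ) δ).indicator (fun _ => (N : ENNReal)) w ∂(μH[2] : Measure ℂ) := by
        gcongr with w; exact hle w
    _ = 4 * (N * (μH[2] : Measure ℂ) (ball 0 δ)) := by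
        rw [lintegral_indicator_const measurableSet_ball]
    _ < ⊤ := by
        refine ENNReal.mul_lt_top (by norm_num) (ENNReal.mul_lt_top (by simp) (disc_finite δ))

theorem meas_family' {Z : Set CC} (hZ : MeasurableSet Z) {δ : ℝ} (hZδ : Z ⊆ ball 0 δ) {N : ℕ}
    (hN : ∀ w : ℂ, ∀ S : Finset ℂ, (∀ z ∈ S, (z, w) ∈ Z) → S.card ≤ N) {A : Set (Set CC)} (hAc : A.Countable) (hA : ∀ a ∈ A, MeasurableSet a) (hg : ∀ a ∈ A, good1 a) :
    μH[2] (Z ∩ ⋃₀ A) < ⊤ := by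
  rcases A.eq_empty_or_nonempty with rfl | hne
  · simp
  obtain ⟨f, rfl⟩ := hAc.exists_eq_range hne
  rw [Set.sUnion_range]
  exact meas_family hZ hZδ hN (fun i => hA _ ⟨i, rfl⟩) (fun i => hg _ ⟨i, rfl⟩)

theorem swap_isometry : Isometry (Prod.swap : CC → CC) := by
  refine Isometry.of_dist_eq fun x y => ?_
  simp [Prod.dist_eq, max_comm]

theorem meas_family2 {Z : Set CC} (hZ : MeasurableSet Z) {δ : ℝ} (hZδ : Z ⊆ ball 0 δ) {N : ℕ}
    (hN : ∀ w : ℂ, ∀ S : Finset ℂ, (∀ z ∈ S, (w, z) ∈ Z) → S.card ≤ N) {A : Set (Set CC)} (hAc : A.Countable) (hA : ∀ a ∈ A, MeasurableSet a) (hg : ∀ a ∈ A, good2 a) :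
    μH[2] (Z ∩ ⋃₀ A) < ⊤ := by
  have h1 := meas_family' (Z := Prod.swap ⁻¹' Z) (δ := δ) (N := N) (A := (fun a => Prod.swap ⁻¹' a) '' A) (measurable_swap hZ) (by
      intro x hx
      have := hZδ hx
      rw [mem_ball_zero_iff] at this ⊢
      simpa [Prod.norm_def, max_comm] using this) (fun w S hS => hN w S hS) (hAc.image _) (by
      rintro _ ⟨a, ha, rfl⟩; exact measurable_swap (hA a ha)) (by
      rintro _ ⟨a, ha, rfl⟩ x hx y hy; exact hg a ha x.swap hx y.swap hy)
  rw [← swap_isometry.hausdorffMeasure_image (Or.inl (by norm_num))] at h1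
  convert h1 using 2
  ext x
  simp only [Set.mem_inter_iff, Set.mem_sUnion, Set.mem_image, Set.mem_preimage, exists_exists_and_eq_and]
  constructor
  · rintro ⟨hx, a, ha, hxa⟩
    exact ⟨x.swap, ⟨by simpa using hx, a, ha, by simpa using hxa⟩, by simp⟩
  · rintro ⟨y, ⟨hy, a, ha, hya⟩, rfl⟩
    exact ⟨hy, a, ha, hya⟩


theorem lin_key {A : CC →L[ℝ] ℂ} {K : CC →L[ℝ] CC} (hK : ‖K - Icl‖ ≤ 1 / 16) (hA : ∀ X, A X + I * A (K X) = 0) (u : CC) :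
    ‖A u - (u.1 * A (1, 0) + u.2 * A (0, 1))‖ ≤ ‖A‖ / 16 * (‖u.1‖ + ‖u.2‖) := by
  have h1 : ∀ e : CC, ‖e‖ ≤ 1 → ‖A (Icl e) - I * A e‖ ≤ ‖A‖ / 16 := by
    intro e he
    have e1 : A (Icl e) - I * A e = - A ((K - Icl) e) := by
      have := hA e
      rw [sub_apply, map_sub]
      linear_combination (-I) * this + A (K e) * Complex.I_mul_I
    rw [e1, norm_neg]
    refine (A.le_opNorm _).trans ?_
    have h2 := (K - Icl).le_opNorm e
    have h3 : ‖(K - Icl) e‖ ≤ 1 / 16 := by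
      refine h2.trans ((mul_le_mul hK he (norm_nonneg _) (by norm_num)).trans (by norm_num))
    calc _ ≤ ‖A‖ * (1 / 16) := mul_le_mul_of_nonneg_left h3 (norm_nonneg _)
      _ = _ := by ring
  have ha := h1 (1, 0) (by simp [Prod.norm_def])
  have hb := h1 (0, 1) (by simp [Prod.norm_def])
  have e2 : A u = (u.1.re : ℂ) * A (1, 0) + (u.1.im : ℂ) * A (Icl (1, 0)) + (u.2.re : ℂ) * A (0, 1) + (u.2.im : ℂ) * A (Icl (0, 1)) := by
    have : u = u.1.re • ((1, 0) : CC) + u.1.im • Icl (1, 0) + u.2.re • ((0, 1) : CC) + u.2.im • Icl (0, 1) := by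
      ext <;> simp [Icl_apply]
    conv_lhs => rw [this]
    simp only [map_add, map_smul, real_smul]
  have e3 : A u - (u.1 * A (1, 0) + u.2 * A (0, 1)) = (u.1.im : ℂ) * (A (Icl (1, 0)) - I * A (1, 0)) + (u.2.im : ℂ) * (A (Icl (0, 1)) - I * A (0, 1)) := by
    rw [e2]
    have q1 := Complex.re_add_im u.1
    have q2 := Complex.re_add_im u.2
    linear_combination A (1, 0) * q1 + A (0, 1) * q2
  rw [e3]
  refine (norm_add_le _ _).trans ?_
  rw [norm_mul, norm_mul, Complex.norm_real, Complex.norm_real]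
  have i1 := mul_le_mul (Complex.abs_im_le_norm u.1) ha (norm_nonneg _) (norm_nonneg _)
  have i2 := mul_le_mul (Complex.abs_im_le_norm u.2) hb (norm_nonneg _) (norm_nonneg _)
  rw [Real.norm_eq_abs, Real.norm_eq_abs]
  linarith

theorem lin_norm {A : CC →L[ℝ] ℂ} {K : CC →L[ℝ] CC} (hK : ‖K - Icl‖ ≤ 1 / 16) (hA : ∀ X, A X + I * A (K X) = 0) {m : ℝ}
    (h1 : ‖A (1, 0)‖ ≤ m) (h2 : ‖A (0, 1)‖ ≤ m) : ‖A‖ ≤ 3 * m := by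
  have hm : 0 ≤ m := (norm_nonneg _).trans h1
  have : ‖A‖ ≤ 2 * m + ‖A‖ / 8 := by
    refine A.opNorm_le_bound (by positivity) fun u => ?_
    have h := lin_key hK hA u
    have h3 := norm_le_norm_add_norm_sub' (A u) (u.1 * A (1, 0) + u.2 * A (0, 1))
    have h4 : ‖u.1 * A (1, 0) + u.2 * A (0, 1)‖ ≤ ‖u‖ * m + ‖u‖ * m := by
      refine (norm_add_le _ _).trans ?_
      rw [norm_mul, norm_mul]
      gcongr
      · exact norm_fst_le u
      · exact norm_snd_le u
    have h5 : ‖A‖ / 16 * (‖u.1‖ + ‖u.2‖) ≤ ‖A‖ / 16 * (‖u‖ + ‖u‖) := by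
      gcongr
      · exact norm_fst_le u
      · exact norm_snd_le u
    linarith
  linarith

theorem lin_est {A : CC →L[ℝ] ℂ} {K : CC →L[ℝ] CC} (hK : ‖K - Icl‖ ≤ 1 / 16) (hA : ∀ X, A X + I * A (K X) = 0) (hA0 : A ≠ 0) :
    ∃ η : ℝ, 0 < η ∧ ((∀ u : CC, ‖A u‖ ≤ η * ‖u‖ → ‖u.1‖ ≤ 2 * ‖u.2‖) ∨ (∀ u : CC, ‖A u‖ ≤ η * ‖u‖ → ‖u.2‖ ≤ 2 * ‖u.1‖)) := by
  have hApos : 0 < ‖A‖ := norm_pos_iff.2 hA0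
  have hmax : ∀ u : CC, ‖u‖ ≤ ‖u.1‖ + ‖u.2‖ := fun u => by
    rw [Prod.norm_def]; exact max_le (by linarith [norm_nonneg u.2]) (by linarith [norm_nonneg u.1])
  rcases le_total ‖A (0, 1)‖ ‖A (1, 0)‖ with h | h
  · have hn := lin_norm hK hA le_rfl h
    refine ⟨‖A (1, 0)‖ / 16, by linarith, Or.inl fun u hu => ?_⟩
    have hk := lin_key hK hA u
    have h3 : ‖u.1 * A (1, 0)‖ ≤ ‖A u‖ + ‖A u - (u.1 * A (1, 0) + u.2 * A (0, 1))‖ + ‖u.2 * A (0, 1)‖ := by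
      have e : u.1 * A (1, 0) = A u - (A u - (u.1 * A (1, 0) + u.2 * A (0, 1))) - u.2 * A (0, 1) := by ring
      conv_lhs => rw [e]
      exact (norm_sub_le _ _).trans (add_le_add (norm_sub_le _ _) le_rfl)
    rw [norm_mul, norm_mul] at h3
    have hpos : 0 < ‖A (1, 0)‖ := by linarith
    have h4 := mul_le_mul_of_nonneg_left h (norm_nonneg u.2)
    have h5 : ‖A‖ / 16 * (‖u.1‖ + ‖u.2‖) ≤ 3 * ‖A (1, 0)‖ / 16 * (‖u.1‖ + ‖u.2‖) := by gcongr
    have h6 : ‖A (1, 0)‖ / 16 * ‖u‖ ≤ ‖A (1, 0)‖ / 16 * (‖u.1‖ + ‖u.2‖) := by gcongr; exact hmax u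
    have h7 : ‖A (1, 0)‖ * ‖u.1‖ ≤ ‖A (1, 0)‖ * (2 * ‖u.2‖) := by nlinarith [mul_nonneg hpos.le (norm_nonneg u.2)]
    exact le_of_mul_le_mul_left h7 hpos
  · have hn := lin_norm hK hA h le_rfl
    refine ⟨‖A (0, 1)‖ / 16, by linarith, Or.inr fun u hu => ?_⟩
    have hk := lin_key hK hA u
    have h3 : ‖u.2 * A (0, 1)‖ ≤ ‖A u‖ + ‖A u - (u.1 * A (1, 0) + u.2 * A (0, 1))‖ + ‖u.1 * A (1, 0)‖ := by
      have e : u.2 * A (0, 1) = A u - (A u - (u.1 * A (1, 0) + u.2 * A (0, 1))) - u.1 * A (1, 0) := by ring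
      conv_lhs => rw [e]
      exact (norm_sub_le _ _).trans (add_le_add (norm_sub_le _ _) le_rfl)
    rw [norm_mul, norm_mul] at h3
    have hpos : 0 < ‖A (0, 1)‖ := by linarith
    have h4 := mul_le_mul_of_nonneg_left h (norm_nonneg u.1)
    have h5 : ‖A‖ / 16 * (‖u.1‖ + ‖u.2‖) ≤ 3 * ‖A (0, 1)‖ / 16 * (‖u.1‖ + ‖u.2‖) := by gcongr
    have h6 : ‖A (0, 1)‖ / 16 * ‖u‖ ≤ ‖A (0, 1)‖ / 16 * (‖u.1‖ + ‖u.2‖) := by gcongr; exact hmax u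
    have h7 : ‖A (0, 1)‖ * ‖u.2‖ ≤ ‖A (0, 1)‖ * (2 * ‖u.1‖) := by nlinarith [mul_nonneg hpos.le (norm_nonneg u.1)]
    exact le_of_mul_le_mul_left h7 hpos

theorem exists_graph {J : CC → (CC →L[ℝ] CC)} (hJ : ContDiff ℝ (⊤ : ℕ∞) J) {f : CC → ℂ} (hf : Sm f) {q : CC} {r C : ℝ} (hr : 0 < r)
    (hE : ∀ x ∈ ball q r, ∀ X, ‖fderiv ℝ f x X + I * fderiv ℝ f x (J x X)‖ ≤ C * ‖f x‖ * ‖X‖) (hK : ‖J q - Icl‖ ≤ 1 / 16)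
    (hq : f q = 0) {k : ℕ} (hnf : ¬ flat (k + 1) f q) :
    ∃ m : ℕ, flat m f q ∧ ∃ N : Set CC, IsOpen N ∧ q ∈ N ∧ (good1 (N ∩ {x | flat m f x}) ∨ good2 (N ∩ {x | flat m f x})) := by
  classical
  have hex : ∃ n, ¬ flat (n + 1) f q := ⟨k, hnf⟩
  obtain ⟨m, hm, hmin⟩ : ∃ m, ¬ flat (m + 1) f q ∧ ∀ j < m, flat (j + 1) f q :=
    ⟨Nat.find hex, Nat.find_spec hex, fun j hj => not_not.1 (Nat.find_min hex hj)⟩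
  have hm1 : m ≠ 0 := by
    rintro rfl
    apply hm
    intro l hl
    have : l = [] := List.length_eq_zero_iff.1 (by omega)
    rw [this]; exact hq
  have hfm : flat m f q := by
    have := hmin (m - 1) (by omega)
    rwa [Nat.sub_add_cancel (by omega)] at this
  refine ⟨m, hfm, ?_⟩
  have : ∃ l : List CC, l.length = m ∧ Dl l f q ≠ 0 := by
    by_contra hcon
    push Not at hcon
    apply hm
    intro l hl
    rcases (Nat.lt_succ_iff.1 hl).lt_or_eq with h | h
    · exact hfm l h
    · exact hcon l h
  obtain ⟨l, hl, hl0⟩ := this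
  rcases l with _ | ⟨v, l⟩
  · simp at hl; omega
  simp only [List.length_cons] at hl
  rw [Dl_cons hf] at hl0
  set g := Dl l f with hg
  have hgs : Sm g := hf.dl l
  have hA : ∀ X, fderiv ℝ g q X + I * fderiv ℝ g q (J q X) = 0 := by
    intro X
    have h1 := holo_flat hJ hf hr hE hfm X l (by omega)
    rw [Dl_add (hf.dv _) ((hf.dv _).cmul I), Dl_cmul (hf.dv _)] at h1
    have e1 : Dl l (Dv X f) = Dv X g := Dl_cons hf X l
    have e2 : Dl l (Dv (J q X) f) = Dv (J q X) g := Dl_cons hf _ l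
    simp only [e1, e2] at h1
    exact h1
  have hA0 : fderiv ℝ g q ≠ 0 := by
    intro h0; apply hl0; rw [Dv, h0]; rfl
  obtain ⟨η, hη, hor⟩ := lin_est hK hA hA0
  have hs : HasStrictFDerivAt g (fderiv ℝ g q) q := hgs.contDiffAt.hasStrictFDerivAt (by norm_cast)
  obtain ⟨s, hs, hap⟩ := hs.approximates_deriv_on_nhds (c := ⟨η, hη.le⟩) (Or.inr hη)
  obtain ⟨N, hNs, hNo, hqN⟩ := _root_.mem_nhds_iff.1 hs
  have hkey : ∀ x ∈ N ∩ {x | flat m f x}, ∀ y ∈ N ∩ {x | flat m f x}, ‖fderiv ℝ g q (x - y)‖ ≤ η * ‖x - y‖ := by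
    intro x hx y hy
    have h1 := hap x (hNs hx.1) y (hNs hy.1)
    have gx : g x = 0 := hx.2 l (by omega)
    have gy : g y = 0 := hy.2 l (by omega)
    rw [gx, gy, sub_self, zero_sub, norm_neg] at h1
    exact h1
  refine ⟨N, hNo, hqN, ?_⟩
  rcases hor with h | h
  · exact Or.inl fun x hx y hy => h _ (hkey x hx y hy)
  · exact Or.inr fun x hx y hy => h _ (hkey x hx y hy)

theorem isClosed_flat {f : CC → ℂ} (hf : Sm f) (m : ℕ) : IsClosed {x | flat m f x} := by
  have : {x | flat m f x} = ⋂ l : List CC, ⋂ _ : l.length < m, {x | Dl l f x = 0} := by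
    ext x; simp [flat]
  rw [this]
  exact isClosed_iInter fun l => isClosed_iInter fun _ => isClosed_eq (hf.dl l).continuous continuous_const

noncomputable def swp : CC →L[ℝ] CC := (ContinuousLinearMap.snd ℝ ℂ ℂ).prod (ContinuousLinearMap.fst ℝ ℂ ℂ)
theorem swp_apply (x : CC) : swp x = (x.2, x.1) := rfl

theorem meas_local {J : CC → (CC →L[ℝ] CC)} (hJ : ContDiff ℝ (⊤ : ℕ∞) J) (hJ0 : J 0 = Icl) {f : CC → ℂ} (hf : Sm f) {ρ C : ℝ} (hρ : 0 < ρ)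
    (hE : ∀ x ∈ ball (0 : CC) ρ, ∀ X, ‖fderiv ℝ f x X + I * fderiv ℝ f x (J x X)‖ ≤ C * ‖f x‖ * ‖X‖)
    {k : ℕ} (hk : flat k f 0) (h1 : Dl (List.replicate k (1, 0)) f 0 ≠ 0) (h2 : Dl (List.replicate k (0, 1)) f 0 ≠ 0) :
    ∃ δ > 0, μH[2] ({x | f x = 0} ∩ ball (0 : CC) δ) < ⊤ := by
  obtain ⟨δ1, hδ1, hc1⟩ := zero_count hf hk (by
    have := holo_flat hJ hf hρ hE hk (1, 0)
    rw [hJ0, Icl_apply] at this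
    simpa using this) h1
  have hsw : Sm (fun x => f (0 + swp x)) := ContDiff.comp hf (contDiff_const.add swp.contDiff)
  obtain ⟨δ2, hδ2, hc2⟩ := zero_count (k := k) hsw (by
      intro l hl
      rw [Dl_comp hf]
      simp only [map_zero, add_zero]
      exact hk _ (by simpa using hl)) (by
      have := holo_flat hJ hf hρ hE hk (0, 1)
      rw [hJ0, Icl_apply] at this
      have hD : ∀ v, Dv v (fun x => f (0 + swp x)) = fun x => Dv (swp v) f (0 + swp x) := fun v => Dl_comp hf 0 swp [v]
      intro l hl
      have e : (fun x => Dv (1, 0) (fun x => f (0 + swp x)) x + I * Dv (I, 0) (fun x => f (0 + swp x)) x) = fun x => (fun y => Dv (0, 1) f y + I * Dv (0, I) f y) (0 + swp x) := by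
        funext x
        rw [hD, hD]; rfl
      rw [e, Dl_comp (f := fun y => Dv (0, 1) f y + I * Dv (0, I) f y) ((hf.dv _).add' ((hf.dv _).cmul I)) 0 swp l]
      simp only [map_zero, add_zero]
      have := this (l.map swp) (by simpa using hl)
      simpa using this) (by
      rw [Dl_comp hf]
      simp only [map_zero, add_zero, List.map_replicate, swp_apply]
      exact h2)
  have hJc : ∀ᶠ q in nhds (0 : CC), ‖J q - Icl‖ ≤ 1 / 16 := by
    have hcont : ContinuousAt (fun q => ‖J q - Icl‖) 0 := ((hJ.continuous.sub continuous_const).norm).continuousAt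
    have h0 : ‖J 0 - Icl‖ < 1 / 16 := by rw [hJ0, sub_self, norm_zero]; norm_num
    exact (hcont.eventually (gt_mem_nhds h0)).mono fun q hq => hq.le
  have hnf : ∀ᶠ q in nhds (0 : CC), ¬ flat (k + 1) f q := by
    have : ∀ᶠ q in nhds (0 : CC), Dl (List.replicate k (1, 0)) f q ≠ 0 := (hf.dl _).continuous.continuousAt.eventually_ne h1
    refine this.mono fun q hq hfl => hq (hfl _ (by simp))
  obtain ⟨δ3, hδ3, h3⟩ := Metric.eventually_nhds_iff_ball.1 (hJc.and hnf)
  set δ := min (min δ1 δ2) (min δ3 ρ) with hδ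
  have hδpos : 0 < δ := lt_min (lt_min hδ1 hδ2) (lt_min hδ3 hρ)
  refine ⟨δ, hδpos, ?_⟩
  set Z := {x | f x = 0} ∩ ball (0 : CC) δ with hZ
  have hZm : MeasurableSet Z := (isClosed_eq hf.continuous continuous_const).measurableSet.inter measurableSet_ball
  have hg : ∀ q ∈ Z, ∃ m : ℕ, flat m f q ∧ ∃ N : Set CC, IsOpen N ∧ q ∈ N ∧ (good1 (N ∩ {x | flat m f x}) ∨ good2 (N ∩ {x | flat m f x})) := by
    intro q hq
    have hqδ := hq.2
    have hq3 : q ∈ ball (0 : CC) δ3 := ball_subset_ball ((min_le_right _ _).trans (min_le_left _ _)) hqδ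
    have hqρ : q ∈ ball (0 : CC) ρ := ball_subset_ball ((min_le_right _ _).trans (min_le_right _ _)) hqδ
    obtain ⟨hK, hn⟩ := h3 q hq3
    obtain ⟨r, hr, hrs⟩ := Metric.isOpen_iff.1 isOpen_ball q hqρ
    exact exists_graph hJ hf hr (fun x hx => hE x (hrs hx)) hK hq.1 hn
  choose! m hm N hNo hqN hgood using hg
  have hcov : ∀ j : ℕ, ∃ t ⊆ {q ∈ Z | m q = j}, t.Countable ∧ {q ∈ Z | m q = j} ⊆ ⋃ q ∈ t, N q ∩ {x | flat (m q) f x} := by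
    intro j
    refine TopologicalSpace.countable_cover_nhdsWithin fun q hq => ?_
    refine mem_nhdsWithin.2 ⟨N q, hNo q hq.1, hqN q hq.1, ?_⟩
    rintro x ⟨hxN, hxZ, hxm⟩
    refine ⟨hxN, ?_⟩
    have := hm x hxZ
    rw [hxm, ← hq.2] at this
    exact this
  choose t htsub htc htcov using hcov
  set T : Set CC := ⋃ j, t j with hT
  have hTc : T.Countable := Set.countable_iUnion htc
  have hTZ : T ⊆ Z := Set.iUnion_subset fun j q hq => (htsub j hq).1
  set 𝒜 : Set (Set CC) := (fun q => N q ∩ {x | flat (m q) f x}) '' T with h𝒜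
  have h𝒜c : 𝒜.Countable := hTc.image _
  have h𝒜m : ∀ a ∈ 𝒜, MeasurableSet a := by
    rintro _ ⟨q, hq, rfl⟩
    exact (hNo q (hTZ hq)).measurableSet.inter (isClosed_flat hf _).measurableSet
  have h𝒜g : ∀ a ∈ 𝒜, good1 a ∨ good2 a := by
    rintro _ ⟨q, hq, rfl⟩
    exact hgood q (hTZ hq)
  have hsub : Z ⊆ (Z ∩ ⋃₀ {a ∈ 𝒜 | good1 a}) ∪ (Z ∩ ⋃₀ {a ∈ 𝒜 | good2 a}) := by
    intro x hx
    obtain ⟨q, hq⟩ := Set.mem_iUnion.1 (htcov (m x) ⟨hx, rfl⟩)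
    obtain ⟨hqt, hxq⟩ := Set.mem_iUnion.1 hq
    have hmem : N q ∩ {x | flat (m q) f x} ∈ 𝒜 := ⟨q, Set.mem_iUnion.2 ⟨m x, hqt⟩, rfl⟩
    rcases h𝒜g _ hmem with h | h
    · exact Or.inl ⟨hx, _, ⟨hmem, h⟩, hxq⟩
    · exact Or.inr ⟨hx, _, ⟨hmem, h⟩, hxq⟩
  have hnorm : ∀ x ∈ Z, ‖x.1‖ < δ ∧ ‖x.2‖ < δ := fun x hx =>
    ⟨(norm_fst_le x).trans_lt (mem_ball_zero_iff.1 hx.2), (norm_snd_le x).trans_lt (mem_ball_zero_iff.1 hx.2)⟩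
  have hle1 : δ ≤ δ1 := (min_le_left _ _).trans (min_le_left _ _)
  have hle2 : δ ≤ δ2 := (min_le_left _ _).trans (min_le_right _ _)
  refine (measure_mono hsub).trans_lt ((measure_union_le _ _).trans_lt (ENNReal.add_lt_top.2 ⟨?_, ?_⟩))
  · refine meas_family' hZm Set.inter_subset_right (N := k ^ 2) ?_ (h𝒜c.mono fun a ha => ha.1) (fun a ha => h𝒜m a ha.1) fun a ha => ha.2
    intro w S hS
    rcases S.eq_empty_or_nonempty with rfl | ⟨z0, hz0⟩
    · simp
    · exact hc1 w ((hnorm _ (hS z0 hz0)).2.trans_le hle1) S fun z hz => ⟨(hnorm _ (hS z hz)).1.trans_le hle1, (hS z hz).1⟩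
  · refine meas_family2 hZm Set.inter_subset_right (N := k ^ 2) ?_ (h𝒜c.mono fun a ha => ha.1) (fun a ha => h𝒜m a ha.1) fun a ha => ha.2
    intro w S hS
    rcases S.eq_empty_or_nonempty with rfl | ⟨z0, hz0⟩
    · simp
    · refine hc2 w ((hnorm _ (hS z0 hz0)).1.trans_le hle2) S fun z hz => ⟨(hnorm _ (hS z hz)).2.trans_le hle2, ?_⟩
      have := (hS z hz).1
      simpa [swp_apply] using this


noncomputable def mat (p q r s : ℂ) : CC →L[ℝ] CC :=
  LinearMap.toContinuousLinearMap
    { toFun := fun x => (p * x.1 + q * x.2, r * x.1 + s * x.2)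
      map_add' := fun x y => by ext1 <;> simp <;> ring
      map_smul' := fun c x => by ext1 <;> simp [real_smul] <;> ring }

theorem mat_apply (p q r s : ℂ) (x : CC) : mat p q r s x = (p * x.1 + q * x.2, r * x.1 + s * x.2) := rfl

theorem exists_two_dirs {O : Set CC} (hO : IsOpen O) (hne : O.Nonempty) : ∃ e1 ∈ O, ∃ e2 ∈ O, e1.1 * e2.2 - e1.2 * e2.1 ≠ 0 := by
  obtain ⟨⟨a, b⟩, he⟩ := hne
  have h1 : ∀ᶠ s : ℂ in nhds 0, ((a + s, b) : CC) ∈ O := by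
    have hc : Continuous fun s : ℂ => ((a + s, b) : CC) := by fun_prop
    exact hc.continuousAt.eventually_mem (hO.mem_nhds (by simpa using he))
  have h2 : ∀ᶠ s : ℂ in nhds 0, ((a, b + s) : CC) ∈ O := by
    have hc : Continuous fun s : ℂ => ((a, b + s) : CC) := by fun_prop
    exact hc.continuousAt.eventually_mem (hO.mem_nhds (by simpa using he))
  have h3 : ∀ᶠ s : ℂ in nhdsWithin 0 {0}ᶜ, s ≠ 0 := eventually_mem_nhdsWithin
  have h4 : ∀ᶠ s : ℂ in nhdsWithin 0 {0}ᶜ, a + b + s ≠ 0 := by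
    by_cases hab : a + b = 0
    · refine h3.mono fun s hs => by rwa [hab, zero_add]
    · have hc : ContinuousAt (fun s : ℂ => a + b + s) 0 := by fun_prop
      exact (hc.eventually_ne (by simpa using hab)).filter_mono nhdsWithin_le_nhds
  obtain ⟨s, ⟨⟨h1, h2⟩, h3⟩, h4⟩ := ((((h1.and h2).filter_mono nhdsWithin_le_nhds).and h3).and h4).exists
  refine ⟨_, h1, _, h2, ?_⟩
  have : (a + s) * (b + s) - b * a = s * (a + b + s) := by ring
  simp only [this]
  exact mul_ne_zero h3 h4

theorem meas_model {J : CC → (CC →L[ℝ] CC)} (hJ : ContDiff ℝ (⊤ : ℕ∞) J) (hJ0 : J 0 = Icl) {f : CC → ℂ} (hf : Sm f) {ρ C : ℝ} (hρ : 0 < ρ)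
    (hE : ∀ x ∈ ball (0 : CC) ρ, ∀ X, ‖fderiv ℝ f x X + I * fderiv ℝ f x (J x X)‖ ≤ C * ‖f x‖ * ‖X‖)
    {k : ℕ} (hk : flat k f 0) (hnk : ¬ flat (k + 1) f 0) :
    ∃ δ > 0, μH[2] ({x | f x = 0} ∩ ball (0 : CC) δ) < ⊤ := by
  set O : Set CC := {e | Dl (List.replicate k e) f 0 ≠ 0} with hO
  have hOo : IsOpen O := isOpen_ne_fun (continuous_Dl_diag hf k 0) continuous_const
  have hOne : O.Nonempty := by
    by_contra hcon
    rw [Set.not_nonempty_iff_eq_empty] at hcon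
    apply hnk
    intro l hl
    rcases (Nat.lt_succ_iff.1 hl).lt_or_eq with h | h
    · exact hk l h
    · refine diag_zero hf (fun e => ?_) h
      by_contra he
      have : e ∈ O := he
      rw [hcon] at this; exact this
  obtain ⟨e1, he1, e2, he2, hd⟩ := exists_two_dirs hOo hOne
  set d := e1.1 * e2.2 - e1.2 * e2.1 with hdd
  set S := mat e1.1 e2.1 e1.2 e2.2 with hS
  set S' := mat (e2.2 / d) (-e2.1 / d) (-e1.2 / d) (e1.1 / d) with hS'
  have hSS' : ∀ x, S (S' x) = x := by
    intro x
    rw [hS, hS', mat_apply, mat_apply]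
    ext1
    · simp only
      field_simp
      rw [hdd]; ring
    · simp only
      field_simp
      rw [hdd]; ring
  have hS'S : ∀ x, S' (S x) = x := by
    intro x
    rw [hS, hS', mat_apply, mat_apply]
    ext1
    · simp only
      field_simp
      rw [hdd]; ring
    · simp only
      field_simp
      rw [hdd]; ring
  have hg : Sm (fun x => f (0 + S x)) := ContDiff.comp hf (contDiff_const.add S.contDiff)
  have hJ' : ContDiff ℝ (⊤ : ℕ∞) (fun x => S'.comp ((J (0 + S x)).comp S)) :=
    contDiff_const.clm_comp ((hJ.comp (contDiff_const.add S.contDiff)).clm_comp contDiff_const)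
  have hgd : ∀ x X, fderiv ℝ (fun x => f (0 + S x)) x X = fderiv ℝ f (0 + S x) (S X) := by
    intro x X
    have := congrFun (Dl_comp hf 0 S [X]) x
    exact this
  set ρ' := ρ / (‖S‖ + 1) with hρ'
  have hρ'0 : 0 < ρ' := by positivity
  obtain ⟨δ, hδ, hfin⟩ := meas_local (J := fun x => S'.comp ((J (0 + S x)).comp S)) hJ' (by
      refine ContinuousLinearMap.ext fun x => ?_
      simp only [map_zero, add_zero, hJ0, ContinuousLinearMap.comp_apply]
      have : Icl (S x) = S (Icl x) := by
        rw [hS, mat_apply, mat_apply, Icl_apply, Icl_apply]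
        ext1 <;> simp only <;> ring
      rw [this, hS'S]) (f := fun x => f (0 + S x)) hg (C := |C| * ‖S‖) hρ'0 (by
      intro x hx X
      rw [hgd, hgd]
      simp only [ContinuousLinearMap.comp_apply, hSS']
      have hx' : 0 + S x ∈ ball (0 : CC) ρ := by
        rw [zero_add, mem_ball_zero_iff]
        rw [mem_ball_zero_iff, hρ', lt_div_iff₀ (by positivity)] at hx
        have := S.le_opNorm x
        nlinarith [norm_nonneg x]
      refine (hE _ hx' (S X)).trans ?_
      have h1 := S.le_opNorm X
      calc C * ‖f (0 + S x)‖ * ‖S X‖ ≤ |C| * ‖f (0 + S x)‖ * (‖S‖ * ‖X‖) := by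
            gcongr; exact le_abs_self C
        _ = _ := by ring) (k := k) (by
      intro l hl
      rw [Dl_comp hf]
      simp only [map_zero, add_zero]
      exact hk _ (by simpa using hl)) (by
      rw [Dl_comp hf]
      have : S (1, 0) = e1 := by rw [hS, mat_apply]; ext1 <;> simp
      simp only [map_zero, add_zero, List.map_replicate, this]
      exact he1) (by
      rw [Dl_comp hf]
      have : S (0, 1) = e2 := by rw [hS, mat_apply]; ext1 <;> simp
      simp only [map_zero, add_zero, List.map_replicate, this]
      exact he2)
  refine ⟨δ / (‖S'‖ + 1), by positivity, ?_⟩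
  have hsub : {x | f x = 0} ∩ ball (0 : CC) (δ / (‖S'‖ + 1)) ⊆ S '' ({x | f (0 + S x) = 0} ∩ ball 0 δ) := by
    rintro x ⟨hx0, hx⟩
    refine ⟨S' x, ⟨?_, ?_⟩, hSS' x⟩
    · rw [Set.mem_setOf_eq, zero_add, hSS']; exact hx0
    · rw [mem_ball_zero_iff]
      rw [mem_ball_zero_iff, lt_div_iff₀ (by positivity)] at hx
      have := S'.le_opNorm x
      nlinarith [norm_nonneg x]
  refine (measure_mono hsub).trans_lt ((S.lipschitz.lipschitzOnWith.hausdorffMeasure_image_le (by norm_num)).trans_lt ?_)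
  exact ENNReal.mul_lt_top (ENNReal.rpow_lt_top_of_nonneg (by norm_num) (by simp)) hfin


abbrev BF := CC →L[ℝ] CC →L[ℝ] ℝ

theorem alt_swap {A : BF} (hA : ∀ X, A X X = 0) (X Y : CC) : A X Y = - A Y X := by
  have h := hA (X + Y)
  simp only [map_add, add_apply, hA] at h
  linarith

theorem anti_move {A : BF} {K : CC →L[ℝ] CC} (hK : ∀ X, K (K X) = -X) (hAK : ∀ X Y, A (K X) (K Y) = - A X Y) (X Y : CC) : A (K X) Y = A X (K Y) := by
  have h := hAK X (K Y)
  rw [hK, map_neg] at h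
  linarith

theorem anti_self {A : BF} {K : CC →L[ℝ] CC} (hK : ∀ X, K (K X) = -X) (hA : ∀ X, A X X = 0) (hAK : ∀ X Y, A (K X) (K Y) = - A X Y) (X : CC) : A X (K X) = 0 := by
  have h1 := anti_move hK hAK X X
  have h2 := alt_swap hA (K X) X
  linarith

noncomputable def frame (K : CC →L[ℝ] CC) (a b : CC) : CC →L[ℝ] CC :=
  (reCLM.comp (ContinuousLinearMap.fst ℝ ℂ ℂ)).smulRight a + (imCLM.comp (ContinuousLinearMap.fst ℝ ℂ ℂ)).smulRight (K a)
   + (reCLM.comp (ContinuousLinearMap.snd ℝ ℂ ℂ)).smulRight b + (imCLM.comp (ContinuousLinearMap.snd ℝ ℂ ℂ)).smulRight (K b)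

theorem frame_apply (K : CC →L[ℝ] CC) (a b x : CC) : frame K a b x = x.1.re • a + x.1.im • K a + x.2.re • b + x.2.im • K b := rfl

theorem frame_Icl {K : CC →L[ℝ] CC} (hK : ∀ X, K (K X) = -X) (a b x : CC) : K (frame K a b x) = frame K a b (Icl x) := by
  rw [frame_apply, frame_apply, Icl_apply]
  simp only [map_add, map_smul, hK]
  simp
  abel

theorem form_frame {A : BF} {K : CC →L[ℝ] CC} (hK : ∀ X, K (K X) = -X) (hA : ∀ X, A X X = 0) (hAK : ∀ X Y, A (K X) (K Y) = - A X Y) (a b Y Z : CC) :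
    A (frame K a b Y) (frame K a b Z) = ((Y.1 * Z.2 - Y.2 * Z.1) * ((A a b : ℂ) - I * (A (K a) b : ℂ))).re := by
  rw [frame_apply, frame_apply]
  have e1 := anti_self hK hA hAK a
  have e2 := anti_self hK hA hAK b
  have e3 : A (K a) a = 0 := by rw [anti_move hK hAK, e1]
  have e4 : A (K b) b = 0 := by rw [anti_move hK hAK, e2]
  have e5 : A a (K b) = A (K a) b := (anti_move hK hAK a b).symm
  have e6 : A b a = - A a b := alt_swap hA b a
  have e7 : A b (K a) = - A (K a) b := alt_swap hA _ _
  have e8 : A (K b) a = - A (K a) b := by rw [alt_swap hA, e5]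
  simp only [map_add, map_smul, add_apply, smul_apply, hA, hAK, e1, e2, e3, e4, e5, e6, e7, e8, smul_eq_mul]
  simp
  ring

theorem form_frame_bound {A : BF} {K : CC →L[ℝ] CC} (hK : ∀ X, K (K X) = -X) (hA : ∀ X, A X X = 0) (hAK : ∀ X Y, A (K X) (K Y) = - A X Y) (a b Y Z : CC) :
    ‖A (frame K a b Y) (frame K a b Z)‖ ≤ 2 * ‖(A a b : ℂ) - I * (A (K a) b : ℂ)‖ * ‖Y‖ * ‖Z‖ := by
  rw [form_frame hK hA hAK]
  refine (Complex.abs_re_le_norm _).trans ?_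
  rw [norm_mul]
  have h : ‖Y.1 * Z.2 - Y.2 * Z.1‖ ≤ 2 * ‖Y‖ * ‖Z‖ := by
    refine (norm_sub_le _ _).trans ?_
    rw [norm_mul, norm_mul]
    have h1 := mul_le_mul (norm_fst_le Y) (norm_snd_le Z) (norm_nonneg _) (norm_nonneg _)
    have h2 := mul_le_mul (norm_snd_le Y) (norm_fst_le Z) (norm_nonneg _) (norm_nonneg _)
    linarith
  have := mul_le_mul_of_nonneg_right h (norm_nonneg ((A a b : ℂ) - I * (A (K a) b : ℂ)))
  linarith

theorem op_trick {E : Type*} [NormedAddCommGroup E] [NormedSpace ℝ E] (T0 : CC ≃L[ℝ] CC) {T1 : CC →L[ℝ] CC}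
    (hT : ‖(T0 : CC →L[ℝ] CC) - T1‖ * ‖(T0.symm : CC →L[ℝ] CC)‖ ≤ 1 / 2) {L : CC →L[ℝ] E} {m : ℝ} (hm : 0 ≤ m) (hL : ∀ Y, ‖L (T1 Y)‖ ≤ m * ‖Y‖) :
    ‖L‖ ≤ 2 * m * ‖(T0.symm : CC →L[ℝ] CC)‖ := by
  have h1 : ‖L‖ ≤ m * ‖(T0.symm : CC →L[ℝ] CC)‖ + ‖L‖ * (1 / 2) := by
    refine L.opNorm_le_bound (by positivity) fun X => ?_
    have e : L X = L (T1 (T0.symm X)) + L (((T0 : CC →L[ℝ] CC) - T1) (T0.symm X)) := by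
      rw [← map_add]; congr 1
      simp
    rw [e]
    refine (norm_add_le _ _).trans ?_
    have h2 := hL (T0.symm X)
    have h3 : ‖T0.symm X‖ ≤ ‖(T0.symm : CC →L[ℝ] CC)‖ * ‖X‖ := (T0.symm : CC →L[ℝ] CC).le_opNorm X
    have h4 : ‖((T0 : CC →L[ℝ] CC) - T1) (T0.symm X)‖ ≤ ‖(T0 : CC →L[ℝ] CC) - T1‖ * (‖(T0.symm : CC →L[ℝ] CC)‖ * ‖X‖) :=
      (((T0 : CC →L[ℝ] CC) - T1).le_opNorm _).trans (by gcongr)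
    have h5 : ‖L (((T0 : CC →L[ℝ] CC) - T1) (T0.symm X))‖ ≤ ‖L‖ * (1 / 2 * ‖X‖) := by
      refine (L.le_opNorm _).trans (mul_le_mul_of_nonneg_left (h4.trans ?_) (norm_nonneg _))
      rw [← mul_assoc]; gcongr
    have h6 := mul_le_mul_of_nonneg_left h3 hm
    linarith
  linarith

theorem form_bound {A : BF} {K : CC →L[ℝ] CC} (hK : ∀ X, K (K X) = -X) (hA : ∀ X, A X X = 0) (hAK : ∀ X Y, A (K X) (K Y) = - A X Y) (a b : CC)
    (T0 : CC ≃L[ℝ] CC) (hT : ‖(T0 : CC →L[ℝ] CC) - frame K a b‖ * ‖(T0.symm : CC →L[ℝ] CC)‖ ≤ 1 / 2) :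
    ‖A‖ ≤ 8 * ‖(T0.symm : CC →L[ℝ] CC)‖ ^ 2 * ‖(A a b : ℂ) - I * (A (K a) b : ℂ)‖ := by
  set N := ‖(T0.symm : CC →L[ℝ] CC)‖
  set F := ‖(A a b : ℂ) - I * (A (K a) b : ℂ)‖ with hF
  have hF0 : 0 ≤ F := norm_nonneg _
  have h1 : ∀ Y, ‖A (frame K a b Y)‖ ≤ (2 * (2 * F) * N) * ‖Y‖ := by
    intro Y
    have := op_trick T0 hT (L := A (frame K a b Y)) (m := 2 * F * ‖Y‖) (by positivity) fun Z => form_frame_bound hK hA hAK a b Y Z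
    refine this.trans (le_of_eq ?_); ring
  have := op_trick T0 hT (L := A) (m := 2 * (2 * F) * N) (by positivity) h1
  refine this.trans (le_of_eq ?_); ring

theorem fderiv_form {α : CC → BF} {u w : CC → CC} {x : CC} {u' w' : CC →L[ℝ] CC} (hα : DifferentiableAt ℝ α x) (hu : HasFDerivAt u u' x) (hw : HasFDerivAt w w' x) :
    HasFDerivAt (fun y => α y (u y) (w y)) (fderiv ℝ (fun y => α y (u y) (w y)) x) x ∧
    ∀ v, fderiv ℝ (fun y => α y (u y) (w y)) x v = fderiv ℝ α x v (u x) (w x) + α x (u' v) (w x) + α x (u x) (w' v) := by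
  have h : HasFDerivAt (fun y => α y (u y) (w y)) _ x := (hα.hasFDerivAt.clm_apply hu).clm_apply hw
  refine ⟨h.differentiableAt.hasFDerivAt, fun v => ?_⟩
  rw [h.fderiv]
  simp
  ring

theorem exists_frame {K : CC →L[ℝ] CC} (hK : ∀ X, K (K X) = -X) : ∃ (a b : CC) (T : CC ≃L[ℝ] CC), (T : CC →L[ℝ] CC) = frame K a b := by
  set a : CC := (1, 0) with ha
  have ha0 : a ≠ 0 := by simp [ha]
  have hsp : Submodule.span ℝ ({a, K a} : Set CC) ≠ ⊤ := by
    intro h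
    have h1 : Module.finrank ℝ (Submodule.span ℝ ({a, K a} : Set CC)) ≤ 2 := by
      classical
      have := finrank_span_finset_le_card (R := ℝ) ({a, K a} : Finset CC)
      refine le_trans ?_ (this.trans Finset.card_le_two)
      rw [Finset.coe_pair]; exact le_rfl
    rw [h, finrank_top] at h1
    have : Module.finrank ℝ CC = 4 := by
      rw [Module.finrank_prod, Complex.finrank_real_complex]
    omega
  obtain ⟨b, -, hb⟩ := SetLike.exists_of_lt (lt_top_iff_ne_top.2 hsp)
  have hinj : Function.Injective (frame K a b) := by
    rw [injective_iff_map_eq_zero]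
    rintro ⟨z, w⟩ h
    have h2 : frame K a b (Icl (z, w)) = 0 := by rw [← frame_Icl hK, h, map_zero]
    rw [frame_apply] at h
    rw [frame_apply, Icl_apply] at h2
    simp at h h2
    have hw : w = 0 := by
      by_contra hw
      have hn : w.re ^ 2 + w.im ^ 2 ≠ 0 := by
        intro h0
        have h1 : w.re = 0 := by nlinarith [sq_nonneg w.re, sq_nonneg w.im]
        have h3 : w.im = 0 := by nlinarith [sq_nonneg w.re, sq_nonneg w.im]
        exact hw (Complex.ext h1 h3)
      have e : (w.re ^ 2 + w.im ^ 2) • b = (-(w.re * z.re + w.im * z.im)) • a + (w.im * z.re - w.re * z.im) • K a := by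
        have h3 : w.re • (z.re • a + z.im • K a + w.re • b + w.im • K b) - w.im • (-(z.im • a) + z.re • K a + -(w.im • b) + w.re • K b) = 0 := by
          rw [h, h2]; simp
        rw [← sub_eq_zero, ← h3]
        module
      have hmem : (w.re ^ 2 + w.im ^ 2) • b ∈ Submodule.span ℝ ({a, K a} : Set CC) := by
        rw [e]
        exact Submodule.add_mem _ (Submodule.smul_mem _ _ (Submodule.subset_span (by simp))) (Submodule.smul_mem _ _ (Submodule.subset_span (by simp)))
      exact hb ((Submodule.smul_mem_iff _ hn).1 hmem)
    subst hw
    simp at h h2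
    have hz : (z.re ^ 2 + z.im ^ 2) • a = 0 := by
      have h3 : z.re • (z.re • a + z.im • K a) - z.im • (-(z.im • a) + z.re • K a) = 0 := by
        rw [h, h2]; simp
      rw [← h3]; module
    have hn : z.re ^ 2 + z.im ^ 2 = 0 := by
      rcases smul_eq_zero.1 hz with h | h
      · exact h
      · exact absurd h ha0
    have h1 : z.re = 0 := by nlinarith [sq_nonneg z.re, sq_nonneg z.im]
    have h3 : z.im = 0 := by nlinarith [sq_nonneg z.re, sq_nonneg z.im]
    have : z = 0 := Complex.ext h1 h3
    rw [this]; rfl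
  refine ⟨a, b, (LinearEquiv.ofInjectiveEndo (frame K a b : CC →ₗ[ℝ] CC) hinj).toContinuousLinearEquiv, ?_⟩
  refine ContinuousLinearMap.ext fun x => rfl


theorem dbar_alg {A : BF} {K : CC →L[ℝ] CC} {D : CC →L[ℝ] BF} {DJ : CC →L[ℝ] CC →L[ℝ] CC} {a b : CC} {m : ℝ}
    {G H : CC →L[ℝ] ℝ}
    (hm : 1 ≤ m) (ha : ‖a‖ ≤ m) (hb : ‖b‖ ≤ m) (hKm : ‖K‖ ≤ m) (hDJ : ‖DJ‖ ≤ m)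
    (hcl : ∀ X Y Z, D X Y Z - D Y X Z + D Z X Y = 0)
    (hG : ∀ v, G v = D v a b) (hH : ∀ v, H v = D v (K a) b + A (DJ v a) b)
    (h1 : ∀ v, D v a (K a) + A a (DJ v a) = 0)
    (h2 : ∀ v, D v (K a) (K b) + A (DJ v a) (K b) + A (K a) (DJ v b) = - D v a b)
    (h3 : ∀ v, D v a (K b) + A a (DJ v b) = H v) :
    ‖((G a : ℂ) - I * (H a : ℂ)) + I * ((G (K a) : ℂ) - I * (H (K a) : ℂ))‖ ≤ 6 * ‖A‖ * m ^ 5 := by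
  have e1 : H a - G (K a) = A a (DJ b a) + A (DJ a a) b := by
    rw [hH, hG]; have := hcl a (K a) b; have := h1 b; linarith
  have e2 : G a + H (K a) = - A (DJ a a) (K b) - A (K a) (DJ a b) + A a (DJ (K a) b) - A a (DJ (K b) a) := by
    rw [hG, ← h3]; have := hcl a (K a) (K b); have := h1 (K b); have := h2 a; linarith
  have e3 : ((G a : ℂ) - I * (H a : ℂ)) + I * ((G (K a) : ℂ) - I * (H (K a) : ℂ)) = ((G a + H (K a) : ℝ) : ℂ) - I * ((H a - G (K a) : ℝ) : ℂ) := by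
    push_cast
    linear_combination (-(H (K a) : ℂ)) * I_mul_I
  have m0 : (0:ℝ) ≤ m := by linarith
  have bK : ∀ u (n : ℕ), ‖u‖ ≤ m ^ n → ‖K u‖ ≤ m ^ (n + 1) := fun u n hu => by
    refine (K.le_opNorm u).trans ?_
    rw [pow_succ']; gcongr
  have bD : ∀ u w (n k : ℕ), ‖u‖ ≤ m ^ n → ‖w‖ ≤ m ^ k → ‖DJ u w‖ ≤ m ^ (n + k + 1) := fun u w n k hu hw => by
    refine (DJ.le_opNorm₂ u w).trans ?_
    have : m ^ (n + k + 1) = m * m ^ n * m ^ k := by ring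
    rw [this]; gcongr
  have bA : ∀ u w (n k : ℕ), ‖u‖ ≤ m ^ n → ‖w‖ ≤ m ^ k → n + k ≤ 5 → |A u w| ≤ ‖A‖ * m ^ 5 := fun u w n k hu hw hn => by
    refine (A.le_opNorm₂ u w).trans ?_
    have : m ^ n * m ^ k ≤ m ^ 5 := by rw [← pow_add]; exact pow_le_pow_right₀ hm hn
    rw [mul_assoc]
    refine mul_le_mul_of_nonneg_left (le_trans ?_ this) (ContinuousLinearMap.opNorm_nonneg A)
    gcongr
  have ha' : ‖a‖ ≤ m ^ 1 := by simpa using ha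
  have hb' : ‖b‖ ≤ m ^ 1 := by simpa using hb
  have b1 := bA _ _ _ _ ha' (bD _ _ _ _ hb' ha') (by norm_num)
  have b2 := bA _ _ _ _ (bD _ _ _ _ ha' ha') hb' (by norm_num)
  have b3 := bA _ _ _ _ (bD _ _ _ _ ha' ha') (bK _ _ hb') (by norm_num)
  have b4 := bA _ _ _ _ (bK _ _ ha') (bD _ _ _ _ ha' hb') (by norm_num)
  have b5 := bA _ _ _ _ ha' (bD _ _ _ _ (bK _ _ ha') hb') (by norm_num)
  have b6 := bA _ _ _ _ ha' (bD _ _ _ _ (bK _ _ hb') ha') (by norm_num)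
  rw [e3]
  refine (norm_sub_le _ _).trans ?_
  rw [norm_mul, norm_I, one_mul, norm_real, norm_real, Real.norm_eq_abs, Real.norm_eq_abs, e1, e2]
  rw [abs_le] at b1 b2 b3 b4 b5 b6
  have c1 : |A a (DJ b a) + A (DJ a a) b| ≤ 2 * (‖A‖ * m ^ 5) := by rw [abs_le]; constructor <;> linarith
  have c2 : |- A (DJ a a) (K b) - A (K a) (DJ a b) + A a (DJ (K a) b) - A a (DJ (K b) a)| ≤ 4 * (‖A‖ * m ^ 5) := by rw [abs_le]; constructor <;> linarith
  linarith

noncomputable def ff (J : CC → CC →L[ℝ] CC) (α : CC → BF) (a b : CC) (y : CC) : ℂ := (α y a b : ℂ) - I * (α y (J y a) b : ℂ)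

structure Setup (U : Set CC) (J : CC → CC →L[ℝ] CC) (α : CC → BF) : Prop where
  op : IsOpen U
  sJ : ContDiffOn ℝ (⊤ : ℕ∞) J U
  hJ : ∀ x ∈ U, ∀ X, J x (J x X) = -X
  sa : ContDiffOn ℝ (⊤ : ℕ∞) α U
  alt : ∀ x ∈ U, ∀ X, α x X X = 0
  anti : ∀ x ∈ U, ∀ X Y, α x (J x X) (J x Y) = - α x X Y
  cl : ∀ x ∈ U, ∀ X Y Z, fderiv ℝ α x X Y Z - fderiv ℝ α x Y X Z + fderiv ℝ α x Z X Y = 0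

theorem fderiv_ff {J : CC → CC →L[ℝ] CC} {α : CC → BF} {x : CC} (hJ : DifferentiableAt ℝ J x) (hα : DifferentiableAt ℝ α x) (a b v : CC) :
    fderiv ℝ (ff J α a b) x v = (fderiv ℝ (fun y => α y a b) x v : ℂ) - I * (fderiv ℝ (fun y => α y (J y a) b) x v : ℂ) := by
  have hJa : HasFDerivAt (fun y => J y a) ((fderiv ℝ J x).flip a) x := by
    have := hJ.hasFDerivAt.clm_apply (hasFDerivAt_const a x)
    simpa using this
  have h1 := (fderiv_form hα (hasFDerivAt_const a x) (hasFDerivAt_const b x)).1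
  have h2 := (fderiv_form hα hJa (hasFDerivAt_const b x)).1
  have h3 : HasFDerivAt (ff J α a b) _ x := (ofRealCLM.hasFDerivAt.comp x h1).sub ((ofRealCLM.hasFDerivAt.comp x h2).const_mul I)
  rw [h3.fderiv]
  rfl

theorem dbar_a {U : Set CC} {J : CC → CC →L[ℝ] CC} {α : CC → BF} (S : Setup U J α) {x : CC} (hx : x ∈ U) {a b : CC} {m : ℝ} (hm : 1 ≤ m) (ha : ‖a‖ ≤ m) (hb : ‖b‖ ≤ m)
    (hKm : ‖J x‖ ≤ m) (hDJ : ‖fderiv ℝ J x‖ ≤ m) :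
    ‖fderiv ℝ (ff J α a b) x a + I * fderiv ℝ (ff J α a b) x (J x a)‖ ≤ 6 * ‖α x‖ * m ^ 5 := by
  have hU : U ∈ nhds x := S.op.mem_nhds hx
  have dJ : DifferentiableAt ℝ J x := (S.sJ.contDiffAt hU).differentiableAt (by simp)
  have dα : DifferentiableAt ℝ α x := (S.sa.contDiffAt hU).differentiableAt (by simp)
  have hc : ∀ c : CC, HasFDerivAt (fun y => J y c) ((fderiv ℝ J x).flip c) x := fun c => by
    have := dJ.hasFDerivAt.clm_apply (hasFDerivAt_const c x)
    simpa using this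
  rw [fderiv_ff dJ dα, fderiv_ff dJ dα]
  refine dbar_alg (D := fderiv ℝ α x) (DJ := fderiv ℝ J x) hm ha hb hKm hDJ (S.cl x hx) ?_ ?_ ?_ ?_ ?_
  · intro v
    rw [(fderiv_form dα (hasFDerivAt_const a x) (hasFDerivAt_const b x)).2]; simp
  · intro v
    rw [(fderiv_form dα (hc a) (hasFDerivAt_const b x)).2]; simp
  · intro v
    have h := (fderiv_form dα (hasFDerivAt_const a x) (hc a)).2 v
    have e : (fun y => α y a (J y a)) =ᶠ[nhds x] fun _ => 0 := by
      filter_upwards [hU] with y hy using anti_self (S.hJ y hy) (S.alt y hy) (S.anti y hy) a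
    rw [e.fderiv_eq] at h
    simp at h
    exact h.symm
  · intro v
    have h := (fderiv_form dα (hc a) (hc b)).2 v
    have h' := (fderiv_form dα (hasFDerivAt_const a x) (hasFDerivAt_const b x)).2 v
    have e : (fun y => α y (J y a) (J y b)) =ᶠ[nhds x] fun y => - α y a b := by
      filter_upwards [hU] with y hy using S.anti y hy a b
    rw [e.fderiv_eq, fderiv_fun_neg, neg_apply, h'] at h
    simp at h
    exact h.symm
  · intro v
    have h := (fderiv_form dα (hasFDerivAt_const a x) (hc b)).2 v
    have e : (fun y => α y a (J y b)) =ᶠ[nhds x] fun y => α y (J y a) b := by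
      filter_upwards [hU] with y hy using (anti_move (S.hJ y hy) (S.anti y hy) a b).symm
    rw [e.fderiv_eq] at h
    rw [h]; simp

theorem ff_swap {U : Set CC} {J : CC → CC →L[ℝ] CC} {α : CC → BF} (S : Setup U J α) {y : CC} (hy : y ∈ U) (a b : CC) : ff J α a b y = - ff J α b a y := by
  simp only [ff]
  rw [alt_swap (S.alt y hy) a b, alt_swap (S.alt y hy) (J y a) b, ← anti_move (S.hJ y hy) (S.anti y hy) b a]
  push_cast; ring

theorem dbar_b {U : Set CC} {J : CC → CC →L[ℝ] CC} {α : CC → BF} (S : Setup U J α) {x : CC} (hx : x ∈ U) {a b : CC} {m : ℝ} (hm : 1 ≤ m) (ha : ‖a‖ ≤ m) (hb : ‖b‖ ≤ m)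
    (hKm : ‖J x‖ ≤ m) (hDJ : ‖fderiv ℝ J x‖ ≤ m) :
    ‖fderiv ℝ (ff J α a b) x b + I * fderiv ℝ (ff J α a b) x (J x b)‖ ≤ 6 * ‖α x‖ * m ^ 5 := by
  have e : ff J α a b =ᶠ[nhds x] fun y => - ff J α b a y := by
    filter_upwards [S.op.mem_nhds hx] with y hy using ff_swap S hy a b
  rw [e.fderiv_eq, fderiv_fun_neg, neg_apply, neg_apply, mul_neg, ← neg_add, norm_neg]
  exact dbar_a S hx hm hb ha hKm hDJ

theorem dbar_frame {U : Set CC} {J : CC → CC →L[ℝ] CC} {α : CC → BF} (S : Setup U J α) {x : CC} (hx : x ∈ U) {a b : CC} {m : ℝ} (hm : 1 ≤ m) (ha : ‖a‖ ≤ m) (hb : ‖b‖ ≤ m)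
    (hKm : ‖J x‖ ≤ m) (hDJ : ‖fderiv ℝ J x‖ ≤ m)
    (T0 : CC ≃L[ℝ] CC) (hT : ‖(T0 : CC →L[ℝ] CC) - frame (J x) a b‖ * ‖(T0.symm : CC →L[ℝ] CC)‖ ≤ 1 / 2) (X : CC) :
    ‖fderiv ℝ (ff J α a b) x X + I * fderiv ℝ (ff J α a b) x (J x X)‖ ≤ (2 * (24 * m ^ 5 * (8 * ‖(T0.symm : CC →L[ℝ] CC)‖ ^ 2)) * ‖(T0.symm : CC →L[ℝ] CC)‖) * ‖ff J α a b x‖ * ‖X‖ := by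
  set L : CC →L[ℝ] ℂ := fderiv ℝ (ff J α a b) x + I • (fderiv ℝ (ff J α a b) x).comp (J x) with hL
  have hLa : ∀ X, L X = fderiv ℝ (ff J α a b) x X + I * fderiv ℝ (ff J α a b) x (J x X) := fun X => rfl
  have hLJ : ∀ X, L (J x X) = - I * L X := fun X => by
    rw [hLa, hLa, S.hJ x hx, map_neg]; linear_combination (fderiv ℝ (ff J α a b) x (J x X)) * I_mul_I
  have hLJn : ∀ X, ‖L (J x X)‖ = ‖L X‖ := fun X => by rw [hLJ, norm_mul]; simp
  have h1 := dbar_a S hx hm ha hb hKm hDJ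
  have h2 := dbar_b S hx hm ha hb hKm hDJ
  rw [← hLa] at h1 h2
  have h3 := form_bound (S.hJ x hx) (S.alt x hx) (S.anti x hx) a b T0 hT
  have m0 : (0:ℝ) ≤ m := by linarith
  have h4 : ∀ Y, ‖L (frame (J x) a b Y)‖ ≤ (24 * ‖α x‖ * m ^ 5) * ‖Y‖ := fun Y => by
    rw [frame_apply]
    simp only [map_add, map_smul]
    have n1 : ‖Y.1.re • L a‖ ≤ ‖Y‖ * (6 * ‖α x‖ * m ^ 5) := by
      rw [norm_smul]; exact mul_le_mul ((Complex.abs_re_le_norm _).trans (norm_fst_le Y)) h1 (norm_nonneg _) (norm_nonneg _)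
    have n2 : ‖Y.1.im • L (J x a)‖ ≤ ‖Y‖ * (6 * ‖α x‖ * m ^ 5) := by
      rw [norm_smul, hLJn]; exact mul_le_mul ((Complex.abs_im_le_norm _).trans (norm_fst_le Y)) h1 (norm_nonneg _) (norm_nonneg _)
    have n3 : ‖Y.2.re • L b‖ ≤ ‖Y‖ * (6 * ‖α x‖ * m ^ 5) := by
      rw [norm_smul]; exact mul_le_mul ((Complex.abs_re_le_norm _).trans (norm_snd_le Y)) h2 (norm_nonneg _) (norm_nonneg _)
    have n4 : ‖Y.2.im • L (J x b)‖ ≤ ‖Y‖ * (6 * ‖α x‖ * m ^ 5) := by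
      rw [norm_smul, hLJn]; exact mul_le_mul ((Complex.abs_im_le_norm _).trans (norm_snd_le Y)) h2 (norm_nonneg _) (norm_nonneg _)
    refine (norm_add_le _ _).trans ?_
    have q1 := norm_add_le (Y.1.re • L a + Y.1.im • L (J x a)) (Y.2.re • L b)
    have q2 := norm_add_le (Y.1.re • L a) (Y.1.im • L (J x a))
    linarith
  have h5 := op_trick T0 hT (L := L) (m := 24 * ‖α x‖ * m ^ 5) (by positivity) h4
  rw [← hLa]
  refine (L.le_opNorm X).trans (mul_le_mul_of_nonneg_right (h5.trans ?_) (norm_nonneg _))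
  have h6 : ‖α x‖ ≤ 8 * ‖(T0.symm : CC →L[ℝ] CC)‖ ^ 2 * ‖ff J α a b x‖ := h3
  calc 2 * (24 * ‖α x‖ * m ^ 5) * ‖(T0.symm : CC →L[ℝ] CC)‖ ≤ 2 * (24 * (8 * ‖(T0.symm : CC →L[ℝ] CC)‖ ^ 2 * ‖ff J α a b x‖) * m ^ 5) * ‖(T0.symm : CC →L[ℝ] CC)‖ := by gcongr
    _ = _ := by ring

theorem cutoff {E : Type*} [NormedAddCommGroup E] [NormedSpace ℝ E] {G : CC → E} {R : ℝ} (hR : 0 < R) (hG : ContDiffOn ℝ (⊤ : ℕ∞) G (ball 0 R)) :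
    ∃ G' : CC → E, ContDiff ℝ (⊤ : ℕ∞) G' ∧ ∀ x ∈ ball (0:CC) (R / 4), G' x = G x := by
  let χ : ContDiffBump (0:CC) := ⟨R / 4, R / 2, by linarith, by linarith⟩
  refine ⟨fun x => χ x • G x, ?_, fun x hx => ?_⟩
  · rw [contDiff_iff_contDiffAt]
    intro x
    by_cases hx : x ∈ ball (0:CC) R
    · exact χ.contDiff.contDiffAt.smul (hG.contDiffAt (isOpen_ball.mem_nhds hx))
    · have : (fun x => χ x • G x) =ᶠ[nhds x] fun _ => 0 := by
        have h : (closedBall (0:CC) (R / 2))ᶜ ∈ nhds x := by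
          refine isClosed_closedBall.isOpen_compl.mem_nhds ?_
          simp at hx ⊢; linarith
        filter_upwards [h] with y hy
        have : χ y = 0 := χ.zero_of_le_dist (by simp at hy ⊢; exact hy.le)
        rw [this, zero_smul]
      exact contDiffAt_const.congr_of_eventuallyEq this
  · have : χ x = 1 := χ.one_of_mem_closedBall (ball_subset_closedBall hx)
    simp [this]


theorem frame_cont {J : CC → CC →L[ℝ] CC} {p : CC} (hJ : ContinuousAt J p) (a b : CC) : ContinuousAt (fun y => frame (J y) a b) p := by
  have h : ∀ c, ContinuousAt (fun y => J y c) p := fun c => hJ.clm_apply continuousAt_const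
  have h2 : ∀ (φ : CC →L[ℝ] ℝ) c, ContinuousAt (fun y => φ.smulRight (J y c)) p := fun φ c =>
    (ContinuousLinearMap.smulRightL ℝ CC CC φ).continuous.continuousAt.comp (h c)
  unfold frame
  exact ((continuousAt_const.add (h2 _ _)).add continuousAt_const).add (h2 _ _)

theorem ff_smooth {U : Set CC} {J : CC → CC →L[ℝ] CC} {α : CC → BF} (S : Setup U J α) (a b : CC) : ContDiffOn ℝ (⊤ : ℕ∞) (ff J α a b) U := by
  have h1 : ContDiffOn ℝ (⊤ : ℕ∞) (fun y => α y a b) U := (S.sa.clm_apply contDiffOn_const).clm_apply contDiffOn_const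
  have h2 : ContDiffOn ℝ (⊤ : ℕ∞) (fun y => α y (J y a) b) U := (S.sa.clm_apply (S.sJ.clm_apply contDiffOn_const)).clm_apply contDiffOn_const
  exact (ofRealCLM.contDiff.comp_contDiffOn h1).sub (contDiffOn_const.mul (ofRealCLM.contDiff.comp_contDiffOn h2))

theorem ev_norm_lt {E : Type*} [NormedAddCommGroup E] {g : CC → E} {p : CC} {m : ℝ} (hg : ContinuousAt g p) (h : ‖g p‖ < m) : ∀ᶠ y in nhds p, ‖g y‖ < m :=
  hg.norm.eventually_lt continuousAt_const h

theorem local_model {U : Set CC} {J : CC → CC →L[ℝ] CC} {α : CC → BF} (S : Setup U J α) {p : CC} (hp : p ∈ U) :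
    ∃ (T : CC ≃L[ℝ] CC) (J' : CC → CC →L[ℝ] CC) (f : CC → ℂ) (C ρ : ℝ), ContDiff ℝ (⊤ : ℕ∞) J' ∧ J' 0 = Icl ∧ Sm f ∧ 0 < ρ ∧
      (∀ x ∈ ball (0:CC) ρ, ∀ X, ‖fderiv ℝ f x X + I * fderiv ℝ f x (J' x X)‖ ≤ C * ‖f x‖ * ‖X‖) ∧
      ∀ x ∈ ball (0:CC) ρ, p + T x ∈ U ∧ (f x = 0 ↔ α (p + T x) = 0) := by
  have hU : U ∈ nhds p := S.op.mem_nhds hp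
  obtain ⟨a, b, T, hTf⟩ := exists_frame (S.hJ p hp)
  set N := ‖(T.symm : CC →L[ℝ] CC)‖ with hN
  set m := 1 + ‖a‖ + ‖b‖ + (‖J p‖ + 1) + (‖fderiv ℝ J p‖ + 1) with hmdef
  have na := norm_nonneg a
  have nb := norm_nonneg b
  have nJ : 0 ≤ ‖J p‖ := norm_nonneg _
  have nD : 0 ≤ ‖fderiv ℝ J p‖ := ContinuousLinearMap.opNorm_nonneg _
  have hm : 1 ≤ m := by linarith
  have cJ : ContinuousAt J p := (S.sJ.contDiffAt hU).continuousAt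
  have cD : ContinuousAt (fderiv ℝ J) p := ((S.sJ.contDiffAt hU).fderiv_right (m := 0) (by norm_cast)).continuousAt
  have E1 : ∀ᶠ y in nhds p, ‖J y‖ < m := cJ.norm.eventually_lt continuousAt_const (by linarith)
  have E2 : ∀ᶠ y in nhds p, ‖fderiv ℝ J y‖ < m := by
    have h : ‖fderiv ℝ J p‖ < m := by linarith
    exact ev_norm_lt (E := CC →L[ℝ] CC →L[ℝ] CC) cD h
  have E3 : ∀ᶠ y in nhds p, ‖(T : CC →L[ℝ] CC) - frame (J y) a b‖ * N < 1 / 2 := by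
    have c : ContinuousAt (fun y => ‖(T : CC →L[ℝ] CC) - frame (J y) a b‖ * N) p :=
      ((continuousAt_const.sub (frame_cont cJ a b)).norm).mul continuousAt_const
    refine c.eventually_lt continuousAt_const ?_
    rw [hTf]; simp
  have cS : Filter.Tendsto (fun x : CC => p + T x) (nhds 0) (nhds p) := by
    have : ContinuousAt (fun x : CC => p + T x) 0 := (continuous_const.add T.continuous).continuousAt
    simpa [ContinuousAt] using this
  obtain ⟨R, hR, hball⟩ := Metric.eventually_nhds_iff_ball.1 (cS.eventually (((E1.and E2).and E3).and hU))
  have sS : ContDiff ℝ (⊤ : ℕ∞) (fun x : CC => p + T x) := contDiff_const.add T.contDiff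
  obtain ⟨f, sf, ef⟩ := cutoff (G := fun x => ff J α a b (p + T x)) hR ((ff_smooth S a b).comp sS.contDiffOn fun x hx => (hball x hx).2)
  obtain ⟨J', sJ', eJ'⟩ := cutoff (G := fun x => (T.symm : CC →L[ℝ] CC).comp ((J (p + T x)).comp (T : CC →L[ℝ] CC))) hR
    (contDiffOn_const.clm_comp ((S.sJ.comp sS.contDiffOn fun x hx => (hball x hx).2).clm_comp contDiffOn_const))
  refine ⟨T, J', f, (2 * (24 * m ^ 5 * (8 * N ^ 2)) * N) * ‖(T : CC →L[ℝ] CC)‖, R / 4, sJ', ?_, sf, by positivity, ?_, ?_⟩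
  · rw [eJ' 0 (mem_ball_self (by positivity))]
    refine ContinuousLinearMap.ext fun x => ?_
    simp only [ContinuousLinearMap.comp_apply, map_zero, add_zero]
    rw [hTf, frame_Icl (S.hJ p hp), ← hTf]
    simp
  · intro x hx X
    have hxR : x ∈ ball (0:CC) R := ball_subset_ball (by linarith) hx
    obtain ⟨⟨⟨b1, b2⟩, b3⟩, b4⟩ := hball x hxR
    have hd : ∀ X, fderiv ℝ f x X = fderiv ℝ (ff J α a b) (p + T x) (T X) := fun X => by
      have e : f =ᶠ[nhds x] fun x => ff J α a b (p + T x) := by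
        filter_upwards [isOpen_ball.mem_nhds hx] with y hy using ef y hy
      have h1 : HasFDerivAt (fun x : CC => p + T x) (T : CC →L[ℝ] CC) x := (T : CC →L[ℝ] CC).hasFDerivAt.const_add p
      have h2 : HasFDerivAt (ff J α a b) (fderiv ℝ (ff J α a b) (p + T x)) (p + T x) :=
        (((ff_smooth S a b).contDiffAt (S.op.mem_nhds b4)).differentiableAt (by simp)).hasFDerivAt
      have h3 : HasFDerivAt (fun x => ff J α a b (p + T x)) ((fderiv ℝ (ff J α a b) (p + T x)).comp (T : CC →L[ℝ] CC)) x := HasFDerivAt.comp (g := ff J α a b) x h2 h1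
      rw [e.fderiv_eq, h3.fderiv]
      rfl
    rw [hd, hd, eJ' x hx, ef x hx]
    have e2 : T (((T.symm : CC →L[ℝ] CC).comp ((J (p + T x)).comp (T : CC →L[ℝ] CC))) X) = J (p + T x) (T X) := by simp
    rw [e2]
    have := dbar_frame S b4 (a := a) (b := b) hm (by linarith) (by linarith) b1.le b2.le T b3.le (T X)
    refine this.trans ?_
    have h5 : ‖T X‖ ≤ ‖(T : CC →L[ℝ] CC)‖ * ‖X‖ := (T : CC →L[ℝ] CC).le_opNorm X
    calc _ ≤ (2 * (24 * m ^ 5 * (8 * N ^ 2)) * N) * ‖ff J α a b (p + T x)‖ * (‖(T : CC →L[ℝ] CC)‖ * ‖X‖) :=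
          mul_le_mul_of_nonneg_left h5 (by positivity)
      _ = _ := by ring
  · intro x hx
    have hxR : x ∈ ball (0:CC) R := ball_subset_ball (by linarith) hx
    obtain ⟨⟨⟨b1, b2⟩, b3⟩, b4⟩ := hball x hxR
    refine ⟨b4, ?_⟩
    rw [ef x hx]
    constructor
    · intro h
      have := form_bound (S.hJ _ b4) (S.alt _ b4) (S.anti _ b4) a b T b3.le
      have h' : ‖(α (p + T x) a b : ℂ) - I * (α (p + T x) (J (p + T x) a) b : ℂ)‖ = 0 := by
        rw [norm_eq_zero]; exact h
      rw [h', mul_zero] at this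
      exact (ContinuousLinearMap.opNorm_zero_iff _).1 (le_antisymm this (ContinuousLinearMap.opNorm_nonneg _))
    · intro h
      simp [ff, h]


theorem Dl_open_zero {f : CC → ℂ} {V : Set CC} (hV : IsOpen V) (h : ∀ x ∈ V, f x = 0) (l : List CC) : ∀ x ∈ V, Dl l f x = 0 := by
  induction l generalizing f with
  | nil => exact h
  | cons v l ih =>
    refine ih fun x hx => ?_
    have e : f =ᶠ[nhds x] fun _ => 0 := by
      filter_upwards [hV.mem_nhds hx] with y hy using h y hy
    simp [Dv, e.fderiv_eq]

theorem tend_shift (p : CC) (T : CC ≃L[ℝ] CC) : Filter.Tendsto (fun y : CC => T.symm (y - p)) (nhds p) (nhds 0) := by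
  have : ContinuousAt (fun y : CC => T.symm (y - p)) p := (T.symm.continuous.comp (continuous_id.sub continuous_const)).continuousAt
  simpa [ContinuousAt] using this

/-- dichotomy at a limit point of the interior of the zero set. -/
theorem closure_step {U : Set CC} {J : CC → CC →L[ℝ] CC} {α : CC → BF} (S : Setup U J α) {p : CC} (hp : p ∈ U)
    (hc : p ∈ closure {q | ∀ᶠ x in nhds q, α x = 0}) : ∀ᶠ x in nhds p, α x = 0 := by
  obtain ⟨T, J', f, C, ρ, hJ', hJ0, hf, hρ, hE, hz⟩ := local_model S hp
  have ht := tend_shift p T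
  have hflat : ∀ k, flat k f 0 := by
    intro k l _
    set W := {q | ∀ᶠ x in nhds q, α x = 0} with hW
    have hWo : IsOpen W := isOpen_iff_mem_nhds.2 fun q hq => hq.eventually_nhds
    have hcS : Continuous (fun x : CC => p + T x) := continuous_const.add T.continuous
    set V := (fun x : CC => p + T x) ⁻¹' W ∩ ball 0 ρ with hV
    have hVo : IsOpen V := (hWo.preimage hcS).inter isOpen_ball
    have hVz : ∀ x ∈ V, f x = 0 := fun x hx => (hz x hx.2).2.2 hx.1.self_of_nhds
    have h0 : (0:CC) ∈ closure V := by
      rw [mem_closure_iff_nhds]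
      intro N hN
      have h1 := ht (Filter.inter_mem hN (ball_mem_nhds 0 hρ))
      obtain ⟨y, hy, hyW⟩ := mem_closure_iff_nhds.1 hc _ h1
      refine ⟨T.symm (y - p), hy.1, ?_, hy.2⟩
      simpa using hyW
    have hcl : IsClosed {x | Dl l f x = 0} := isClosed_eq (hf.dl l).continuous continuous_const
    exact closure_minimal (fun x hx => Dl_open_zero hVo hVz l x hx) hcl h0
  have h := sucp hJ' hJ0 hf hρ hE fun N => by
    obtain ⟨C', _, hC'⟩ := flat_bound hf (hflat N)
    exact ⟨C', fun x hx => by simpa using hC' x (by simpa using hx)⟩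
  filter_upwards [ht.eventually h, ht (ball_mem_nhds 0 hρ)] with y hy hyb
  have := (hz _ hyb).2.1 hy
  simpa using this

theorem meas_near {U : Set CC} {J : CC → CC →L[ℝ] CC} {α : CC → BF} (S : Setup U J α) {p : CC} (hp : p ∈ U)
    (hn : ¬ ∀ᶠ x in nhds p, α x = 0) : ∃ N ∈ nhds p, μH[2] ({x | α x = 0} ∩ N) < ⊤ := by
  obtain ⟨T, J', f, C, ρ, hJ', hJ0, hf, hρ, hE, hz⟩ := local_model S hp
  have ht := tend_shift p T
  have hex : ∃ k, ¬ flat k f 0 := by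
    by_contra hcon
    push Not at hcon
    have h := sucp hJ' hJ0 hf hρ hE fun N => by
      obtain ⟨C', _, hC'⟩ := flat_bound hf (hcon N)
      exact ⟨C', fun x hx => by simpa using hC' x (by simpa using hx)⟩
    apply hn
    filter_upwards [ht.eventually h, ht (ball_mem_nhds 0 hρ)] with y hy hyb
    have := (hz _ hyb).2.1 hy
    simpa using this
  classical
  obtain ⟨k, hk, hnk⟩ : ∃ k, flat k f 0 ∧ ¬ flat (k + 1) f 0 := by
    have h1 := Nat.find_spec hex
    have h0 : Nat.find hex ≠ 0 := by
      intro h0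
      rw [h0] at h1
      exact h1 fun l hl => absurd hl (by simp)
    obtain ⟨k, hk⟩ := Nat.exists_eq_succ_of_ne_zero h0
    refine ⟨k, ?_, ?_⟩
    · by_contra h2
      have := Nat.find_min' hex h2
      omega
    · rw [hk] at h1; exact h1
  obtain ⟨δ, hδ, hfin⟩ := meas_model hJ' hJ0 hf hρ hE hk hnk
  refine ⟨(fun y : CC => T.symm (y - p)) ⁻¹' (ball 0 δ ∩ ball 0 ρ), ht (Filter.inter_mem (ball_mem_nhds 0 hδ) (ball_mem_nhds 0 hρ)), ?_⟩
  have hlip : LipschitzWith ‖(T : CC →L[ℝ] CC)‖₊ (fun x : CC => p + T x) := by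
    refine LipschitzWith.of_dist_le_mul fun x y => ?_
    rw [dist_add_left]
    exact (T : CC →L[ℝ] CC).lipschitz.dist_le_mul x y
  have hsub : {x | α x = 0} ∩ (fun y : CC => T.symm (y - p)) ⁻¹' (ball 0 δ ∩ ball 0 ρ) ⊆ (fun x : CC => p + T x) '' ({x | f x = 0} ∩ ball 0 δ) := by
    rintro y ⟨hy, hy1, hy2⟩
    refine ⟨T.symm (y - p), ⟨?_, hy1⟩, by simp⟩
    refine (hz _ hy2).2.2 ?_
    simpa using hy
  refine (measure_mono hsub).trans_lt ((hlip.lipschitzOnWith.hausdorffMeasure_image_le (by norm_num)).trans_lt ?_)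
  exact ENNReal.mul_lt_top (ENNReal.rpow_lt_top_of_nonneg (by norm_num) (by simp)) hfin

theorem main_setup {U : Set CC} {J : CC → CC →L[ℝ] CC} {α : CC → BF} (S : Setup U J α) (hconn : IsConnected U) (hne : ∃ x ∈ U, α x ≠ 0) :
    (∃ C : Set CC, IsClosed C ∧ {x ∈ U | α x = 0} = C ∩ U) ∧
    (∀ K : Set CC, K ⊆ U → IsCompact K → μH[2] ({x ∈ U | α x = 0} ∩ K) < ⊤) ∧
    dimH {x ∈ U | α x = 0} ≤ 2 := by
  have hno : ∀ p ∈ U, ¬ ∀ᶠ x in nhds p, α x = 0 := by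
    intro p hp hpz
    have hWo : IsOpen {q | ∀ᶠ x in nhds q, α x = 0} := isOpen_iff_mem_nhds.2 fun q hq => hq.eventually_nhds
    have := hconn.isPreconnected.subset_of_closure_inter_subset hWo ⟨p, hp, hpz⟩ fun q hq => closure_step S hq.2 hq.1
    obtain ⟨x, hx, hx0⟩ := hne
    exact hx0 (this hx).self_of_nhds
  have hN : ∀ p ∈ U, ∃ N ∈ nhds p, μH[2] ({x ∈ U | α x = 0} ∩ N) < ⊤ := fun p hp => by
    obtain ⟨N, hN, h⟩ := meas_near S hp (hno p hp)
    exact ⟨N, hN, (measure_mono (Set.inter_subset_inter_left _ fun x hx => hx.2)).trans_lt h⟩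
  refine ⟨?_, ?_, ?_⟩
  · have ho : IsOpen (U ∩ α ⁻¹' {0}ᶜ) := S.sa.continuousOn.isOpen_inter_preimage S.op isOpen_compl_singleton
    refine ⟨(U ∩ α ⁻¹' {0}ᶜ)ᶜ, ho.isClosed_compl, ?_⟩
    ext x
    simp only [Set.mem_setOf_eq, Set.mem_inter_iff, Set.mem_compl_iff, Set.mem_preimage, Set.mem_singleton_iff]
    tauto
  · intro K hKU hK
    refine hK.induction_on (p := fun K => μH[2] ({x ∈ U | α x = 0} ∩ K) < ⊤) (by simp) ?_ ?_ ?_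
    · intro s t hst ht
      exact (measure_mono (Set.inter_subset_inter_right _ hst)).trans_lt ht
    · intro s t hs ht
      rw [Set.inter_union_distrib_left]
      exact (measure_union_le _ _).trans_lt (ENNReal.add_lt_top.2 ⟨hs, ht⟩)
    · intro x hx
      obtain ⟨N, hN, h⟩ := hN x (hKU hx)
      exact ⟨N, mem_nhdsWithin_of_mem_nhds hN, h⟩
  · choose! N hN1 hN2 using hN
    obtain ⟨t, htU, htc, hcov⟩ := TopologicalSpace.countable_cover_nhdsWithin (f := N) (s := U) fun x hx => mem_nhdsWithin_of_mem_nhds (hN1 x hx)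
    have hsub : {x ∈ U | α x = 0} ⊆ ⋃ i ∈ t, ({x ∈ U | α x = 0} ∩ N i) := by
      intro x hx
      obtain ⟨i, hi, hxi⟩ := Set.mem_iUnion₂.1 (hcov hx.1)
      exact Set.mem_iUnion₂.2 ⟨i, hi, hx, hxi⟩
    refine (dimH_mono hsub).trans ?_
    rw [dimH_bUnion htc]
    refine iSup₂_le fun i hi => ?_
    have h := dimH_le_of_hausdorffMeasure_ne_top (d := 2) (s := {x ∈ U | α x = 0} ∩ N i) (by exact_mod_cast (hN2 i (htU hi)).ne)
    exact_mod_cast h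


/-- local form of Proposition 2.1 of the paper: the zero set of a
nontrivial closed `J`-anti-invariant 2-form on a connected open set `U ⊆ ℂ²` is closed
in `U`, has locally finite 2-dimensional Hausdorff measure, and has Hausdorff
dimension at most 2. -/
theorem zero_set_hausdorff_measure_finite
    (U : Set (ℂ × ℂ)) (hU : IsOpen U) (hconn : IsConnected U)
    (J : ℂ × ℂ → (ℂ × ℂ →L[ℝ] ℂ × ℂ)) (hJ : IsAlmostComplexOn J U)
    (α : ℂ × ℂ → (ℂ × ℂ →L[ℝ] ℂ × ℂ →L[ℝ] ℝ))
    (hα : IsTwoFormOn α U) (hαJ : IsJAntiInvariantOn J α U)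
    (hαcl : IsClosedTwoFormOn α U)
    (hne : ∃ x ∈ U, α x ≠ 0) :
    (∃ C : Set (ℂ × ℂ), IsClosed C ∧ {x ∈ U | α x = 0} = C ∩ U) ∧
    (∀ K : Set (ℂ × ℂ), K ⊆ U → IsCompact K →
      μH[2] ({x ∈ U | α x = 0} ∩ K) < ⊤) ∧
    dimH {x ∈ U | α x = 0} ≤ 2 := by
  exact main_setup ⟨hU, hJ.1, hJ.2, hα.1, hα.2, hαJ, hαcl⟩ hconn hne
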